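/- arXiv:2505.12156 — 2 statements merged into one kernel-verified Lean document; each statement's English description precedes it below -/
import Mathlib

section
/- Let G be a finite undirected graph with vertex set K, without loops or multiple edges, such that the K×K matrix 2·Id − Adj(G) is positive definite (i.e. G is a possibly disconnected finite-type ADE Dynkin diagram). Then for every dimension vector v : K → ℕ, the fixed subalgebra of the GL(v)-action on the coordinate ring ℂ[Rep(Π,v)] = R_v/I_v of the representation scheme of the preprojective algebra Π is exactly ℂ·1; that is, every GL(v)-invariant element of R_v/I_v is a scalar multiple of the identity. (Hence the affine quiver scheme Rep(Π,v) // GL(v) is a reduced point.) -/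
noncomputable section

open scoped BigOperators MatrixGroups

namespace Stmt0

variable {K : Type} [Fintype K] [DecidableEq K]

/-- Arrows of the double quiver of a simple graph: an arrow `⟨(i,j), h⟩` goes from `i` to `j`. -/
def Arrow (G : SimpleGraph K) : Type := {p : K × K // G.Adj p.1 p.2}

/-- Source of an arrow. -/
abbrev src {G : SimpleGraph K} (a : Arrow G) : K := a.1.1

/-- Target of an arrow. -/
abbrev tgt {G : SimpleGraph K} (a : Arrow G) : K := a.1.2

/-- The reverse arrow `a*`. -/
def star {G : SimpleGraph K} (a : Arrow G) : Arrow G := ⟨(a.1.2, a.1.1), a.2.symm⟩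

/-- Index type of the variables `x^a_{p,q}`. -/
def Var (G : SimpleGraph K) (v : K → ℕ) : Type :=
  Σ a : Arrow G, Fin (v (tgt a)) × Fin (v (src a))

/-- The polynomial ring `R_v`. -/
abbrev R (G : SimpleGraph K) (v : K → ℕ) : Type := MvPolynomial (Var G v) ℂ

/-- The generic matrix `X_a`. -/
def X (G : SimpleGraph K) (v : K → ℕ) (a : Arrow G) :
    Matrix (Fin (v (tgt a))) (Fin (v (src a))) (R G v) :=
  fun p q => MvPolynomial.X ⟨a, (p, q)⟩

/-- Preprojective relation matrix at vertex `i`: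
`∑_{a : t(a) = i} ε(a) • X_a * X_{a*}`. -/
def relMat (G : SimpleGraph K) [DecidableRel G.Adj] (v : K → ℕ) (ε : Arrow G → ℂ) (i : K) :
    Matrix (Fin (v i)) (Fin (v i)) (R G v) :=
  ∑ j : K,
    if h : G.Adj j i then
      ε ⟨(j, i), h⟩ •
        ((X G v ⟨(j, i), h⟩ : Matrix (Fin (v i)) (Fin (v j)) (R G v)) *
          (X G v ⟨(i, j), h.symm⟩ : Matrix (Fin (v j)) (Fin (v i)) (R G v)))
    else 0

/-- The ideal `I_v` generated by the entries of the preprojective relation matrices. -/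
def Irel (G : SimpleGraph K) [DecidableRel G.Adj] (v : K → ℕ) (ε : Arrow G → ℂ) :
    Ideal (R G v) :=
  Ideal.span {f | ∃ (i : K) (p q : Fin (v i)), f = relMat G v ε i p q}

/-- The action of `g ∈ GL(v)` on `R_v` by `ℂ`-algebra automorphisms:
`x^a_{p,q} ↦ (g_{t a} · X_a · g_{s a}⁻¹)_{p,q}`. -/
def act (G : SimpleGraph K) (v : K → ℕ) (g : ∀ i : K, GL (Fin (v i)) ℂ) :
    R G v →ₐ[ℂ] R G v :=
  MvPolynomial.aeval fun x : Var G v =>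
    ∑ p' : Fin (v (tgt x.1)), ∑ q' : Fin (v (src x.1)),
      MvPolynomial.C ((g (tgt x.1)).val x.2.1 p') *
        MvPolynomial.X (⟨x.1, (p', q')⟩ : Var G v) *
        MvPolynomial.C (((g (src x.1))⁻¹).val q' x.2.2)

set_option linter.all false
set_option linter.unusedSectionVars false

section PartA
variable {E S : Type*} [Ring E] [AddCommGroup S]

/-- Words of the form used in the icosahedral case. -/
def NF (u v w : E) : Prop :=
  w = 0 ∨ (∃ a, w = u ^ (a+1) ∨ w = - u ^ (a+1)) ∨
    (∃ a b, w = u ^ a * v * u ^ b ∨ w = -(u ^ a * v * u ^ b)) ∨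
    (∃ a, w = u ^ a * (v * v) ∨ w = -(u ^ a * (v * v)))

theorem NF.neg {u v w : E} (h : NF u v w) : NF u v (-w) := by
  rcases h with h | ⟨a, h⟩ | ⟨a, b, h⟩ | ⟨a, h⟩
  · left; simp [h]
  · right; left; exact ⟨a, by rcases h with h | h <;> simp [h]⟩
  · right; right; left; exact ⟨a, b, by rcases h with h | h <;> simp [h]⟩
  · right; right; right; exact ⟨a, by rcases h with h | h <;> simp [h]⟩

theorem NF.ofneg {u v w : E} (h : NF u v (-w)) : NF u v w := by
  simpa using h.neg

structure Rels (u v : E) : Prop where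
  r2 : u*u*v + u*v*u + v*u*u = 0
  r3 : u*v*v = -(v*u*v)
  r4 : v*v*u = -(u^4)
  r5 : v*v*v = -(u^3*v)
  r7 : v*v*v = -(v*u^3)
  r8 : v*u*u*v = 0

namespace Rels
variable {u v : E} (h : Rels u v)
include h

theorem vuvu : v*u*v*u = u^5 := by
  have h1 : v*(u*u*v + u*v*u + v*u*u) = 0 := by rw [h.r2]; simp
  have h2 : v*u*u*v + v*u*v*u + (v*v*u)*u = 0 := by rw [← h1]; noncomm_ring
  rw [h.r8, h.r4] at h2
  have : v*u*v*u = u^4*u := by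
    linear_combination (norm := noncomm_ring) h2
  rw [this]; noncomm_ring

theorem u5v : u^5*v = 0 := by
  rw [← h.vuvu]
  have : v*u*v*u*v = -(v*u*(u*v*v)) := by rw [h.r3]; noncomm_ring
  rw [this]
  have : v*u*(u*v*v) = (v*u*u*v)*v := by noncomm_ring
  rw [this, h.r8]; simp

theorem v4 : v*v*v*v = u^6 := by
  have h1 : v*v*v*v = -(v*u*(u*u*v)) := by rw [h.r7]; noncomm_ring
  have h2 : u*u*v = -(u*v*u) - v*u*u := by
    linear_combination (norm := noncomm_ring) h.r2
  have h3 : v*u*(u*u*v) = -(v*u*u*v)*u - (v*u*v*u)*u := by rw [h2]; noncomm_ring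
  rw [h1, h3, h.r8, h.vuvu]; noncomm_ring

theorem vu3v : v*u^3*v = -u^6 := by
  have : v*u^3 = -(v*v*v) := by rw [h.r7]; simp
  rw [this, ← h.v4]; noncomm_ring

theorem vu4v : v*u^4*v = u^7 := by
  have : v*u^4*v = v*u*(u^3*v) := by noncomm_ring
  have h5 : u^3*v = -(v*v*v) := by rw [h.r5]; simp
  rw [this, h5]
  have : v*u*(-(v*v*v)) = -(v*u*v)*v*v := by noncomm_ring
  rw [this]
  rw [show -(v*u*v) = u*v*v from h.r3.symm]
  have : u*v*v*v*v = u*(v*v*v*v) := by noncomm_ring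
  rw [this, h.v4]; noncomm_ring

theorem u9 : u^9 = 0 := by
  have h1 : v*u^6 = 0 := by
    rw [← h.v4]
    have : v*(v*v*v*v) = (v*v*v*v)*v := by noncomm_ring
    rw [this, h.v4]
    have : u^6*v = u*(u^5*v) := by noncomm_ring
    rw [this, h.u5v]; simp
  have h2 : u^9 = -((v*v*u)*u^5) := by rw [h.r4]; noncomm_ring
  rw [h2]
  have : v*v*u*u^5 = v*(v*u^6) := by noncomm_ring
  rw [this, h1]; simp

theorem nf_mul_u {w : E} (hw : NF u v w) : NF u v (w*u) := by
  have key : ∀ w, (∃ a, w = u ^ (a+1)) ∨ (∃ a b, w = u ^ a * v * u ^ b) ∨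
    (∃ a, w = u ^ a * (v * v)) → NF u v (w*u) := by
    rintro w (⟨a, rfl⟩ | ⟨a, b, rfl⟩ | ⟨a, rfl⟩)
    · right; left; exact ⟨a+1, by left; rw [pow_succ u (a+1)]⟩
    · right; right; left; exact ⟨a, b+1, by left; rw [pow_succ u b]; simp only [mul_assoc]⟩
    · right; left; exact ⟨a+3, by right; rw [mul_assoc, h.r4, mul_neg, ← pow_add]⟩
  rcases hw with h | ⟨a, h | h⟩ | ⟨a, b, h | h⟩ | ⟨a, h | h⟩
  · left; simp [h]
  · exact key _ (Or.inl ⟨a, h⟩)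
  · apply NF.ofneg; rw [← neg_mul]; exact key _ (Or.inl ⟨a, by simp [h]⟩)
  · exact key _ (Or.inr (Or.inl ⟨a, b, h⟩))
  · apply NF.ofneg; rw [← neg_mul]; exact key _ (Or.inr (Or.inl ⟨a, b, by simp [h]⟩))
  · exact key _ (Or.inr (Or.inr ⟨a, h⟩))
  · apply NF.ofneg; rw [← neg_mul]; exact key _ (Or.inr (Or.inr ⟨a, by simp [h]⟩))

theorem nf_mul_v {w : E} (hw : NF u v w) : NF u v (w*v) := by
  have key : ∀ w, (∃ a, w = u ^ (a+1)) ∨ (∃ a b, w = u ^ a * v * u ^ b) ∨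
    (∃ a, w = u ^ a * (v * v)) → NF u v (w*v) := by
    rintro w (⟨a, rfl⟩ | ⟨a, b, rfl⟩ | ⟨a, rfl⟩)
    · right; right; left; exact ⟨a+1, 0, by left; simp⟩
    · have e : u^a*v*u^b*v = u^a*(v*u^b*v) := by simp only [mul_assoc]
      rw [e]
      match b with
      | 0 => right; right; right; exact ⟨a, by left; simp⟩
      | 1 =>
        right; right; right
        refine ⟨a+1, Or.inr ?_⟩
        have : v*u*v = -(u*v*v) := by rw [h.r3]; simp
        rw [pow_one, this, pow_succ]; noncomm_ring
      | 2 => left; rw [pow_two, ← mul_assoc v, h.r8]; simp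
      | 3 => right; left; exact ⟨a+5, by right; rw [h.vu3v, mul_neg, ← pow_add]⟩
      | 4 => right; left; exact ⟨a+6, by left; rw [h.vu4v, ← pow_add]⟩
      | b+5 =>
        left; rw [pow_add, mul_assoc v, mul_assoc _ (u^5) v, h.u5v]; simp
    · right; right; left
      exact ⟨a, 3, by right; rw [mul_assoc, h.r7]; simp only [mul_neg, mul_assoc]⟩
  rcases hw with h | ⟨a, h | h⟩ | ⟨a, b, h | h⟩ | ⟨a, h | h⟩
  · left; simp [h]
  · exact key _ (Or.inl ⟨a, h⟩)
  · apply NF.ofneg; rw [← neg_mul]; exact key _ (Or.inl ⟨a, by simp [h]⟩)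
  · exact key _ (Or.inr (Or.inl ⟨a, b, h⟩))
  · apply NF.ofneg; rw [← neg_mul]; exact key _ (Or.inr (Or.inl ⟨a, b, by simp [h]⟩))
  · exact key _ (Or.inr (Or.inr ⟨a, h⟩))
  · apply NF.ofneg; rw [← neg_mul]; exact key _ (Or.inr (Or.inr ⟨a, by simp [h]⟩))

end Rels

/-- If the five small traces vanish, all normal forms have zero trace. -/
theorem nf_trace {u v : E} (h : Rels u v) (τ : E →+ S) (hτ : ∀ a b, τ (a*b) = τ (b*a))
    (hS : ∀ (n : ℕ) (s : S), n ≠ 0 → n • s = 0 → s = 0)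
    (h1 : τ u = 0) (h2 : τ (u*u) = 0) (h3 : τ (u^3) = 0) (hv : τ v = 0) (huv : τ (u*v) = 0)
    (hvv : τ (v*v) = 0) {w : E} (hw : NF u v w) : τ w = 0 := by
  have two : ∀ s : S, s + s = 0 → s = 0 := fun s hs => hS 2 s (by norm_num) (by rw [two_nsmul]; exact hs)
  have hunv : ∀ n, τ (u^n*v) = 0 := by
    intro n
    match n with
    | 0 => simpa using hv
    | 1 => simpa using huv
    | n+2 =>
      have e : (u*u*v + u*v*u + v*u*u) * u^n = 0 := by rw [h.r2]; simp
      have e1 : τ (u*u*v*u^n) = τ (u^(n+2)*v) := by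
        rw [hτ]; congr 1; rw [pow_add]; simp only [pow_two, mul_assoc]
      have e2 : τ (u*v*u*u^n) = τ (u^(n+2)*v) := by
        rw [show u*v*u*u^n = (u*v)*(u*u^n) by simp only [mul_assoc], hτ]
        congr 1; rw [pow_add, ← pow_succ']; rw [pow_two, ← mul_assoc (u^n), ← pow_succ]; simp only [mul_assoc]
      have e3 : τ (v*u*u*u^n) = τ (u^(n+2)*v) := by
        rw [show v*u*u*u^n = v*(u^2*u^n) by simp only [mul_assoc, pow_two], hτ, ← pow_add, add_comm]
      have e4 := congrArg τ e
      rw [add_mul, add_mul, map_add, map_add, e1, e2, e3, map_zero] at e4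
      apply hS 3 _ (by norm_num)
      rw [← e4]; abel
  have hv2 : ∀ n, τ (u^(n+4)) = - τ (u^(n+1)*(v*v)) := by
    intro n
    have : u^(n+4) = -(u^n*(v*v*u)) := by rw [h.r4, mul_neg, neg_neg, ← pow_add]
    rw [this, map_neg, show u^n*(v*v*u) = (u^n*(v*v))*u by simp only [mul_assoc], hτ, ← mul_assoc,
      ← pow_succ']
  have hun : ∀ n, τ (u^(n+1)) = 0 := by
    intro n
    match n with
    | 0 => simpa using h1
    | 1 => simpa [pow_two] using h2
    | 2 => simpa using h3
    | 3 =>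
      have := hv2 0
      rw [show 3+1 = 0+4 from rfl, this, neg_eq_zero]
      apply two
      have e : τ (u*v*v) = τ (-(v*u*v)) := by rw [h.r3]
      have e' : τ (v*u*v) = τ (u*v*v) := by rw [mul_assoc, hτ]
      rw [map_neg, e'] at e
      simp only [zero_add, pow_one, ← mul_assoc]
      nth_rewrite 1 [e]; simp
    | 4 =>
      have := hv2 1
      rw [show 4+1 = 1+4 from rfl, this, neg_eq_zero, pow_two]
      rw [show u*u*(v*v) = (u*u*v)*v by simp only [mul_assoc], hτ,
        show v*(u*u*v) = v*u*u*v by simp only [mul_assoc], h.r8, map_zero]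
    | 5 =>
      have := hv2 2
      rw [show 5+1 = 2+4 from rfl, this, neg_eq_zero]
      have e : u^3*(v*v) = -(u*u*(v*u*v)) := by
        rw [← mul_neg, ← h.r3]; noncomm_ring
      rw [show 2+1 = 3 from rfl, e, map_neg, neg_eq_zero, show u*u*(v*u*v) = (u*u*v)*(u*v) by simp only [mul_assoc],
        hτ, show u*v*(u*u*v) = u*(v*u*u*v) by simp only [mul_assoc], h.r8]
      simp
    | 6 =>
      have e : u^7 = u*v*v*(v*v) := by
        rw [show u*v*v*(v*v) = u*(v*v*v*v) by simp only [mul_assoc], h.v4, ← pow_succ']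
      rw [show 6+1 = 7 from rfl, e]
      apply two
      have e1 : τ (u*v*v*(v*v)) = τ (-(v*u*v)*(v*v)) := by rw [h.r3]
      have e2 : τ (v*u*v*(v*v)) = τ (u*v*v*(v*v)) := by
        rw [show v*u*v*(v*v) = v*(u*v*v*v) by simp only [mul_assoc], hτ]; simp only [mul_assoc]
      rw [neg_mul, map_neg, e2] at e1
      nth_rewrite 1 [e1]; simp
    | 7 =>
      have e : u^8 = (u*u*v*v*v)*v := by
        rw [show u*u*v*v*v*v = u^2*(v*v*v*v) by simp only [mul_assoc, pow_two], h.v4, ← pow_add]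
      rw [show 7+1 = 8 from rfl, e, hτ, show v*(u*u*v*v*v) = (v*u*u*v)*(v*v) by simp only [mul_assoc],
        h.r8]
      simp
    | n+8 => rw [show n+8+1 = n+9 from rfl, pow_add, h.u9]; simp
  rcases hw with h | ⟨a, h | h⟩ | ⟨a, b, h | h⟩ | ⟨a, h | h⟩
  · simp [h]
  · rw [h, hun]
  · rw [h, map_neg, hun, neg_zero]
  · rw [h, hτ, ← mul_assoc, ← pow_add, hunv]
  · rw [h, map_neg, hτ, ← mul_assoc, ← pow_add, hunv, neg_zero]
  all_goals
    have : τ (u^a*(v*v)) = 0 := by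
      match a with
      | 0 => simpa using hvv
      | a+1 =>
        have := hv2 a
        rw [hun (a+3)] at this
        rw [← neg_eq_zero, ← this]
    simp [h, this]

/-- relations -/
theorem rels_of {x y : E} (hx : x*x = 0) (hy : y*y*y = 0) (hz : (x+y)^5 = 0) :
    Rels (x*y) (x*(y*y)) := by
  have hx' : ∀ t, x*(x*t) = 0 := fun t => by rw [← mul_assoc, hx, zero_mul]
  have hy0 : y*(y*y) = 0 := by rw [← mul_assoc, hy]
  have hy' : ∀ t, y*(y*(y*t)) = 0 := fun t => by
    rw [← mul_assoc, ← mul_assoc, hy, zero_mul]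
  have hz0 : (x+y)*((x+y)*((x+y)*((x+y)*(x+y)))) = 0 := by rw [← hz]; noncomm_ring
  have key : ∀ s t, s*(((x+y)*((x+y)*((x+y)*((x+y)*(x+y)))))*t) = 0 := by
    intro s t; rw [hz0]; simp
  simp only [mul_add, add_mul, mul_assoc, hx, hx', hy0, hy', mul_zero, add_zero, zero_add] at key
  have k1 := key x y
  have k2 := key x (y*y)
  have k3 := key x (x*y)
  have k4 := key x (x*(y*y))
  have k5 := key (x*(y*y)) (y)
  have k6 := key (x*(y*y)) (y*y)
  have k7 := key (x*(y*y)) (x*y)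
  have k8 := key (x*(y*y)) (x*(y*y))
  simp only [mul_add, add_mul, mul_assoc, hx, hx', hy0, hy', mul_zero, add_zero, zero_add] at k1 k2 k3 k4 k5 k6 k7 k8
  constructor <;> simp only [pow_succ, pow_zero, one_mul, mul_assoc]
  · rw [← k1]; abel
  · rw [eq_neg_iff_add_eq_zero, ← k2]; abel
  · rw [eq_neg_iff_add_eq_zero, ← k3]; abel
  · rw [eq_neg_iff_add_eq_zero, ← k4]; abel
  · rw [eq_neg_iff_add_eq_zero, ← k5]; abel
  · exact k6

/-- all words in `x, y` starting with `x`: icosahedral case -/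
theorem word_state {x y : E} (hx : x*x = 0) (hy : y*y*y = 0) (h : Rels (x*y) (x*(y*y)))
    (L : List E) (hL : ∀ t ∈ L, t = x ∨ t = y) :
    x * L.prod = 0 ∨ ∃ p, (p = 1 ∨ (NF (x*y) (x*(y*y)) p ∧ ∃ s, p = x*s)) ∧
      (x * L.prod = p * x ∨ x * L.prod = p * (x*y) ∨ x * L.prod = p * (x*(y*y))) := by
  induction L using List.reverseRecOn with
  | nil => right; exact ⟨1, Or.inl rfl, by simp⟩
  | append_singleton L t ih =>
    replace ih := ih (fun s hs => hL s (by simp [hs]))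
    have ht := hL t (by simp)
    rw [List.prod_append, List.prod_singleton, ← mul_assoc]
    have nfu : ∀ p, (p = 1 ∨ (NF (x*y) (x*(y*y)) p ∧ ∃ s, p = x*s)) →
        (p*(x*y) = 1 ∨ (NF (x*y) (x*(y*y)) (p*(x*y)) ∧ ∃ s, p*(x*y) = x*s)) := by
      rintro p (rfl | ⟨hp, s, rfl⟩)
      · right; exact ⟨Or.inr (Or.inl ⟨0, by simp⟩), y, by simp⟩
      · right; exact ⟨h.nf_mul_u hp, s*(x*y), by simp only [mul_assoc]⟩
    have nfv : ∀ p, (p = 1 ∨ (NF (x*y) (x*(y*y)) p ∧ ∃ s, p = x*s)) →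
        (p*(x*(y*y)) = 1 ∨ (NF (x*y) (x*(y*y)) (p*(x*(y*y))) ∧ ∃ s, p*(x*(y*y)) = x*s)) := by
      rintro p (rfl | ⟨hp, s, rfl⟩)
      · right; exact ⟨Or.inr (Or.inr (Or.inl ⟨0, 0, by simp⟩)), y*y, by simp⟩
      · right; exact ⟨h.nf_mul_v hp, s*(x*(y*y)), by simp only [mul_assoc]⟩
    rcases ih with ih | ⟨p, hp, ih | ih | ih⟩
    · left; simp [ih]
    · rcases ht with rfl | rfl
      · left; rw [ih, mul_assoc, hx, mul_zero]
      · right; exact ⟨p, hp, Or.inr (Or.inl (by rw [ih, mul_assoc]))⟩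
    · rcases ht with rfl | rfl
      · right; exact ⟨_, nfu p hp, Or.inl (by rw [ih])⟩
      · right; exact ⟨p, hp, Or.inr (Or.inr (by rw [ih]; simp only [mul_assoc]))⟩
    · rcases ht with rfl | rfl
      · right; exact ⟨_, nfv p hp, Or.inl (by rw [ih])⟩
      · left; rw [ih]; simp only [mul_assoc] at hy ⊢; rw [hy]; simp

/-- rotation to a word starting with `x` -/
theorem word_rotate {x y : E} (τ : E →+ S) (hτ : ∀ a b, τ (a*b) = τ (b*a))
    (hy : ∀ k, τ (y^(k+1)) = 0)
    (hw : ∀ L : List E, (∀ t ∈ L, t = x ∨ t = y) → τ (x * L.prod) = 0)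
    (L : List E) (hL : ∀ t ∈ L, t = x ∨ t = y) (hne : L ≠ []) : τ L.prod = 0 := by
  by_cases hx : x ∈ L
  · obtain ⟨A, M, rfl⟩ := List.append_of_mem hx
    rw [List.prod_append, hτ, List.prod_cons, mul_assoc, ← List.prod_append]
    apply hw
    intro t ht
    apply hL
    simp only [List.mem_append, List.mem_cons] at ht ⊢
    tauto
  · have : ∀ t ∈ L, t = y := by
      intro t ht
      rcases hL t ht with rfl | h
      · exact absurd ht hx
      · exact h
    rw [List.eq_replicate_of_mem this, List.prod_replicate]
    obtain ⟨n, hn⟩ : ∃ n, L.length = n+1 := Nat.exists_eq_succ_of_ne_zero (by simpa using hne)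
    rw [hn, hy]

theorem words_E {x y : E} (τ : E →+ S) (hτ : ∀ a b, τ (a*b) = τ (b*a))
    (hS : ∀ (n : ℕ) (s : S), n ≠ 0 → n • s = 0 → s = 0)
    (hx : x*x = 0) (hy : y*y*y = 0) (hz : (x+y)^5 = 0)
    (hx1 : τ x = 0) (hyk : ∀ k, τ (y^(k+1)) = 0) (hzk : ∀ k, τ ((x+y)^(k+1)) = 0)
    (L : List E) (hL : ∀ t ∈ L, t = x ∨ t = y) (hne : L ≠ []) : τ L.prod = 0 := by
  have h := rels_of hx hy hz
  have hx' : ∀ t, x*(x*t) = 0 := fun t => by rw [← mul_assoc, hx, zero_mul]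
  have hy0 : y*(y*y) = 0 := by rw [← mul_assoc, hy]
  have hy' : ∀ t, y*(y*(y*t)) = 0 := fun t => by
    rw [← mul_assoc, ← mul_assoc, hy, zero_mul]
  have cyc0 : ∀ s, τ (x*(s*x)) = 0 := fun s => by
    rw [hτ, mul_assoc, hx, mul_zero, map_zero]
  have z2 := hzk 1
  have z3 := hzk 2
  have z4 := hzk 3
  have z5 := hzk 4
  have z6 : τ (x*(x+y)^5) = 0 := by rw [hz]; simp
  have z6' : τ (y*(x+y)^5) = 0 := by rw [hz]; simp
  simp only [pow_succ, pow_zero, one_mul, mul_add, add_mul, mul_assoc, hx, hx', hy0, hy', mul_zero,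
    add_zero, zero_add, map_add] at z2 z3 z4 z5 z6 z6'
  have hu : τ (x*y) = 0 := by
    apply hS 2 _ (by norm_num)
    have yy : τ (y*y) = 0 := by rw [← pow_two]; exact hyk 1
    rw [hτ y x, yy, add_zero] at z2
    rw [← z2]; abel
  have hv : τ (x*(y*y)) = 0 := by
    apply hS 3 _ (by norm_num)
    have e1 : τ (x*(y*x)) = 0 := cyc0 y
    have e2 : τ (y*(x*y)) = τ (x*(y*y)) := by rw [hτ, mul_assoc]
    have e3 : τ (y*(y*x)) = τ (x*(y*y)) := by rw [← mul_assoc, hτ]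
    rw [e1, e2, e3] at z3
    rw [← z3]; abel
  have huu : τ ((x*y)*(x*y)) = 0 := by
    apply hS 2 _ (by norm_num)
    have e1 : τ (x*(y*(y*x))) = 0 := by simpa only [mul_assoc] using cyc0 (y*y)
    have e2 : τ (y*(x*(y*x))) = τ ((x*y)*(x*y)) := by rw [hτ]; simp only [mul_assoc]
    have e2' : τ (x*(y*(x*y))) = τ ((x*y)*(x*y)) := by simp only [mul_assoc]
    have e3 : τ (y*(x*(y*y))) = 0 := by rw [hτ]; simp only [mul_assoc, hy0, mul_zero, map_zero]
    have e4 : τ (y*(y*(x*y))) = 0 := by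
      rw [show y*(y*(x*y)) = (y*y)*(x*y) by simp only [mul_assoc], hτ]
      simp only [mul_assoc, hy0, mul_zero, map_zero]
    simp only [e1, e2, e2', e3, e4] at z4
    rw [← z4]; abel
  have huv : τ ((x*y)*(x*(y*y))) = 0 := by
    apply hS 5 _ (by norm_num)
    have e0 : τ (x*(y*(x*(y*y)))) = τ ((x*y)*(x*(y*y))) := by simp only [mul_assoc]
    have e1 : τ (x*(y*(x*(y*x)))) = 0 := by simpa only [mul_assoc] using cyc0 (y*(x*y))
    have e2 : τ (x*(y*(y*(x*y)))) = τ ((x*y)*(x*(y*y))) := by rw [hτ (x*y)]; simp only [mul_assoc]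
    have e3 : τ (y*(x*(y*(x*y)))) = τ ((x*y)*(x*(y*y))) := by rw [hτ]; simp only [mul_assoc]
    have e4 : τ (y*(x*(y*(y*x)))) = τ ((x*y)*(x*(y*y))) := by
      rw [show y*(x*(y*(y*x))) = (y*(x*(y*y)))*x by simp only [mul_assoc], hτ]; simp only [mul_assoc]
    have e5 : τ (y*(y*(x*(y*x)))) = τ ((x*y)*(x*(y*y))) := by
      rw [show y*(y*(x*(y*x))) = (y*y)*(x*(y*x)) by simp only [mul_assoc], hτ]; simp only [mul_assoc]
    have e6 : τ (y*(y*(x*(y*y)))) = 0 := by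
      rw [show y*(y*(x*(y*y))) = (y*y)*(x*(y*y)) by simp only [mul_assoc], hτ]
      simp only [mul_assoc, hy', mul_zero, map_zero]
    simp only [e0, e1, e2, e3, e4, e5, e6] at z5
    rw [← z5]; abel
  have hst : τ ((x*y)^3) = 0 ∧ τ ((x*(y*y))*(x*(y*y))) = 0 := by
    have e1 : τ (x*(y*(y*(x*(y*x))))) = 0 := by simpa only [mul_assoc] using cyc0 (y*(y*(x*y)))
    have e2 : τ (x*(y*(x*(y*(y*x))))) = 0 := by simpa only [mul_assoc] using cyc0 (y*(x*(y*y)))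
    have e3 : τ (x*(y*(x*(y*(x*y))))) = τ ((x*y)^3) := by
      simp only [pow_succ, pow_zero, one_mul, mul_assoc]
    have e4 : τ (x*(y*(y*(x*(y*y))))) = τ ((x*(y*y))*(x*(y*y))) := by simp only [mul_assoc]
    simp only [e1, e2, e3, e4] at z6
    have f1 : τ (y*(x*(y*(x*(y*x))))) = τ ((x*y)^3) := by
      rw [← e3, hτ]; simp only [mul_assoc]
    have f2 : τ (y*(x*(y*(x*(y*y))))) = 0 := by
      rw [hτ]; simp only [mul_assoc, hy', hy0, mul_zero, map_zero]
    have f3 : τ (y*(x*(y*(y*(x*y))))) = τ ((x*(y*y))*(x*(y*y))) := by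
      rw [← e4, hτ]; simp only [mul_assoc]
    have f4 : τ (y*(y*(x*(y*(x*y))))) = 0 := by
      rw [show y*(y*(x*(y*(x*y)))) = (y*y)*(x*(y*(x*y))) by simp only [mul_assoc], hτ]
      simp only [mul_assoc, hy', hy0, mul_zero, map_zero]
    have f5 : τ (y*(y*(x*(y*(y*x))))) = τ ((x*(y*y))*(x*(y*y))) := by
      rw [← e4, show y*(y*(x*(y*(y*x)))) = (y*y)*(x*(y*(y*x))) by simp only [mul_assoc], hτ,
        show x*(y*(y*x))*(y*y) = x*(y*(y*(x*(y*y)))) by simp only [mul_assoc]]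
    simp only [f1, f2, f3, f4, f5, zero_add, add_zero] at z6 z6'
    have g1 : τ ((x*(y*y))*(x*(y*y))) = 0 := by
      have : τ ((x*(y*y))*(x*(y*y))) = (τ ((x*y)^3) + τ ((x*(y*y))*(x*(y*y))) + τ ((x*(y*y))*(x*(y*y))))
        - (τ ((x*y)^3) + τ ((x*(y*y))*(x*(y*y)))) := by abel
      rw [this]
      have z6a : τ ((x*y)^3) + τ ((x*(y*y))*(x*(y*y))) = 0 := by rw [← z6]
      have z6b : τ ((x*y)^3) + τ ((x*(y*y))*(x*(y*y))) + τ ((x*(y*y))*(x*(y*y))) = 0 := by rw [← z6']; try abel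
      rw [z6b, z6a, sub_zero]
    refine ⟨?_, g1⟩
    simpa [g1] using z6
  apply word_rotate τ hτ hyk _ L hL hne
  intro M hM
  have nft : ∀ {w}, NF (x*y) (x*(y*y)) w → τ w = 0 := fun hw =>
    nf_trace h τ hτ hS hu huu hst.1 hv huv hst.2 hw
  rcases word_state hx hy h M hM with e | ⟨p, hp, e | e | e⟩
  · rw [e, map_zero]
  · rcases hp with rfl | ⟨-, s, rfl⟩
    · rw [e, one_mul, hx1]
    · rw [e, mul_assoc, cyc0]
  · rcases hp with rfl | ⟨hp, -⟩
    · rw [e, one_mul, hu]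
    · rw [e]; exact nft (h.nf_mul_u hp)
  · rcases hp with rfl | ⟨hp, -⟩
    · rw [e, one_mul, hv]
    · rw [e]; exact nft (h.nf_mul_v hp)

theorem words_D {x y : E} (τ : E →+ S) (hτ : ∀ a b, τ (a*b) = τ (b*a))
    (hS : ∀ (n : ℕ) (s : S), n ≠ 0 → n • s = 0 → s = 0)
    (hx : x*x = 0) (hy : y*y = 0)
    (hx1 : τ x = 0) (hyk : ∀ k, τ (y^(k+1)) = 0) (hzk : ∀ k, τ ((x+y)^(k+1)) = 0)
    (L : List E) (hL : ∀ t ∈ L, t = x ∨ t = y) (hne : L ≠ []) : τ L.prod = 0 := by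
  have hx' : ∀ t, x*(x*t) = 0 := fun t => by rw [← mul_assoc, hx, zero_mul]
  have hy' : ∀ t, y*(y*t) = 0 := fun t => by rw [← mul_assoc, hy, zero_mul]
  have hpow : ∀ k, (x+y)^(2*(k+1)) = (x*y)^(k+1) + (y*x)^(k+1) := by
    intro k
    induction k with
    | zero => simp only [zero_add, mul_one, pow_succ, pow_zero, one_mul, mul_add, add_mul, hx, hy]; abel
    | succ k ih =>
      rw [show 2*(k+1+1) = 2*(k+1)+1+1 by ring, pow_succ, pow_succ, ih, mul_assoc]
      simp only [mul_add, add_mul, hx, hy, zero_add, add_zero]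
      rw [pow_succ (x*y) (k+1), pow_succ (y*x) (k+1)]
      have e1 : (x*y)^(k+1)*(y*x) = 0 := by rw [pow_succ]; simp only [mul_assoc, hy', mul_zero]
      have e2 : (y*x)^(k+1)*(x*y) = 0 := by rw [pow_succ]; simp only [mul_assoc, hx', mul_zero]
      rw [e1, e2]; abel
  have hrot : ∀ k, τ ((y*x)^(k+1)) = τ ((x*y)^(k+1)) := by
    intro k
    have e : (y*x)^(k+1) = y*((x*y)^k*x) := by
      induction k with
      | zero => simp
      | succ k ih => rw [pow_succ, ih, pow_succ]; simp only [mul_assoc]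
    rw [e, hτ, mul_assoc, ← pow_succ]
  have huk : ∀ k, τ ((x*y)^(k+1)) = 0 := by
    intro k
    have := hzk (2*k+1)
    rw [show 2*k+1+1 = 2*(k+1) by ring, hpow, map_add, hrot] at this
    apply hS 2 _ (by norm_num)
    rw [two_nsmul, this]
  apply word_rotate τ hτ hyk _ L hL hne
  intro M hM
  have st : x * M.prod = 0 ∨ (∃ a, x*M.prod = (x*y)^a*x) ∨ (∃ a, x*M.prod = (x*y)^(a+1)) := by
    clear hL hne
    induction M using List.reverseRecOn with
    | nil => right; left; exact ⟨0, by simp⟩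
    | append_singleton M t ih =>
      have ih := ih (fun s hs => hM s (by simp [hs]))
      have ht := hM t (by simp)
      rw [List.prod_append, List.prod_singleton, ← mul_assoc]
      rcases ih with e | ⟨a, e⟩ | ⟨a, e⟩ <;> rw [e] <;> rcases ht with rfl | rfl
      · simp
      · simp
      · left; rw [mul_assoc, hx, mul_zero]
      · right; right; exact ⟨a, by rw [pow_succ, mul_assoc]⟩
      · right; left; exact ⟨_, rfl⟩
      · left; rw [pow_succ]; simp only [mul_assoc, hy, mul_zero]
  rcases st with e | ⟨a, e⟩ | ⟨a, e⟩
  · rw [e, map_zero]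
  · rw [e]
    cases a with
    | zero => simpa using hx1
    | succ a => rw [hτ, pow_succ', mul_assoc, hx', map_zero]
  · rw [e, huk]

/-- from words in `x,y` to words in `x,y,z` with `x+y+z=0` -/
theorem words_three {x y z : E} (τ : E →+ S) (h0 : x + y + z = 0)
    (hw : ∀ L : List E, (∀ t ∈ L, t = x ∨ t = y) → L ≠ [] → τ L.prod = 0)
    (L : List E) (hL : ∀ t ∈ L, t = x ∨ t = y ∨ t = z) (hne : L ≠ []) : τ L.prod = 0 := by
  have key : ∀ (L M : List E), (∀ t ∈ L, t = x ∨ t = y ∨ t = z) → (∀ t ∈ M, t = x ∨ t = y) →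
      M ++ L ≠ [] → τ (M.prod * L.prod) = 0 := by
    intro L
    induction L with
    | nil => intro M _ hM hne; simpa using hw M hM (by simpa using hne)
    | cons t L ih =>
      intro M hL hM _
      have hL' : ∀ t ∈ L, t = x ∨ t = y ∨ t = z := fun s hs => hL s (by simp [hs])
      have hxx := ih (M ++ [x]) hL' (by
        intro s hs; rw [List.mem_append, List.mem_singleton] at hs
        rcases hs with hs | hs
        · exact hM s hs
        · exact Or.inl hs) (by simp)
      have hyy := ih (M ++ [y]) hL' (by
        intro s hs; rw [List.mem_append, List.mem_singleton] at hs
        rcases hs with hs | hs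
        · exact hM s hs
        · exact Or.inr hs) (by simp)
      rw [List.prod_append, List.prod_singleton, mul_assoc] at hxx hyy
      rw [List.prod_cons]
      rcases hL t (by simp) with rfl | rfl | rfl
      · exact hxx
      · exact hyy
      · have : t = -x - y := by linear_combination (norm := abel) h0
        rw [this, sub_mul, mul_sub, neg_mul, mul_neg, map_sub, map_neg, hxx, hyy]; simp
  simpa using key L [] hL (by simp) (by simpa using hne)

/-- sorted version -/
theorem words_sorted {x y z : E} (τ : E →+ S) (hτ : ∀ a b, τ (a*b) = τ (b*a))
    (hS : ∀ (n : ℕ) (s : S), n ≠ 0 → n • s = 0 → s = 0) (h0 : x + y + z = 0)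
    {p q r : ℕ} (hp : x^p = 0) (hq : y^q = 0) (hr : z^r = 0)
    (hpqr : (p = 2 ∧ q = 2) ∨ (p = 2 ∧ q = 3 ∧ r ≤ 5))
    (hx1 : ∀ k, τ (x^(k+1)) = 0) (hyk : ∀ k, τ (y^(k+1)) = 0) (hzk : ∀ k, τ (z^(k+1)) = 0)
    (L : List E) (hL : ∀ t ∈ L, t = x ∨ t = y ∨ t = z) (hne : L ≠ []) : τ L.prod = 0 := by
  have hz : x + y = -z := by linear_combination (norm := abel) h0
  have hzk' : ∀ k, τ ((x+y)^(k+1)) = 0 := by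
    intro k
    rw [hz, neg_pow]
    rcases neg_one_pow_eq_or E (k+1) with e | e <;> simp [e, hzk]
  have hx1' : τ x = 0 := by simpa using hx1 0
  apply words_three τ h0 _ L hL hne
  rcases hpqr with ⟨rfl, rfl⟩ | ⟨rfl, rfl, h5⟩
  · exact words_D τ hτ hS (by rw [← hp, pow_two]) (by rw [← hq, pow_two]) hx1' hyk hzk'
  · refine words_E τ hτ hS (by rw [← hp, pow_two]) (by rw [← hq]; noncomm_ring) ?_ hx1' hyk hzk'
    rw [hz, neg_pow, pow_eq_zero_of_le h5 hr, mul_zero]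

theorem pqr_sorted {p q r : ℕ} (hp : 2 ≤ p) (hpq : p ≤ q) (hqr : q ≤ r)
    (h : (1:ℝ) < 1/p + 1/q + 1/r) : (p = 2 ∧ q = 2) ∨ (p = 2 ∧ q = 3 ∧ r ≤ 5) := by
  have inv : ∀ {a b : ℕ}, 0 < a → a ≤ b → (1:ℝ)/b ≤ 1/a := fun {a b} ha hab =>
    one_div_le_one_div_of_le (by exact_mod_cast ha) (by exact_mod_cast hab)
  have hp2 : p = 2 := by
    by_contra hne
    have h3 : 3 ≤ p := by omega
    have a1 := inv (a := 3) (by norm_num) h3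
    have a2 := inv (a := 3) (by norm_num) (h3.trans hpq)
    have a3 := inv (a := 3) (by norm_num) ((h3.trans hpq).trans hqr)
    push_cast at a1 a2 a3
    linarith
  subst hp2
  by_cases hq2 : q = 2
  · left; exact ⟨rfl, hq2⟩
  right
  have hq3 : q = 3 := by
    by_contra hne
    have h4 : 4 ≤ q := by omega
    have a2 := inv (a := 4) (by norm_num) h4
    have a3 := inv (a := 4) (by norm_num) (h4.trans hqr)
    push_cast at a2 a3 h
    linarith
  subst hq3
  refine ⟨rfl, rfl, ?_⟩
  by_contra hne
  have a3 := inv (a := 6) (by norm_num) (show 6 ≤ r by omega)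
  push_cast at a3 h
  linarith

theorem words_all {x y z : E} (τ : E →+ S) (hτ : ∀ a b, τ (a*b) = τ (b*a))
    (hS : ∀ (n : ℕ) (s : S), n ≠ 0 → n • s = 0 → s = 0) (h0 : x + y + z = 0)
    {p q r : ℕ} (hp2 : 2 ≤ p) (hq2 : 2 ≤ q) (hr2 : 2 ≤ r)
    (h : (1:ℝ) < 1/p + 1/q + 1/r) (hp : x^p = 0) (hq : y^q = 0) (hr : z^r = 0)
    (hxk : ∀ k, τ (x^(k+1)) = 0) (hyk : ∀ k, τ (y^(k+1)) = 0) (hzk : ∀ k, τ (z^(k+1)) = 0)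
    (L : List E) (hL : ∀ t ∈ L, t = x ∨ t = y ∨ t = z) (hne : L ≠ []) : τ L.prod = 0 := by
  rcases le_total p q with a | a <;> rcases le_total q r with b | b <;> rcases le_total p r with c | c
  · exact words_sorted τ hτ hS h0 hp hq hr (pqr_sorted hp2 a b h) hxk hyk hzk L hL hne
  · exact words_sorted τ hτ hS h0 hp hq hr (pqr_sorted hp2 a b h) hxk hyk hzk L hL hne
  · exact words_sorted τ hτ hS (x := x) (y := z) (z := y) (by rw [← h0]; abel) hp hr hq
      (pqr_sorted hp2 c b (by linarith)) hxk hzk hyk L (fun t ht => by have := hL t ht; tauto) hne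
  · exact words_sorted τ hτ hS (x := z) (y := x) (z := y) (by rw [← h0]; abel) hr hp hq
      (pqr_sorted hr2 c a (by linarith)) hzk hxk hyk L (fun t ht => by have := hL t ht; tauto) hne
  · exact words_sorted τ hτ hS (x := y) (y := x) (z := z) (by rw [← h0]; abel) hq hp hr
      (pqr_sorted hq2 a c (by linarith)) hyk hxk hzk L (fun t ht => by have := hL t ht; tauto) hne
  · exact words_sorted τ hτ hS (x := y) (y := z) (z := x) (by rw [← h0]; abel) hq hr hp
      (pqr_sorted hq2 b c (by linarith)) hyk hzk hxk L (fun t ht => by have := hL t ht; tauto) hne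
  · exact words_sorted τ hτ hS (x := z) (y := y) (z := x) (by rw [← h0]; abel) hr hq hp
      (pqr_sorted hr2 b a (by linarith)) hzk hyk hxk L (fun t ht => by have := hL t ht; tauto) hne
  · exact words_sorted τ hτ hS (x := z) (y := y) (z := x) (by rw [← h0]; abel) hr hq hp
      (pqr_sorted hr2 b a (by linarith)) hzk hyk hxk L (fun t ht => by have := hL t ht; tauto) hne
end PartA
section PartB1
variable {K : Type} [Fintype K] [DecidableEq K]

theorem exists_y (G : SimpleGraph K) [DecidableRel G.Adj]
    (hG : ((2 : ℝ) • (1 : Matrix K K ℝ) - G.adjMatrix ℝ).PosDef) :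
    ∃ y : K → ℝ, (∀ i, 0 < y i) ∧ ∀ i, ∑ j ∈ G.neighborFinset i, y j < 2 * y i := by
  set M := (2 : ℝ) • (1 : Matrix K K ℝ) - G.adjMatrix ℝ with hM
  have hMv : ∀ (x : K → ℝ) i, M.mulVec x i = 2 * x i - ∑ j ∈ G.neighborFinset i, x j := by
    intro x i
    rw [hM, Matrix.sub_mulVec, Matrix.smul_mulVec, Matrix.one_mulVec, Pi.sub_apply,
      SimpleGraph.adjMatrix_mulVec_apply]
    simp
  have hu : IsUnit M := hG.isUnit
  obtain ⟨y, hy⟩ : ∃ y : K → ℝ, M.mulVec y = 1 := by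
    refine ⟨M⁻¹.mulVec 1, ?_⟩
    rw [Matrix.mulVec_mulVec, Matrix.mul_nonsing_inv _ ((Matrix.isUnit_iff_isUnit_det _).mp hu),
      Matrix.one_mulVec]
  have hy' : ∀ i, 2 * y i - ∑ j ∈ G.neighborFinset i, y j = 1 := fun i => by
    rw [← hMv, hy]; rfl
  have hnn : ∀ i, 0 ≤ y i := by
    set ym : K → ℝ := fun i => max (-y i) 0 with hym
    have hym0 : ym = 0 := by
      by_contra hne
      have h1 := hG.dotProduct_mulVec_pos hne
      have h2 : ∀ i, ym i * 1 ≤ - (ym i * M.mulVec ym i) := by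
        intro i
        rw [hMv, ← hy' i]
        by_cases hi : 0 ≤ y i
        · have : ym i = 0 := by simp [hym, hi]
          simp [this]
        · have hyi : ym i = - y i := by simp only [hym]; rw [max_eq_left]; linarith
          have hs : -∑ j ∈ G.neighborFinset i, y j ≤ ∑ j ∈ G.neighborFinset i, ym j := by
            rw [← Finset.sum_neg_distrib]
            exact Finset.sum_le_sum fun j _ => le_max_left _ _
          have hpos : 0 ≤ ym i := le_max_right _ _
          rw [← mul_neg]
          apply mul_le_mul_of_nonneg_left _ hpos
          rw [hyi]; linarith
      have h3 : ∑ i, ym i * 1 ≤ - ∑ i, (ym i * M.mulVec ym i) := by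
        rw [← Finset.sum_neg_distrib]; exact Finset.sum_le_sum fun i _ => h2 i
      have h4 : 0 ≤ ∑ i, ym i * 1 := Finset.sum_nonneg fun i _ => by simp [hym]
      have h5 : 0 < ∑ i, (ym i * M.mulVec ym i) := by simpa [dotProduct] using h1
      linarith
    intro i
    have := congrFun hym0 i
    simp only [hym, Pi.zero_apply] at this
    have h6 := le_max_left (-y i) 0
    linarith
  refine ⟨y, fun i => ?_, fun i => by linarith [hy' i]⟩
  have : 0 ≤ ∑ j ∈ G.neighborFinset i, y j := Finset.sum_nonneg fun j _ => hnn j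
  linarith [hy' i]

/-- `Arm G i j p`: beyond the edge `i → j` the graph is a path, with `p - 1` vertices. -/
inductive Arm (G : SimpleGraph K) : K → K → ℕ → Prop
  | leaf (i j : K) (hij : G.Adj i j) (h : ∀ k, G.Adj j k → k = i) : Arm G i j 2
  | step (i j k : K) (p : ℕ) (hij : G.Adj i j) (hjk : G.Adj j k) (hki : k ≠ i)
      (h : ∀ l, G.Adj j l → l = i ∨ l = k) (ha : Arm G j k p) : Arm G i j (p+1)

theorem Arm.adj {G : SimpleGraph K} {i j : K} {p : ℕ} (h : Arm G i j p) : G.Adj i j := by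
  cases h <;> assumption

theorem Arm.two_le {G : SimpleGraph K} {i j : K} {p : ℕ} (h : Arm G i j p) : 2 ≤ p := by
  induction h <;> omega

section
variable (G : SimpleGraph K) [DecidableRel G.Adj] (y : K → ℝ) (hy0 : ∀ i, 0 < y i)
  (hy : ∀ i, ∑ j ∈ G.neighborFinset i, y j < 2 * y i)
include hy0 hy

theorem y_sub (i : K) (s : Finset K) (hs : ∀ j ∈ s, G.Adj i j) : ∑ j ∈ s, y j < 2 * y i := by
  refine lt_of_le_of_lt ?_ (hy i)
  apply Finset.sum_le_sum_of_subset_of_nonneg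
  · intro j hj; simpa using hs j hj
  · intro j _ _; exact (hy0 j).le

theorem y_one {i j : K} (hij : G.Adj i j) : y j < 2 * y i := by
  simpa using y_sub G y hy0 hy i {j} (by simpa using hij)

theorem y_two {i j k : K} (hij : G.Adj i j) (hik : G.Adj i k) (hjk : j ≠ k) :
    y j + y k < 2 * y i := by
  have := y_sub G y hy0 hy i {j, k} (by simp [hij, hik])
  rwa [Finset.sum_pair hjk] at this

theorem y_three {i j k l : K} (hij : G.Adj i j) (hik : G.Adj i k) (hil : G.Adj i l) (hjk : j ≠ k)
    (hjl : j ≠ l) (hkl : k ≠ l) :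
    y j + y k + y l < 2 * y i := by
  have := y_sub G y hy0 hy i {j, k, l} (by simp [hij, hik, hil])
  rw [Finset.sum_insert (by simp [hjk, hjl]), Finset.sum_pair hkl] at this
  linarith

theorem arm_y {i j : K} {p : ℕ} (h : Arm G i j p) : ((p:ℝ) - 1) * y i < p * y j := by
  induction h with
  | leaf i j hij h => have := y_one G y hy0 hy hij.symm; push_cast; linarith
  | step i j k p hij hjk hki h ha ih =>
    have h1 := y_two G y hy0 hy hij.symm hjk hki.symm
    have h2 : (2:ℝ) ≤ p := by exact_mod_cast ha.two_le
    push_cast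
    nlinarith

theorem arm_exists (i j : K) (hij : G.Adj i j) (hle : y j ≤ y i) : ∃ p, Arm G i j p := by
  induction hn : (Finset.univ.filter fun k => y k < y j).card using Nat.strong_induction_on generalizing i j with
  | _ n ih =>
    by_cases h1 : ∃ k, G.Adj j k ∧ k ≠ i
    · obtain ⟨k, hjk, hki⟩ := h1
      have h2 : ∀ l, G.Adj j l → l = i ∨ l = k := by
        intro l hl
        by_contra hcon
        push Not at hcon
        have a1 := y_three G y hy0 hy hij.symm hjk hl hki.symm hcon.1.symm hcon.2.symm
        have a2 := y_one G y hy0 hy hjk.symm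
        have a3 := y_one G y hy0 hy hl.symm
        linarith
      have hlt : y k < y j := by
        have := y_two G y hy0 hy hij.symm hjk hki.symm
        linarith
      obtain ⟨p, hp⟩ := ih _ (by
        rw [← hn]
        apply Finset.card_lt_card
        rw [Finset.ssubset_iff_of_subset]
        · exact ⟨k, by simpa using hlt, by simp⟩
        · intro l hl; simp at hl ⊢; linarith) j k hjk hlt.le rfl
      exact ⟨p+1, Arm.step i j k p hij hjk hki h2 hp⟩
    · push Not at h1
      exact ⟨2, Arm.leaf i j hij h1⟩

end
end PartB1
section PartB2
variable {K : Type} [Fintype K] [DecidableEq K]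
variable {E S : Type*} [Ring E] [Algebra ℂ E] [AddCommGroup S] [Module ℂ S]

/-- product along a walk -/
def wp (a : K → K → E) : K → List K → E
  | _, [] => 1
  | i, j :: l => a i j * wp a j l

/-- last vertex of a walk -/
def lst : K → List K → K
  | i, [] => i
  | _, j :: l => lst j l

theorem lst_append (i : K) (l m : List K) : lst i (l ++ m) = lst (lst i l) m := by
  induction l generalizing i with
  | nil => rfl
  | cons j l ih => exact ih j

theorem wp_append (a : K → K → E) (i : K) (l m : List K) :
    wp a i (l ++ m) = wp a i l * wp a (lst i l) m := by
  induction l generalizing i with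
  | nil => simp [wp, lst]
  | cons j l ih => simp [wp, lst, ih, mul_assoc]

variable (G : SimpleGraph K) (y : K → ℝ)

/-- straight paths outward from `i` -/
inductive St (a : K → K → E) (Good : K → Prop) (i : K) : K → K → E → Prop
  | base (j : K) (hj : Good j) : St a Good i i j (a i j)
  | step (m e k : K) (p : ℕ) (D : E) (h : St a Good i m e D) (hem : G.Adj e m) (hek : G.Adj e k)
      (hkm : k ≠ m) (hn : ∀ l, G.Adj e l → l = m ∨ l = k) (hA : Arm G e k p) :
      St a Good i e k (D * a e k)

/-- state of a walk -/
def State (a : K → K → E) (Good : K → Prop) (i e : K) (P : E) : Prop :=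
  P = 0 ∨ (e = i ∧ ∃ (t : ℂ) (L : List K), L ≠ [] ∧ (∀ j ∈ L, Good j) ∧
      P = t • (L.map fun j => a i j * a j i).prod) ∨
    ∃ (m : K) (D : E) (t : ℂ) (L : List K), (∀ j ∈ L, Good j) ∧ St G a Good i m e D ∧
      P = t • ((L.map fun j => a i j * a j i).prod * D)

variable (a : K → K → E) (s : K → K → ℂ)
variable (ha : ∀ i j, ¬ G.Adj i j → a i j = 0) (hs : ∀ i j, G.Adj i j → s i j ≠ 0)
variable (hrel : ∀ i, ∑ j, s i j • (a i j * a j i) = 0)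

include ha hs hrel in
theorem rel_leaf {i j : K} (hij : G.Adj i j) (h : ∀ k, G.Adj j k → k = i) : a j i * a i j = 0 := by
  have h1 := hrel j
  rw [Finset.sum_eq_single i] at h1
  · exact (smul_eq_zero_iff_right (hs _ _ hij.symm)).mp h1
  · intro k _ hk
    rw [ha j k (fun h' => hk (h k h'))]; simp
  · simp

include ha hs hrel in
theorem rel_step {m e k : K} (hem : G.Adj e m) (hek : G.Adj e k) (hkm : k ≠ m)
    (hn : ∀ l, G.Adj e l → l = m ∨ l = k) : ∃ t : ℂ, t ≠ 0 ∧ a e k * a k e = t • (a e m * a m e) := by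
  have h1 := hrel e
  rw [Finset.sum_eq_add k m hkm] at h1
  · refine ⟨-((s e k)⁻¹ * s e m), ?_, ?_⟩
    · exact neg_ne_zero.mpr (mul_ne_zero (inv_ne_zero (hs _ _ hek)) (hs _ _ hem))
    · have h2 := eq_neg_of_add_eq_zero_left h1
      have h3 := congrArg (fun z => (s e k)⁻¹ • z) h2
      simp only [smul_smul, inv_mul_cancel₀ (hs _ _ hek), one_smul] at h3
      rw [h3, neg_smul, smul_neg, smul_smul]
  · rintro l _ ⟨h2, h3⟩
    rw [ha e l]; · simp
    intro h4
    rcases hn l h4 with h | h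
    · exact h3 h
    · exact h2 h
  · simp
  · simp

variable (τ : E →ₗ[ℂ] S) (hτ : ∀ a b, τ (a * b) = τ (b * a))

theorem cyc_pow (u w : E) (n : ℕ) : (u * w) ^ (n+1) = u * (w * u) ^ n * w := by
  induction n with
  | zero => simp
  | succ n ih =>
    rw [pow_succ, ih, pow_succ (w*u)]; simp only [mul_assoc]

include ha hs hrel hτ in
theorem arm_nil {i j : K} {p : ℕ} (h : Arm G i j p) :
    (a i j * a j i) ^ p = 0 ∧ ∀ k, τ ((a i j * a j i) ^ (k+1)) = 0 := by
  induction h with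
  | leaf i j hij h =>
    have h0 := rel_leaf G a s ha hs hrel hij h
    constructor
    · rw [cyc_pow, pow_one, h0]; simp
    · intro k
      rw [cyc_pow, mul_assoc, hτ, mul_assoc, ← pow_succ, h0]; simp
  | step i j k p hij hjk hki h hA ih =>
    obtain ⟨t, ht, h0⟩ := rel_step G a s ha hs hrel hij.symm hjk hki h
    have h1 : a j i * a i j = t⁻¹ • (a j k * a k j) := by
      rw [h0, smul_smul, inv_mul_cancel₀ ht, one_smul]
    constructor
    · rw [cyc_pow, h1, smul_pow, ih.1]; simp
    · intro k
      rw [cyc_pow, mul_assoc, hτ, mul_assoc, ← pow_succ, h1, smul_pow, map_smul, ih.2, smul_zero]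

theorem lin_word {T : Type*} (L : List T) (c f : T → E) (μ : T → ℂ) (h : ∀ j ∈ L, c j = μ j • f j) :
    (L.map c).prod = (L.map μ).prod • (L.map f).prod := by
  induction L with
  | nil => simp
  | cons j L ih =>
    simp only [List.map_cons, List.prod_cons]
    rw [ih (fun j hj => h j (by simp [hj])), h j (by simp), smul_mul_smul_comm]

variable (hy0 : ∀ i, 0 < y i) [DecidableRel G.Adj] (hy : ∀ i, ∑ j ∈ G.neighborFinset i, y j < 2 * y i)

include hy0 hy in
theorem St_ne {Good : K → Prop} {i : K} (hGood : ∀ j, Good j → G.Adj i j ∧ y j ≤ y i) {m e : K} {D : E}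
    (h : St G a Good i m e D) : e ≠ i ∧ y e ≤ y m ∧ y e ≤ y i := by
  induction h with
  | base j hj => exact ⟨(hGood j hj).1.ne', (hGood j hj).2, (hGood j hj).2⟩
  | step m e k p D h hem hek hkm hn hA ih =>
    have h2 := y_two G y hy0 hy hem hek hkm.symm
    obtain ⟨h3, h4, h5⟩ := ih
    have : y k < y e := by linarith
    refine ⟨?_, this.le, by linarith⟩
    rintro rfl; linarith

include ha hs hrel in
theorem St_back {Good : K → Prop} {i : K} {m e : K} {D : E}
    (h : St G a Good i m e D) : ∃ (t : ℂ) (j : K), Good j ∧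
      D * (a e m * a m e) = t • (a i j * a j i * D) := by
  induction h with
  | base j hj => exact ⟨1, j, hj, by simp [mul_assoc]⟩
  | step m e k p D h hem hek hkm hn hA ih =>
    obtain ⟨t, j, hj, h1⟩ := ih
    obtain ⟨t', _, h2⟩ := rel_step G a s ha hs hrel hem hek hkm hn
    refine ⟨t' * t, j, hj, ?_⟩
    calc D * a e k * (a k e * a e k) = D * (a e k * a k e) * a e k := by simp only [mul_assoc]
      _ = _ := by rw [h2, mul_smul_comm, h1, smul_smul, smul_mul_assoc, mul_assoc _ D]

include ha hs hrel in
theorem state_step {Good : K → Prop} {i : K} 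
    (hGood : ∀ j, Good j → G.Adj i j ∧ ∃ p, Arm G i j p)
    {e k : K} {P : E} (h : State G a Good i e P) (hk : G.Adj i k → Good k) :
    State G a Good i k (P * a e k) := by
  by_cases hadj : G.Adj e k
  swap
  · left; rw [ha _ _ hadj, mul_zero]
  rcases h with h | ⟨rfl, t, L, hL, hLG, rfl⟩ | ⟨m, D, t, L, hLG, hSt, rfl⟩
  · left; rw [h, zero_mul]
  · right; right
    exact ⟨e, a e k, t, L, hLG, St.base k (hk hadj), by rw [smul_mul_assoc]⟩
  · have hArm : ∃ p, Arm G m e p := by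
      cases hSt with
      | base j hj => exact (hGood _ hj).2
      | step m e k p D h hem hek hkm hn hA => exact ⟨p, hA⟩
    by_cases hkm : k = m
    · subst hkm
      cases hSt with
      | base j hj =>
        right; left
        refine ⟨rfl, t, L ++ [e], by simp, ?_, ?_⟩
        · intro j' hj'
          rcases List.mem_append.mp hj' with h | h
          · exact hLG _ h
          · simp only [List.mem_singleton] at h; rwa [h]
        · simp [mul_assoc]
      | step m e k p D h hem hek hkm hn hA =>
        obtain ⟨t', _, h2⟩ := rel_step G a s ha hs hrel hem hek hkm hn
        obtain ⟨t1, j, hj, h3⟩ := St_back G a s ha hs hrel h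
        right; right
        refine ⟨m, D, t * t' * t1, L ++ [j], ?_, h, ?_⟩
        · intro j' hj'
          rcases List.mem_append.mp hj' with h | h
          · exact hLG _ h
          · simp only [List.mem_singleton] at h; rwa [h]
        · rw [smul_mul_assoc, mul_assoc, mul_assoc D, h2, mul_smul_comm, h3, mul_smul_comm,
            mul_smul_comm, smul_smul, smul_smul]
          simp [mul_assoc]
    · right; right
      obtain ⟨p, hA⟩ := hArm
      have hA' := hA
      cases hA with
      | leaf _ _ hij h => exact absurd (h k hadj) hkm
      | step _ _ k' p hij hjk hki h hA2 =>
        obtain rfl : k = k' := (h k hadj).resolve_left hkm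
        exact ⟨e, D * a e k, t, L, hLG, St.step m e k p D hSt hij.symm hjk hkm h hA2,
          by rw [smul_mul_assoc]; simp only [mul_assoc]⟩

include ha hs hrel in
theorem state_walk {Good : K → Prop} {i : K} 
    (hGood : ∀ j, Good j → G.Adj i j ∧ ∃ p, Arm G i j p)
    {e : K} {P : E} (h : State G a Good i e P) (l : List K) (hl : ∀ k ∈ l, G.Adj i k → Good k) :
    State G a Good i (lst e l) (P * wp a e l) := by
  induction l generalizing e P with
  | nil => simpa [wp, lst] using h
  | cons k l ih =>
    have := ih (state_step G a s ha hs hrel hGood h (hl k (by simp)))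
      (fun k' hk' => hl k' (by simp [hk']))
    simpa [wp, lst, mul_assoc] using this

include ha hs hrel hy0 hy in
theorem closed_word {Good : K → Prop} {i : K} 
    (hGood : ∀ j, Good j → G.Adj i j ∧ y j ≤ y i ∧ ∃ p, Arm G i j p)
    (l : List K) (hne : l ≠ []) (hc : lst i l = i) (hl : ∀ k ∈ l, G.Adj i k → Good k) :
    wp a i l = 0 ∨ ∃ (t : ℂ) (L : List K), L ≠ [] ∧ (∀ j ∈ L, Good j) ∧
      wp a i l = t • (L.map fun j => a i j * a j i).prod := by
  cases l with
  | nil => exact absurd rfl hne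
  | cons k l =>
    by_cases hadj : G.Adj i k
    swap
    · left; simp [wp, ha _ _ hadj]
    have h0 : State G a Good i k (a i k) := by
      right; right
      exact ⟨i, a i k, 1, [], by simp, St.base k (hl k (by simp) hadj), by simp⟩
    have h1 := state_walk G a s ha hs hrel (fun j hj => ⟨(hGood j hj).1, (hGood j hj).2.2⟩) h0 l
      (fun k' hk' => hl k' (by simp [hk']))
    have hc' : lst k l = i := hc
    rw [hc'] at h1
    rcases h1 with h | ⟨_, h⟩ | ⟨m, D, t, L, hLG, hSt, h⟩
    · left; exact h
    · right; exact h
    · exact absurd rfl (St_ne G y a hy0 hy (fun j hj => ⟨(hGood j hj).1, (hGood j hj).2.1⟩) hSt).1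

include ha hs hrel hy0 hy hτ in
theorem closed_center {i : K} (hle : ∀ j, G.Adj i j → y j ≤ y i)
    (l : List K) (hne : l ≠ []) (hc : lst i l = i) : τ (wp a i l) = 0 := by
  have hGood : ∀ j, G.Adj i j → G.Adj i j ∧ y j ≤ y i ∧ ∃ p, Arm G i j p := fun j hj =>
    ⟨hj, hle j hj, arm_exists G y hy0 hy i j hj (hle j hj)⟩
  rcases closed_word G y a s ha hs hrel hy0 hy hGood l hne hc (fun _ _ h => h) with h |
    ⟨t, L, hLne, hL, h⟩
  · rw [h, map_zero]
  rw [h, map_smul]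
  suffices τ (L.map fun j => a i j * a j i).prod = 0 by rw [this, smul_zero]
  have hnil : ∀ j, G.Adj i j → ∀ k, τ ((a i j * a j i) ^ (k+1)) = 0 := fun j hj =>
    (arm_nil G a s ha hs hrel τ hτ (hGood j hj).2.2.choose_spec).2
  have hpow : ∀ (j : K) (hj : G.Adj i j) (μ : K → ℂ),
      (∀ k, G.Adj i k → a i k * a k i = μ k • (a i j * a j i)) →
      τ (L.map fun j => a i j * a j i).prod = 0 := by
    intro j hj μ hμ
    rw [lin_word L _ (fun _ => a i j * a j i) μ (fun k hk => hμ k (hL k hk)), map_smul]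
    simp only [List.map_const', List.prod_replicate]
    obtain ⟨n, hn⟩ := Nat.exists_eq_succ_of_ne_zero (by simpa using hLne : L.length ≠ 0)
    rw [hn, hnil j hj, smul_zero]
  obtain ⟨j1, hj1⟩ : ∃ j, j ∈ L := List.exists_mem_of_ne_nil _ hLne
  have hj1 := hL _ hj1
  by_cases h2 : ∃ j2, G.Adj i j2 ∧ j2 ≠ j1
  swap
  · push Not at h2
    exact hpow j1 hj1 (fun _ => 1) (fun k hk => by rw [h2 k hk, one_smul])
  obtain ⟨j2, hj2, h21⟩ := h2
  by_cases h3 : ∃ j3, G.Adj i j3 ∧ j3 ≠ j1 ∧ j3 ≠ j2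
  swap
  · push Not at h3
    have hn : ∀ l, G.Adj i l → l = j1 ∨ l = j2 := fun l hl => by
      by_contra h'
      push Not at h'
      exact h'.2 (h3 l hl h'.1)
    obtain ⟨t', _, h4⟩ := rel_step G a s ha hs hrel hj1 hj2 h21 hn
    refine hpow j1 hj1 (fun k => if k = j1 then 1 else t') (fun k hk => ?_)
    rcases hn k hk with rfl | rfl
    · simp
    · simp [h21, h4]
  obtain ⟨j3, hj3, h31, h32⟩ := h3
  have hn : ∀ l, G.Adj i l → l = j1 ∨ l = j2 ∨ l = j3 := by
    intro j4 hj4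
    by_contra h'
    push Not at h'
    obtain ⟨h41, h42, h43⟩ := h'
    have := y_sub G y hy0 hy i {j1, j2, j3, j4} (by simp [hj1, hj2, hj3, hj4])
    rw [Finset.sum_insert (by simp [h21.symm, h31.symm, h41.symm]),
      Finset.sum_insert (by simp [h32.symm, h42.symm]), Finset.sum_insert (by simp [h43.symm]),
      Finset.sum_singleton] at this
    have e1 := y_one G y hy0 hy hj1.symm
    have e2 := y_one G y hy0 hy hj2.symm
    have e3 := y_one G y hy0 hy hj3.symm
    have e4 := y_one G y hy0 hy hj4.symm
    linarith
  obtain ⟨p, hp⟩ := (hGood _ hj1).2.2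
  obtain ⟨q, hq⟩ := (hGood _ hj2).2.2
  obtain ⟨r, hr⟩ := (hGood _ hj3).2.2
  let f : K → E := fun j => s i j • (a i j * a j i)
  have hrel3 : f j1 + f j2 + f j3 = 0 := by
    have h1 := hrel i
    rw [← Finset.sum_subset (Finset.subset_univ {j1, j2, j3})] at h1
    · rw [Finset.sum_insert (by simp [h21.symm, h31.symm]), Finset.sum_insert (by simp [h32.symm]),
        Finset.sum_singleton] at h1
      rw [← h1, add_assoc]
    · intro k _ hk
      rw [ha i k, zero_mul, smul_zero]
      intro h'
      rcases hn k h' with h | h | h <;> simp [h] at hk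
  rw [lin_word L _ f (fun j => (s i j)⁻¹) (fun j hj => by
    simp only [f, smul_smul]; rw [inv_mul_cancel₀ (hs _ _ (hL j hj)), one_smul]), map_smul]
  have key : τ.toAddMonoidHom (L.map f).prod = 0 := by
    refine words_all (x := f j1) (y := f j2) (z := f j3) (p := p) (q := q) (r := r)
      τ.toAddMonoidHom hτ ?_ hrel3 hp.two_le hq.two_le hr.two_le ?_ ?_ ?_ ?_ ?_ ?_ ?_ _ ?_ ?_
    · intro n x hn hx
      have : (n : ℂ) • x = 0 := by rw [Nat.cast_smul_eq_nsmul]; exact hx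
      exact (smul_eq_zero.mp this).resolve_left (by exact_mod_cast hn)
    · have e1 := arm_y G y hy0 hy hp
      have e2 := arm_y G y hy0 hy hq
      have e3 := arm_y G y hy0 hy hr
      have e4 := y_three G y hy0 hy hj1 hj2 hj3 h21.symm h31.symm h32.symm
      have hyi := hy0 i
      have aux : ∀ {n : ℕ} {z : ℝ}, 2 ≤ n → ((n:ℝ) - 1) * y i < n * z → (1 - 1 / (n:ℝ)) * y i < z := by
        intro n z hn h
        have hn' : (0:ℝ) < n := by positivity
        have : (1 - 1 / (n:ℝ)) * y i = (((n:ℝ) - 1) * y i) / n := by field_simp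
        rw [this, div_lt_iff₀ hn']; linarith
      have e1' := aux hp.two_le e1
      have e2' := aux hq.two_le e2
      have e3' := aux hr.two_le e3
      by_contra hcon
      push Not at hcon
      nlinarith
    · simp only [f, smul_pow, (arm_nil G a s ha hs hrel τ hτ hp).1, smul_zero]
    · simp only [f, smul_pow, (arm_nil G a s ha hs hrel τ hτ hq).1, smul_zero]
    · simp only [f, smul_pow, (arm_nil G a s ha hs hrel τ hτ hr).1, smul_zero]
    · intro k; simp only [f, smul_pow, LinearMap.toAddMonoidHom_coe, map_smul, hnil _ hj1, smul_zero]
    · intro k; simp only [f, smul_pow, LinearMap.toAddMonoidHom_coe, map_smul, hnil _ hj2, smul_zero]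
    · intro k; simp only [f, smul_pow, LinearMap.toAddMonoidHom_coe, map_smul, hnil _ hj3, smul_zero]
    · intro t ht
      obtain ⟨j, hj, rfl⟩ := List.mem_map.mp ht
      rcases hn j (hL j hj) with rfl | rfl | rfl <;> simp
    · simpa using hLne
  have key' : τ (L.map f).prod = 0 := key
  rw [key', smul_zero]

include ha hs hrel hy0 hy hτ in
theorem closed_walk (n : ℕ) : ∀ (i : K), (Finset.univ.filter fun k => y i < y k).card ≤ n →
    ∀ (l : List K), l ≠ [] → lst i l = i → τ (wp a i l) = 0 := by
  induction n with
  | zero =>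
    intro i hi l hne hc
    refine closed_center G y a s ha hs hrel τ hτ hy0 hy (fun j hj => ?_) l hne hc
    by_contra h
    have : j ∈ (Finset.univ.filter fun k => y i < y k) := by simpa using h
    rw [Finset.card_eq_zero.mp (Nat.le_zero.mp hi)] at this
    simp at this
  | succ n ih =>
    intro i hi l hne hc
    by_cases hle : ∀ j, G.Adj i j → y j ≤ y i
    · exact closed_center G y a s ha hs hrel τ hτ hy0 hy hle l hne hc
    push Not at hle
    obtain ⟨j, hj, hlt⟩ := hle
    by_cases hjl : j ∈ l
    · obtain ⟨l1, l2, rfl⟩ := List.append_of_mem hjl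
      have e : l1 ++ j :: l2 = (l1 ++ [j]) ++ l2 := by simp
      have hl1 : lst i (l1 ++ [j]) = j := by rw [lst_append]; rfl
      rw [e, lst_append, hl1] at hc
      have := ih j ?_ (l2 ++ (l1 ++ [j])) (by simp) (by rw [lst_append, hc, hl1])
      · rw [wp_append, hc, hτ] at this
        rw [e, wp_append, hl1, this]
      · refine Nat.le_of_lt_succ (lt_of_lt_of_le (Finset.card_lt_card ?_) hi)
        refine ⟨fun k hk => ?_, fun h => ?_⟩
        · simp only [Finset.mem_filter, Finset.mem_univ, true_and] at hk ⊢; linarith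
        · have := h (by simpa using hlt : j ∈ _)
          simp at this
    · obtain ⟨p, hA⟩ := arm_exists G y hy0 hy j i hj.symm hlt.le
      cases hA with
      | leaf _ _ hij h =>
        cases l with
        | nil => exact absurd rfl hne
        | cons k l =>
          have : ¬ G.Adj i k := fun h' => hjl (by simp [h k h'])
          simp [wp, ha _ _ this]
      | step _ _ k p hij hjk hki h hA2 =>
        have hyk : y k ≤ y i := by
          have := y_two G y hy0 hy hj hjk hki.symm
          linarith
        rcases closed_word G y a s ha hs hrel hy0 hy (Good := fun k' => k' = k) (i := i)
          (by rintro _ rfl; exact ⟨hjk, hyk, p, hA2⟩) l hne hc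
          (fun k' hk' hadj => (h k' hadj).resolve_left (by rintro rfl; exact hjl hk')) with h |
          ⟨t, L, hLne, hL, h⟩
        · rw [h, map_zero]
        · rw [h, map_smul, lin_word L _ (fun _ => a i k * a k i) (fun _ => 1)
            (fun j hj => by rw [hL j hj, one_smul]), map_smul]
          simp only [List.map_const', List.prod_replicate]
          obtain ⟨n, hn⟩ := Nat.exists_eq_succ_of_ne_zero (by simpa using hLne : L.length ≠ 0)
          rw [hn, (arm_nil G a s ha hs hrel τ hτ hA2).2, smul_zero, smul_zero]

end PartB2
section PartC1
variable {W : Type} [Fintype W] [DecidableEq W]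

theorem hs_proj (J : Submodule ℂ (Matrix W W ℂ)) :
    ∃ pr : Matrix W W ℂ →ₗ[ℂ] Matrix W W ℂ, (∀ x, pr x ∈ J) ∧ (∀ x ∈ J, pr x = x) ∧
      ∀ x, ∀ b ∈ J, (b.conjTranspose * (x - pr x)).trace = 0 := by
  let Φ : Matrix W W ℂ ≃ₗ[ℂ] EuclideanSpace ℂ (W × W) :=
    { toFun := fun x => WithLp.toLp 2 (fun p => x p.1 p.2)
      invFun := fun z => Matrix.of fun i j => z (i, j)
      map_add' := fun _ _ => rfl
      map_smul' := fun _ _ => rfl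
      left_inv := fun _ => rfl
      right_inv := fun _ => rfl }
  have hΦ : ∀ a b : Matrix W W ℂ, inner ℂ (Φ a) (Φ b) = (a.conjTranspose * b).trace := by
    intro a b
    simp only [PiLp.inner_apply, Φ, LinearEquiv.coe_mk, LinearMap.coe_mk, AddHom.coe_mk,
      Matrix.trace, Matrix.diag_apply, Matrix.mul_apply, Matrix.conjTranspose_apply,
      Fintype.sum_prod_type]
    rw [Finset.sum_comm]
    refine Finset.sum_congr rfl fun i _ => Finset.sum_congr rfl fun j _ => ?_
    simp [mul_comm]
    rfl
  let J' := J.map (Φ : Matrix W W ℂ →ₗ[ℂ] EuclideanSpace ℂ (W × W))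
  refine ⟨Φ.symm.toLinearMap ∘ₗ J'.starProjection.toLinearMap ∘ₗ Φ.toLinearMap, ?_, ?_, ?_⟩
  · intro x
    obtain ⟨z, hz, hz'⟩ := J'.starProjection_apply_mem (Φ x)
    simp only [LinearMap.comp_apply, LinearEquiv.coe_coe, ContinuousLinearMap.coe_coe]
    rw [← hz']
    simpa using hz
  · intro x hx
    have : J'.starProjection (Φ x) = Φ x :=
      Submodule.starProjection_eq_self_iff.mpr ⟨x, hx, rfl⟩
    simp only [LinearMap.comp_apply, LinearEquiv.coe_coe, ContinuousLinearMap.coe_coe]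
    rw [this]; simp
  · intro x b hb
    have h := J'.sub_starProjection_mem_orthogonal (Φ x) (Φ b) ⟨b, hb, rfl⟩
    rw [← hΦ]
    simpa [inner_sub_right] using h

open scoped ComplexOrder in
theorem hs_zero {x : Matrix W W ℂ} (h : (x.conjTranspose * x).trace = 0) : x = 0 :=
  Matrix.trace_conjTranspose_mul_self_eq_zero_iff.mp h

/-- bicommutant -/
theorem bicomm (A : Submodule ℂ (Matrix W W ℂ)) (h1 : (1 : Matrix W W ℂ) ∈ A)
    (hmul : ∀ a ∈ A, ∀ b ∈ A, a * b ∈ A) (hstar : ∀ a ∈ A, a.conjTranspose ∈ A)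
    (c : Matrix W W ℂ) (hc : ∀ B : Matrix W W ℂ, (∀ a ∈ A, a * B = B * a) → c * B = B * c) :
    c ∈ A := by
  obtain ⟨pr, hA, hid, horth⟩ := hs_proj A
  have hpr : ∀ b ∈ A, ∀ x, pr (b * x) = b * pr x := by
    intro b hb x
    have e : b * x = b * pr x + b * (x - pr x) := by rw [← mul_add]; simp
    set z := b * (x - pr x) with hz
    have hz0 : ∀ a ∈ A, (a.conjTranspose * z).trace = 0 := by
      intro a ha
      have := horth x (b.conjTranspose * a) (hmul _ (hstar _ hb) _ ha)
      rw [Matrix.conjTranspose_mul, Matrix.conjTranspose_conjTranspose, mul_assoc] at this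
      exact this
    have hz1 : pr z = 0 := by
      apply hs_zero
      have h2 := horth z (pr z) (hA z)
      rw [mul_sub, Matrix.trace_sub, hz0 _ (hA z)] at h2
      simpa using h2
    rw [e, map_add, hz1, add_zero, hid _ (hmul _ hb _ (hA x))]
  have hblock : ∀ (b : Matrix W W ℂ) (Q' P'' : W),
      b * Matrix.single P'' Q' (1:ℂ) = ∑ P', b P' P'' • Matrix.single P' Q' (1:ℂ) := by
    intro b Q' P''
    ext i j
    simp only [Matrix.mul_apply, Matrix.single_apply, Matrix.sum_apply, Matrix.smul_apply]
    by_cases hj : Q' = j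
    · simp [hj]
    · simp [hj]
  let Kb : W → W → Matrix W W ℂ := fun Q Q' P P' => pr (Matrix.single P' Q' (1:ℂ)) P Q
  have hKl : ∀ (b : Matrix W W ℂ) Q Q' P P'', (Kb Q Q' * b) P P'' =
      pr (b * Matrix.single P'' Q' (1:ℂ)) P Q := by
    intro b Q Q' P P''
    rw [hblock, map_sum, Matrix.sum_apply, Matrix.mul_apply]
    refine Finset.sum_congr rfl fun P' _ => ?_
    rw [map_smul, Matrix.smul_apply, smul_eq_mul, mul_comm]
  have hKr : ∀ (b : Matrix W W ℂ) Q Q' P P'', (b * Kb Q Q') P P'' =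
      (b * pr (Matrix.single P'' Q' (1:ℂ))) P Q := by
    intro b Q Q' P P''
    rw [Matrix.mul_apply, Matrix.mul_apply]
  have hcK : ∀ Q Q', c * Kb Q Q' = Kb Q Q' * c := by
    intro Q Q'
    apply hc
    intro b hb
    ext P P''
    rw [hKl, hKr, hpr b hb]
  have hone : (1 : Matrix W W ℂ) = ∑ P, Matrix.single P P (1:ℂ) := by
    ext i j
    simp only [Matrix.one_apply, Matrix.sum_apply, Matrix.single_apply]
    by_cases h : i = j
    · subst h; simp
    · rw [if_neg h, Finset.sum_eq_zero]
      intro k _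
      rw [if_neg]
      rintro ⟨rfl, rfl⟩; exact h rfl
  have hc1 : pr (c * 1) = c * pr 1 := by
    rw [hone, Finset.mul_sum, map_sum, map_sum, Finset.mul_sum]
    refine Finset.sum_congr rfl fun P'' _ => ?_
    ext P Q
    rw [← hKl, ← hKr, hcK]
  rw [mul_one, hid 1 h1, mul_one] at hc1
  rw [← hc1]; exact hA c

end PartC1

section PartC5

theorem perm_sum {K n S : Type} [Fintype n] [DecidableEq n] [CommRing S]
    (Wk : K → K → Matrix n n S → Prop)
    (hmul : ∀ i j k Y Z, Wk i j Y → Wk j k Z → Wk i k (Y * Z))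
    (htr : ∀ i Y, Wk i i Y → Y.trace = 0) (ι : Type) [Fintype ι] :
    ∀ [DecidableEq ι], Nonempty ι → ∀ (σ : Equiv.Perm ι) (γ : ι → K) (Y : ι → Matrix n n S),
      (∀ k, Wk (γ k) (γ (σ k)) (Y k)) →
      ∑ P : ι → n, ∏ k, Y k (P k) (P (σ k)) = 0 := by
  refine Fintype.induction_empty_option (P := fun ι _ => ∀ [DecidableEq ι], Nonempty ι →
    ∀ (σ : Equiv.Perm ι) (γ : ι → K) (Y : ι → Matrix n n S),
      (∀ k, Wk (γ k) (γ (σ k)) (Y k)) →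
      ∑ P : ι → n, ∏ k, Y k (P k) (P (σ k)) = 0) ?_ ?_ ?_ ι
  · intro α β _ e ih
    rintro _ ⟨b⟩ σ γ Y hY
    classical
    let _ : Fintype α := Fintype.ofEquiv _ e.symm
    have := ih ⟨e.symm b⟩ ((e.trans σ).trans e.symm) (γ ∘ e) (Y ∘ e) (fun k => by
      simpa using hY (e k))
    rw [← this]
    refine Fintype.sum_equiv (e.arrowCongr (Equiv.refl n)).symm _ _ fun P => ?_
    refine Fintype.prod_equiv e.symm _ _ fun k => ?_
    simp
  · rintro _ ⟨x⟩; exact x.elim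
  · intro ι _ ih
    rintro _ - σ γ Y hY
    have _ : DecidableEq ι := Classical.decEq ι
    rw [← Equiv.sum_comp (Equiv.piOptionEquivProd (β := fun _ => n)).symm, Fintype.sum_prod_type]
    have hP : ∀ (p : n) (P : ι → n) (k : Option ι),
        (Equiv.piOptionEquivProd (β := fun _ => n)).symm (p, P) k = k.elim p P := by
      intro p P k; cases k <;> rfl
    simp only [hP, Fintype.prod_option, Option.elim_none, Option.elim_some]
    by_cases hσ : σ none = none
    · have h1 : ∀ k, σ (some k) = some (σ.removeNone k) := by
        intro k
        refine (Equiv.removeNone_some σ ?_).symm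
        refine Option.ne_none_iff_exists'.mp fun h => ?_
        have := σ.injective (h.trans hσ.symm)
        simp at this
      simp only [hσ, h1, Option.elim_none, Option.elim_some]
      have h2 := htr _ _ (by simpa [hσ] using hY none)
      simp only [← Finset.mul_sum]
      rw [← Finset.sum_mul]
      have h3 : ∑ i, Y none i i = 0 := h2
      rw [h3, zero_mul]
    · obtain ⟨b, hb⟩ := Option.ne_none_iff_exists'.mp hσ
      obtain ⟨a, ha⟩ : ∃ a, σ (some a) = none := by
        obtain ⟨x, hx⟩ := σ.surjective none
        cases x with
        | none => exact absurd hx hσ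
        | some a => exact ⟨a, hx⟩
      have hab : σ.removeNone a = b := by
        have := Equiv.removeNone_none σ ha
        rw [hb] at this; exact Option.some_injective _ this
      have h1 : ∀ k, k ≠ a → σ (some k) = some (σ.removeNone k) := by
        intro k hk
        refine (Equiv.removeNone_some σ ?_).symm
        refine Option.ne_none_iff_exists'.mp fun h => ?_
        have := σ.injective (h.trans ha.symm)
        exact hk (Option.some_injective _ this)
      have := ih ⟨a⟩ σ.removeNone (fun k => γ (some k))
        (Function.update (fun k => Y (some k)) a (Y (some a) * Y none)) (by
          intro k
          by_cases hk : k = a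
          · subst hk
            rw [Function.update_self]
            refine hmul _ (γ none) _ _ _ (by simpa [ha] using hY (some k)) ?_
            have := hY none
            rwa [hb, ← hab] at this
          · rw [Function.update_of_ne hk]
            have := hY (some k)
            rwa [h1 k hk] at this)
      rw [← this, Finset.sum_comm]
      refine Finset.sum_congr rfl fun P _ => ?_
      rw [← Finset.mul_prod_erase _ _ (Finset.mem_univ a), Function.update_self, Matrix.mul_apply,
        Finset.sum_mul]
      refine Finset.sum_congr rfl fun p _ => ?_
      rw [← Finset.mul_prod_erase _ _ (Finset.mem_univ a), hb, ha, hab, Option.elim_none,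
        Option.elim_some]
      have h4 : ∏ x ∈ Finset.univ.erase a, Y (some x) (P x) ((σ (some x)).elim p P) =
          ∏ x ∈ Finset.univ.erase a, Function.update (fun k => Y (some k)) a (Y (some a) * Y none) x
            (P x) (P (σ.removeNone x)) := by
        refine Finset.prod_congr rfl fun k hk => ?_
        have hk := Finset.ne_of_mem_erase hk
        rw [Function.update_of_ne hk, h1 k hk, Option.elim_some]
      rw [h4]; ring

end PartC5
section PartC2
variable {n K : Type} [Fintype n] [DecidableEq n] [Fintype K] [DecidableEq K]

theorem ryser (d : ℕ) (y : Fin d → Fin d → ℂ) :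
    ∑ T : Finset (Fin d), (-1 : ℂ) ^ T.card * ∏ k, ∑ j ∈ T, y j k =
      (-1) ^ d * ∑ σ : Equiv.Perm (Fin d), ∏ k, y (σ k) k := by
  have h1 : ∀ T : Finset (Fin d), ∏ k, ∑ j ∈ T, y j k =
      ∑ f : Fin d → Fin d, if ∀ k, f k ∈ T then ∏ k, y (f k) k else 0 := by
    intro T
    rw [Finset.prod_univ_sum, ← Finset.sum_filter]
    refine Finset.sum_congr ?_ fun _ _ => rfl
    ext f; simp
  simp only [h1, Finset.mul_sum]
  rw [Finset.sum_comm]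
  symm
  refine Finset.sum_of_injOn (fun σ : Equiv.Perm (Fin d) => (σ : Fin d → Fin d)) ?_ ?_ ?_ ?_
  · intro σ _ ρ _ h
    exact DFunLike.coe_injective h
  · intro σ _; simp
  · intro f _ hf
    have hsurj : ¬ Function.Surjective f := by
      intro hs
      apply hf
      exact ⟨Equiv.ofBijective f (Finite.surjective_iff_bijective.mp hs), by simp, rfl⟩
    obtain ⟨j, hj⟩ := not_forall.mp hsurj
    push Not at hj
    refine Finset.sum_involution (fun T _ => if j ∈ T then T.erase j else insert j T) ?_ ?_ ?_ ?_
    · intro T _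
      by_cases hjT : j ∈ T
      · have e : (∀ k, f k ∈ T.erase j) ↔ ∀ k, f k ∈ T := by
          simp [Finset.mem_erase, hj]
        have hc := Finset.card_erase_add_one hjT
        simp only [hjT, if_true, e]
        rw [← hc, pow_succ]; ring
      · have e : (∀ k, f k ∈ insert j T) ↔ ∀ k, f k ∈ T := by
          simp [Finset.mem_insert, hj]
        simp only [hjT, if_false, e]
        rw [Finset.card_insert_of_notMem hjT, pow_succ]; ring
    · intro T _ _
      by_cases hjT : j ∈ T
      · simp only [hjT, if_true]
        intro h; rw [← h] at hjT; simp at hjT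
      · simp only [hjT, if_false]
        intro h; rw [← h] at hjT; simp at hjT
    · intro T _; simp
    · intro T _
      by_cases hjT : j ∈ T
      · simp [hjT, Finset.insert_erase hjT]
      · simp [hjT, Finset.erase_insert hjT]
  · intro σ _
    rw [Finset.sum_eq_single Finset.univ]
    · simp
    · intro T _ hT
      rw [if_neg, mul_zero]
      intro h
      apply hT
      ext j
      simpa using h (σ.symm j)
    · simp

/-- tensor product of matrices -/
def tens {S : Type} [CommRing S] (d : ℕ) (Y : Fin d → Matrix n n S) :
    Matrix (Fin d → n) (Fin d → n) S :=
  fun P Q => ∏ k, Y k (P k) (Q k)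

theorem tens_mul {S : Type} [CommRing S] (d : ℕ) (Y Z : Fin d → Matrix n n S) :
    tens d Y * tens d Z = tens d (fun k => Y k * Z k) := by
  ext P Q
  simp only [tens, Matrix.mul_apply, ← Finset.prod_mul_distrib]
  rw [Finset.prod_univ_sum]
  simp

theorem tens_one {S : Type} [CommRing S] (d : ℕ) :
    tens d (fun _ => (1 : Matrix n n S)) = 1 := by
  ext P Q
  simp only [tens, Matrix.one_apply]
  rw [Finset.prod_ite_zero]
  simp [funext_iff]

theorem tens_single (d : ℕ) (P Q : Fin d → n) :
    tens d (fun k => Matrix.single (P k) (Q k) (1:ℂ)) = Matrix.single P Q 1 := by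
  ext P' Q'
  simp only [tens, Matrix.single_apply]
  rw [Finset.prod_ite_zero]
  simp [funext_iff, forall_and]

variable (col : n → K)

/-- colour-preserving -/
def Cp (Y : Matrix n n ℂ) : Prop := ∀ p q, col p ≠ col q → Y p q = 0

theorem comm_all (d : ℕ) (c : Matrix (Fin d → n) (Fin d → n) ℂ)
    (hc : ∀ Y : Matrix n n ℂ, Cp col Y → IsUnit Y.det → c * tens d (fun _ => Y) = tens d (fun _ => Y) * c)
    (Y : Matrix n n ℂ) (hY : Cp col Y) : c * tens d (fun _ => Y) = tens d (fun _ => Y) * c := by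
  let F : ℂ → Matrix (Fin d → n) (Fin d → n) ℂ := fun s => tens d (fun _ => Y + s • 1)
  have hF : Continuous F := by
    refine continuous_pi fun P => continuous_pi fun Q => ?_
    simp only [F, tens]
    refine continuous_finset_prod _ fun k _ => ?_
    simp only [Matrix.add_apply, Matrix.smul_apply]
    fun_prop
  have hfin : {s : ℂ | (Y + s • 1).det = 0}.Finite := by
    have h0 : ((-Y).charpoly.roots.toFinset : Set ℂ).Finite := Finset.finite_toSet _
    refine h0.subset fun s hs => ?_
    simp only [Finset.mem_coe, Multiset.mem_toFinset]
    rw [Polynomial.mem_roots (Matrix.charpoly_monic _).ne_zero, Polynomial.IsRoot,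
      Matrix.eval_charpoly, ← hs.out]
    congr 1
    rw [sub_neg_eq_add, add_comm, Matrix.smul_one_eq_diagonal]
    rfl
  have hdense : Dense {s : ℂ | (Y + s • 1).det = 0}ᶜ :=
    Set.Countable.dense_compl ℂ hfin.countable
  have key : (fun s => c * F s) = fun s => F s * c := by
    refine Continuous.ext_on hdense (continuous_const.mul hF) (hF.mul continuous_const) ?_
    intro s hs
    refine hc _ ?_ (isUnit_iff_ne_zero.mpr hs)
    intro p q hpq
    have hne : p ≠ q := fun h => hpq (by rw [h])
    simp [hY p q hpq, hne]
  have := congrFun key 0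
  simpa [F] using this

theorem comm_sym (d : ℕ) (c : Matrix (Fin d → n) (Fin d → n) ℂ)
    (hc : ∀ Y : Matrix n n ℂ, Cp col Y → c * tens d (fun _ => Y) = tens d (fun _ => Y) * c)
    (Y : Fin d → Matrix n n ℂ) (hY : ∀ k, Cp col (Y k)) :
    c * (∑ σ : Equiv.Perm (Fin d), tens d (fun k => Y (σ k))) =
      (∑ σ : Equiv.Perm (Fin d), tens d (fun k => Y (σ k))) * c := by
  have h1 : (-1 : ℂ) ^ d • (∑ σ : Equiv.Perm (Fin d), tens d (fun k => Y (σ k))) =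
      ∑ T : Finset (Fin d), (-1 : ℂ) ^ T.card • tens d (fun _ => ∑ j ∈ T, Y j) := by
    ext P Q
    simp only [Matrix.smul_apply, Matrix.sum_apply, tens, smul_eq_mul]
    rw [ryser d (fun j k => Y j (P k) (Q k))]
  have h2 : (∑ σ : Equiv.Perm (Fin d), tens d (fun k => Y (σ k))) =
      (-1 : ℂ) ^ d • ∑ T : Finset (Fin d), (-1 : ℂ) ^ T.card • tens d (fun _ => ∑ j ∈ T, Y j) := by
    rw [← h1, smul_smul, ← mul_pow]; simp
  rw [h2, mul_smul_comm, smul_mul_assoc, Finset.mul_sum, Finset.sum_mul]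
  congr 1
  refine Finset.sum_congr rfl fun T _ => ?_
  rw [mul_smul_comm, smul_mul_assoc, hc]
  intro p q hpq
  rw [Matrix.sum_apply]
  exact Finset.sum_eq_zero fun j _ => hY j p q hpq

/-- coloured permutation operators -/
def Gam (d : ℕ) (x : Equiv.Perm (Fin d) × (Fin d → K)) : Matrix (Fin d → n) (Fin d → n) ℂ :=
  Matrix.of fun P Q => if Q = P ∘ x.1 ∧ col ∘ P = x.2 then 1 else 0

theorem gam_one (d : ℕ) : (1 : Matrix (Fin d → n) (Fin d → n) ℂ) = ∑ γ, Gam col d (1, γ) := by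
  ext P Q
  simp only [Gam, Matrix.sum_apply, Matrix.of_apply, Matrix.one_apply]
  by_cases h : P = Q
  · subst h; simp
  · have h' : Q ≠ P := fun e => h e.symm
    simp [h, h']

theorem gam_mul (d : ℕ) (x y : Equiv.Perm (Fin d) × (Fin d → K)) :
    Gam col d x * Gam col d y = if x.2 ∘ x.1 = y.2 then Gam col d (x.1 * y.1, x.2) else 0 := by
  ext P Q
  simp only [Gam, Matrix.mul_apply, Matrix.of_apply]
  rw [Finset.sum_eq_single (P ∘ x.1)]
  · by_cases h1 : col ∘ P = x.2
    · have e : col ∘ P ∘ x.1 = x.2 ∘ x.1 := by rw [← h1]; rfl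
      rw [e]
      by_cases h2 : x.2 ∘ x.1 = y.2
      · simp [h1, h2, Function.comp_assoc]
      · simp [h2]
    · by_cases h2 : x.2 ∘ x.1 = y.2 <;> simp [h1, h2]
  · intro M _ hM
    simp [hM]
  · simp

theorem gam_star (d : ℕ) (x : Equiv.Perm (Fin d) × (Fin d → K)) :
    (Gam col d x).conjTranspose = Gam col d (x.1⁻¹, x.2 ∘ x.1) := by
  ext P Q
  simp only [Gam, Matrix.conjTranspose_apply, Matrix.of_apply]
  have : (P = Q ∘ x.1 ∧ col ∘ Q = x.2) ↔ (Q = P ∘ ⇑(x.1⁻¹) ∧ col ∘ P = x.2 ∘ x.1) := by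
    constructor
    · rintro ⟨rfl, h⟩
      refine ⟨by ext k; simp, by rw [← h]; rfl⟩
    · rintro ⟨rfl, h⟩
      refine ⟨by ext k; simp, ?_⟩
      rw [← Function.comp_assoc, h]
      ext k; simp
  simp only [this]
  split_ifs <;> simp

theorem gam_comm (d : ℕ) (B : Matrix (Fin d → n) (Fin d → n) ℂ)
    (hB : ∀ x, Gam col d x * B = B * Gam col d x) (σ : Equiv.Perm (Fin d)) (γ : Fin d → K)
    (P Q : Fin d → n) :
    (if col ∘ P = γ then B (P ∘ σ) (Q ∘ σ) else 0) = if col ∘ Q = γ then B P Q else 0 := by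
  have h := congrFun (congrFun (hB (σ, γ)) P) (Q ∘ σ)
  simp only [Gam, Matrix.mul_apply, Matrix.of_apply] at h
  rw [Finset.sum_eq_single (P ∘ σ), Finset.sum_eq_single Q] at h
  · simpa using h
  · intro M _ hM
    rw [if_neg, mul_zero]
    rintro ⟨h1, _⟩
    exact hM (σ.surjective.injective_comp_right h1.symm)
  · simp
  · intro M _ hM
    simp [hM]
  · simp

theorem fft (d : ℕ) (c : Matrix (Fin d → n) (Fin d → n) ℂ)
    (hc : ∀ Y : Matrix n n ℂ, Cp col Y → IsUnit Y.det → c * tens d (fun _ => Y) = tens d (fun _ => Y) * c) :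
    c ∈ Submodule.span ℂ (Set.range (Gam col d)) := by
  have hc1 := comm_sym col d c (comm_all col d c hc)
  set A := Submodule.span ℂ (Set.range (Gam col d)) with hA
  have hmem : ∀ x, Gam col d x ∈ A := fun x => Submodule.subset_span ⟨x, rfl⟩
  refine bicomm A ?_ ?_ ?_ c ?_
  · rw [gam_one col]
    exact Submodule.sum_mem _ fun γ _ => hmem _
  · intro a ha b hb
    have : A * A ≤ A := by
      rw [hA, Submodule.span_mul_span, Submodule.span_le]
      rintro _ ⟨_, ⟨x, rfl⟩, _, ⟨y, rfl⟩, rfl⟩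
      simp only [gam_mul]
      split_ifs
      · exact hmem _
      · exact zero_mem _
    exact this (Submodule.mul_mem_mul ha hb)
  · intro a ha
    rw [hA] at ha
    induction ha using Submodule.span_induction with
    | mem x h =>
      obtain ⟨x, rfl⟩ := h
      rw [gam_star]; exact hmem _
    | zero => simp
    | add x y _ _ hx hy => rw [Matrix.conjTranspose_add]; exact add_mem hx hy
    | smul t x _ hx => rw [Matrix.conjTranspose_smul]; exact Submodule.smul_mem _ _ hx
  · intro B hB
    have hB' := gam_comm col d B (fun x => hB _ (hmem x))
    have hB0 : ∀ P Q, col ∘ P ≠ col ∘ Q → B P Q = 0 := by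
      intro P Q h
      simpa [h.symm] using hB' 1 (col ∘ P) P Q
    have hBσ : ∀ (σ : Equiv.Perm (Fin d)) P Q, B (P ∘ σ) (Q ∘ σ) = B P Q := by
      intro σ P Q
      by_cases h : col ∘ P = col ∘ Q
      · simpa [h] using hB' σ (col ∘ P) P Q
      · rw [hB0 _ _ h, hB0]
        intro h2
        exact h (σ.surjective.injective_comp_right h2)
    let D : (Fin d → n) → (Fin d → n) → Matrix (Fin d → n) (Fin d → n) ℂ := fun P Q =>
      ∑ σ : Equiv.Perm (Fin d), tens d (fun k => Matrix.single (P (σ k)) (Q (σ k)) (1:ℂ))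
    have hD : ∀ P Q, D P Q = ∑ σ : Equiv.Perm (Fin d), Matrix.single (P ∘ σ) (Q ∘ σ) 1 := by
      intro P Q
      exact Finset.sum_congr rfl fun σ _ => tens_single d (P ∘ σ) (Q ∘ σ)
    have hsum : (Fintype.card (Equiv.Perm (Fin d)) : ℂ) • B = ∑ P, ∑ Q, B P Q • D P Q := by
      have h3 : ∀ σ : Equiv.Perm (Fin d),
          B = ∑ P, ∑ Q, B P Q • Matrix.single (P ∘ σ) (Q ∘ σ) (1:ℂ) := by
        intro σ
        conv_lhs => rw [Matrix.matrix_eq_sum_single B]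
        rw [← Equiv.sum_comp (σ.symm.arrowCongr (Equiv.refl n))]
        refine Finset.sum_congr rfl fun P _ => ?_
        rw [← Equiv.sum_comp (σ.symm.arrowCongr (Equiv.refl n))]
        refine Finset.sum_congr rfl fun Q _ => ?_
        have e : ∀ P : Fin d → n, (σ.symm.arrowCongr (Equiv.refl n)) P = P ∘ σ := by
          intro P; ext k; simp [Equiv.arrowCongr]
        rw [e, e, hBσ, Matrix.smul_single, smul_eq_mul, mul_one]
      have h4 : (Fintype.card (Equiv.Perm (Fin d)) : ℂ) • B = ∑ σ : Equiv.Perm (Fin d), B := by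
        rw [Finset.sum_const, Finset.card_univ, Nat.cast_smul_eq_nsmul]
      rw [h4, Finset.sum_congr rfl fun σ _ => h3 σ, Finset.sum_comm]
      refine Finset.sum_congr rfl fun P _ => ?_
      rw [Finset.sum_comm]
      refine Finset.sum_congr rfl fun Q _ => ?_
      rw [hD, Finset.smul_sum]
    have hcD : ∀ P Q, c * (B P Q • D P Q) = (B P Q • D P Q) * c := by
      intro P Q
      by_cases h : col ∘ P = col ∘ Q
      · rw [mul_smul_comm, smul_mul_assoc]
        congr 1
        refine hc1 (fun k => Matrix.single (P k) (Q k) (1:ℂ)) ?_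
        intro k p q hpq
        rw [Matrix.single_apply, if_neg]
        rintro ⟨rfl, rfl⟩
        exact hpq (congrFun h k)
      · rw [hB0 _ _ h]; simp
    have hcard : (Fintype.card (Equiv.Perm (Fin d)) : ℂ) ≠ 0 := by
      exact_mod_cast Fintype.card_ne_zero
    have : (Fintype.card (Equiv.Perm (Fin d)) : ℂ) • (c * B) =
        (Fintype.card (Equiv.Perm (Fin d)) : ℂ) • (B * c) := by
      rw [← mul_smul_comm, ← smul_mul_assoc, hsum, Finset.mul_sum, Finset.sum_mul]
      refine Finset.sum_congr rfl fun P _ => ?_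
      rw [Finset.mul_sum, Finset.sum_mul]
      exact Finset.sum_congr rfl fun Q _ => hcD P Q
    exact smul_right_injective _ hcard this

end PartC2
section PartD
variable (G : SimpleGraph K) [DecidableRel G.Adj] (v : K → ℕ) (ε : Arrow G → ℂ)

/-- total index set -/
abbrev Ix (v : K → ℕ) : Type := Σ i, Fin (v i)

/-- total generic matrix -/
def XX : Matrix (Ix v) (Ix v) (R G v) := fun P Q =>
  if h : G.Adj Q.1 P.1 then X G v ⟨(Q.1, P.1), h⟩ P.2 Q.2 else 0

/-- total group element -/
def hg (g : ∀ i : K, GL (Fin (v i)) ℂ) : Matrix (Ix v) (Ix v) ℂ :=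
  Matrix.blockDiagonal' fun i => (g i).val

theorem hg_mul (g h : ∀ i : K, GL (Fin (v i)) ℂ) : hg v (g * h) = hg v g * hg v h := by
  simp only [hg, ← Matrix.blockDiagonal'_mul]
  rfl

theorem hg_one : hg v 1 = 1 := by
  simp only [hg, ← Matrix.blockDiagonal'_one]
  rfl

theorem hg_star (g : ∀ i : K, GL (Fin (v i)) ℂ) : (hg v g).conjTranspose = hg v (Star.star g) := by
  simp only [hg, Matrix.blockDiagonal'_conjTranspose]
  rfl

theorem hg_cp (g : ∀ i : K, GL (Fin (v i)) ℂ) {P Q : Ix v} (h : P.1 ≠ Q.1) : hg v g P Q = 0 := by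
  rw [hg, Matrix.blockDiagonal'_apply, dif_neg h]

theorem sum_block {S : Type} [AddCommMonoid S] (i : K) (F : Ix v → S) (hF : ∀ P : Ix v, P.1 ≠ i → F P = 0) :
    ∑ P, F P = ∑ p : Fin (v i), F ⟨i, p⟩ := by
  rw [Fintype.sum_sigma, Finset.sum_eq_single i]
  · intro j _ hj
    exact Finset.sum_eq_zero fun p _ => hF _ hj
  · simp

/-- coefficient embedding of matrices -/
abbrev CM {W : Type} [Fintype W] [DecidableEq W] : Matrix W W ℂ →+* Matrix W W (R G v) :=
  (MvPolynomial.C : ℂ →+* R G v).mapMatrix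

theorem act_XX (g : ∀ i : K, GL (Fin (v i)) ℂ) :
    (XX G v).map (act G v g) = CM G v (hg v g) * XX G v * CM G v (hg v g⁻¹) := by
  ext1 P Q
  obtain ⟨i, p⟩ := P
  obtain ⟨j, q⟩ := Q
  have e1 : ∀ p', hg v g ⟨i, p⟩ ⟨i, p'⟩ = (g i).val p p' := fun p' => by
    rw [hg, Matrix.blockDiagonal'_apply_eq]
  have e2 : ∀ q', hg v g⁻¹ ⟨j, q'⟩ ⟨j, q⟩ = ((g j)⁻¹).val q' q := fun q' => by
    rw [hg, Matrix.blockDiagonal'_apply_eq]; rfl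
  rw [Matrix.map_apply, Matrix.mul_apply, sum_block v j, ]
  · have e3 : ∀ q', (CM G v (hg v g) * XX G v) ⟨i, p⟩ ⟨j, q'⟩ =
        ∑ p', MvPolynomial.C ((g i).val p p') * XX G v ⟨i, p'⟩ ⟨j, q'⟩ := by
      intro q'
      rw [Matrix.mul_apply, sum_block v i]
      · simp [e1]
      · intro P hP
        simp [hg_cp v g (P := ⟨i, p⟩) (Q := P) (fun h => hP h.symm)]
    have e4 : ∀ q', CM G v (hg v g⁻¹) ⟨j, q'⟩ ⟨j, q⟩ = MvPolynomial.C (((g j)⁻¹).val q' q) := by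
      intro q'
      rw [← e2 q']; rfl
    rw [Finset.sum_congr rfl fun q' _ => by rw [e3 q', e4 q']]
    by_cases h : G.Adj j i
    · have e5 : ∀ (p' : Fin (v i)) (q' : Fin (v j)), XX G v ⟨i, p'⟩ ⟨j, q'⟩ =
          X G v ⟨(j, i), h⟩ p' q' := fun p' q' => by rw [XX, dif_pos h]
      rw [e5, Finset.sum_congr rfl fun q' _ => by
        rw [Finset.sum_congr rfl fun p' _ => by rw [e5 p' q'], Finset.sum_mul]]
      rw [Finset.sum_comm]
      exact MvPolynomial.aeval_X _ _
    · have e5 : ∀ (p' : Fin (v i)) (q' : Fin (v j)), XX G v ⟨i, p'⟩ ⟨j, q'⟩ = 0 :=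
        fun p' q' => by rw [XX, dif_neg h]
      simp only [e5, map_zero, mul_zero, Finset.sum_const_zero, zero_mul]
  · intro P hP
    simp [hg_cp v g⁻¹ (P := P) (Q := ⟨j, q⟩) hP]

/-- edge coefficient -/
def ec (i j : K) : ℂ := if h : G.Adj j i then ε ⟨(j, i), h⟩ else 0

theorem rel_XX (i : K) (p q : Fin (v i)) : relMat G v ε i p q =
    (XX G v * CM G v (Matrix.diagonal fun Q : Ix v => ec G ε i Q.1) * XX G v) ⟨i, p⟩ ⟨i, q⟩ := by
  rw [Matrix.mul_apply, relMat, Matrix.sum_apply, Fintype.sum_sigma]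
  refine Finset.sum_congr rfl fun j _ => ?_
  have e : ∀ P Q : Ix v, (XX G v * CM G v (Matrix.diagonal fun Q : Ix v => ec G ε i Q.1)) P Q =
      XX G v P Q * MvPolynomial.C (ec G ε i Q.1) := by
    intro P Q
    rw [RingHom.mapMatrix_apply, Matrix.diagonal_map (map_zero _), Matrix.mul_diagonal]
  simp only [e]
  by_cases h : G.Adj j i
  · rw [dif_pos h, Matrix.smul_apply, Matrix.mul_apply, Finset.smul_sum]
    refine Finset.sum_congr rfl fun r _ => ?_
    simp only [XX, ec, dif_pos h, dif_pos h.symm, MvPolynomial.smul_eq_C_mul]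
    ring
  · rw [dif_neg h, Finset.sum_eq_zero]
    · rfl
    · intro r _
      simp [XX, h]

theorem rel_mem (i : K) (p q : Fin (v i)) : relMat G v ε i p q ∈ Irel G v ε :=
  Ideal.subset_span ⟨i, p, q, rfl⟩

theorem act_Irel (g : ∀ i : K, GL (Fin (v i)) ℂ) (f : R G v) (hf : f ∈ Irel G v ε) :
    act G v g f ∈ Irel G v ε := by
  suffices Irel G v ε ≤ (Irel G v ε).comap (act G v g) from this hf
  rw [Irel, Ideal.span_le]
  rintro _ ⟨i, p, q, rfl⟩
  change act G v g (relMat G v ε i p q) ∈ Irel G v ε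
  set De : Matrix (Ix v) (Ix v) ℂ := Matrix.diagonal fun Q : Ix v => ec G ε i Q.1 with hDe
  have hcomm : hg v g⁻¹ * De * hg v g = De := by
    have : De * hg v g = hg v g * De := by
      ext P Q
      rw [hDe, Matrix.diagonal_mul, Matrix.mul_diagonal]
      by_cases h : P.1 = Q.1
      · rw [h, mul_comm]
      · rw [hg_cp v g h]; simp
    rw [mul_assoc, this, ← mul_assoc, ← hg_mul, inv_mul_cancel, hg_one, one_mul]
  have h1 : (XX G v * CM G v De * XX G v).map (act G v g) =
      CM G v (hg v g) * (XX G v * CM G v De * XX G v) * CM G v (hg v g⁻¹) := by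
    have hD : (CM G v De).map (act G v g) = CM G v De := by
      ext1 P Q
      simp only [RingHom.mapMatrix_apply, Matrix.map_apply]
      exact (act G v g).commutes _
    have hmm : ∀ A B : Matrix (Ix v) (Ix v) (R G v), (A * B).map (act G v g) =
        A.map (act G v g) * B.map (act G v g) := fun A B => Matrix.map_mul
    rw [hmm, hmm, hD, act_XX]
    have hcomm' : CM G v (hg v g⁻¹) * CM G v De * CM G v (hg v g) = CM G v De := by
      rw [← map_mul, ← map_mul, hcomm]
    calc _ = CM G v (hg v g) * (XX G v * (CM G v (hg v g⁻¹) * CM G v De * CM G v (hg v g)) * XX G v)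
          * CM G v (hg v g⁻¹) := by simp only [mul_assoc]
      _ = _ := by rw [hcomm']
  have h2 := congrFun (congrFun h1 ⟨i, p⟩) ⟨i, q⟩
  rw [Matrix.map_apply, ← rel_XX] at h2
  rw [h2, Matrix.mul_apply, sum_block v i]
  · refine Ideal.sum_mem _ fun q' _ => Ideal.mul_mem_right _ _ ?_
    rw [Matrix.mul_apply, sum_block v i]
    · refine Ideal.sum_mem _ fun p' _ => Ideal.mul_mem_left _ _ ?_
      rw [hDe, ← rel_XX]
      exact rel_mem G v ε i p' q'
    · intro P hP
      simp [hg_cp v g (P := ⟨i, p⟩) (Q := P) (fun h => hP h.symm)]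
  · intro P hP
    simp [hg_cp v g⁻¹ (P := P) (Q := ⟨i, q⟩) hP]

/-- the generic tensor -/
def TX (d : ℕ) : Matrix (Fin d → Ix v) (Fin d → Ix v) (R G v) := tens d fun _ => XX G v

/-- polynomials from tensors -/
def psi (d : ℕ) : Matrix (Fin d → Ix v) (Fin d → Ix v) ℂ →ₗ[ℂ] R G v where
  toFun c := (CM G v c * TX G v d).trace
  map_add' a b := by rw [map_add, add_mul, Matrix.trace_add]
  map_smul' t a := by
    have : CM G v (t • a) = t • CM G v a := by
      ext1 P Q
      simp [MvPolynomial.smul_eq_C_mul]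
    rw [this, smul_mul_assoc, Matrix.trace_smul]; rfl

theorem tens_map (d : ℕ) (Y : Matrix (Ix v) (Ix v) ℂ) :
    CM G v (tens d fun _ => Y) = tens d fun _ => CM G v Y := by
  ext1 P Q
  simp [tens]

theorem act_psi (d : ℕ) (g : ∀ i : K, GL (Fin (v i)) ℂ) (c) :
    act G v g (psi G v d c) =
      psi G v d ((tens d fun _ => hg v g⁻¹) * c * (tens d fun _ => hg v g)) := by
  have h1 : (TX G v d).map (act G v g) = CM G v (tens d fun _ => hg v g) * TX G v d *
      CM G v (tens d fun _ => hg v g⁻¹) := by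
    rw [tens_map, tens_map, TX, tens_mul, tens_mul, ← act_XX]
    ext1 P Q
    simp [tens]
  have h2 : act G v g (psi G v d c) = (CM G v c * (TX G v d).map (act G v g)).trace := by
    change act G v g (CM G v c * TX G v d).trace = _
    simp only [Matrix.trace, Matrix.diag_apply, Matrix.mul_apply, map_sum, map_mul, Matrix.map_apply,
      RingHom.mapMatrix_apply]
    refine Finset.sum_congr rfl fun P _ => Finset.sum_congr rfl fun Q _ => ?_
    congr 1
    exact (act G v g).commutes _
  rw [h2, h1]
  change _ = (CM G v _ * TX G v d).trace
  rw [map_mul, map_mul, ← mul_assoc, Matrix.trace_mul_comm]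
  simp only [mul_assoc]

theorem psi_single (d : ℕ) (P Q : Fin d → Ix v) :
    psi G v d (Matrix.single Q P 1) = ∏ k, XX G v (P k) (Q k) := by
  change (CM G v _ * TX G v d).trace = _
  have : CM G v (Matrix.single Q P (1:ℂ)) = Matrix.single Q P 1 := by
    ext1 i j
    simp only [RingHom.mapMatrix_apply, Matrix.map_apply, Matrix.single_apply]
    split_ifs <;> simp
  rw [this, Matrix.trace_single_mul]
  simp [TX, tens]

open scoped Pointwise in
theorem psi_surj (d : ℕ) (f : R G v) (hf : f.IsHomogeneous d) : ∃ c, psi G v d c = f := by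
  have h1 : f ∈ MvPolynomial.homogeneousSubmodule (Var G v) ℂ 1 ^ d := by
    rw [MvPolynomial.homogeneousSubmodule_one_pow]; exact hf
  rw [MvPolynomial.homogeneousSubmodule_one_eq_span_X, Submodule.span_pow] at h1
  suffices Submodule.span ℂ (Set.range (MvPolynomial.X : Var G v → R G v) ^ d) ≤
    LinearMap.range (psi G v d) from this h1
  rw [Submodule.span_le]
  intro m hm
  obtain ⟨F, rfl⟩ := Set.mem_pow.mp hm
  choose x hx using fun k => (F k).2
  refine ⟨Matrix.single (fun k => ⟨src (x k).1, (x k).2.2⟩) (fun k => ⟨tgt (x k).1, (x k).2.1⟩) 1, ?_⟩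
  rw [psi_single, List.prod_ofFn]
  refine Finset.prod_congr rfl fun k _ => ?_
  rw [← hx k]
  simp only [XX]
  rw [dif_pos (x k).1.2]
  rfl

/-- blocks of the generic matrix in the quotient -/
def ab (i j : K) : Matrix (Ix v) (Ix v) (R G v ⧸ Irel G v ε) := fun P Q =>
  if P.1 = i ∧ Q.1 = j then Ideal.Quotient.mk _ (XX G v P Q) else 0

theorem ab_rel (i : K) : ∑ j, ec G ε i j • (ab G v ε i j * ab G v ε j i) = 0 := by
  ext1 P Q
  have hS : ∀ (t : ℂ) (r : R G v), t • (Ideal.Quotient.mk (Irel G v ε) r) =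
      Ideal.Quotient.mk (Irel G v ε) (MvPolynomial.C t * r) := by
    intro t r
    rw [← MvPolynomial.smul_eq_C_mul]; rfl
  by_cases h : P.1 = i ∧ Q.1 = i
  swap
  · rw [Matrix.sum_apply, Matrix.zero_apply]
    refine Finset.sum_eq_zero fun j _ => ?_
    rw [Matrix.smul_apply, Matrix.mul_apply, Finset.sum_eq_zero, smul_zero]
    intro M _
    simp only [ab]
    by_cases h1 : P.1 = i
    · have h2 : Q.1 ≠ i := fun h2 => h ⟨h1, h2⟩
      simp [h2]
    · simp [h1]
  obtain ⟨i', p⟩ := P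
  obtain ⟨i'', q⟩ := Q
  obtain ⟨h1, h2⟩ := h
  change i' = i at h1
  change i'' = i at h2
  subst h2
  subst h1
  have h3 : Ideal.Quotient.mk (Irel G v ε) (relMat G v ε i' p q) = 0 :=
    Ideal.Quotient.eq_zero_iff_mem.mpr (rel_mem G v ε _ p q)
  rw [Matrix.zero_apply, ← h3, rel_XX, Matrix.mul_apply, Fintype.sum_sigma, Matrix.sum_apply, map_sum]
  refine Finset.sum_congr rfl fun j _ => ?_
  rw [Matrix.smul_apply, Matrix.mul_apply, sum_block v j, map_sum, Finset.smul_sum]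
  · refine Finset.sum_congr rfl fun r _ => ?_
    rw [RingHom.mapMatrix_apply, Matrix.diagonal_map (map_zero _), Matrix.mul_diagonal]
    simp only [ab, and_self, if_true]
    rw [← map_mul, hS]
    congr 1
    ring
  · intro M hM
    simp [ab, hM]

theorem psi_gam (hG : ((2 : ℝ) • (1 : Matrix K K ℝ) - G.adjMatrix ℝ).PosDef)
    (hε1 : ∀ a : Arrow G, ε a = 1 ∨ ε a = -1) (d : ℕ) (hd : d ≠ 0)
    (x : Equiv.Perm (Fin d) × (Fin d → K)) :
    psi G v d (Gam (Sigma.fst : Ix v → K) d x) ∈ Irel G v ε := by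
  obtain ⟨y, hy0, hy⟩ := exists_y G hG
  have hs : ∀ i j, G.Adj i j → ec G ε i j ≠ 0 := by
    intro i j h
    rw [ec, dif_pos h.symm]
    rcases hε1 ⟨(j, i), h.symm⟩ with h | h <;> rw [h] <;> simp
  have ha : ∀ i j, ¬ G.Adj i j → ab G v ε i j = 0 := by
    intro i j h
    ext1 P Q
    simp only [ab, Matrix.zero_apply]
    split_ifs with h'
    · obtain ⟨rfl, rfl⟩ := h'
      rw [XX, dif_neg (fun h' => h h'.symm), map_zero]
    · rfl
  have hw := closed_walk G y (ab G v ε) (ec G ε) ha hs (ab_rel G v ε)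
    (Matrix.traceLinearMap (Ix v) ℂ (R G v ⧸ Irel G v ε)) (fun a b => Matrix.trace_mul_comm a b) hy0 hy
  rw [← Ideal.Quotient.eq_zero_iff_mem]
  have key := perm_sum (fun i j Y => ∃ l, l ≠ [] ∧ lst i l = j ∧ Y = wp (ab G v ε) i l)
    (by
      rintro i j k _ _ ⟨l, h1, h2, rfl⟩ ⟨m, h3, h4, rfl⟩
      refine ⟨l ++ m, by simp [h1], by rw [lst_append, h2, h4], by rw [wp_append, h2]⟩)
    (by
      rintro i _ ⟨l, h1, h2, rfl⟩
      exact hw _ i le_rfl l h1 h2)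
    (Fin d) ⟨⟨0, Nat.pos_of_ne_zero hd⟩⟩ x.1⁻¹ x.2
    (fun k => ab G v ε (x.2 k) (x.2 (x.1⁻¹ k)))
    (fun k => ⟨[x.2 (x.1⁻¹ k)], by simp, rfl, by simp [wp]⟩)
  rw [← key]
  change Ideal.Quotient.mk _ (CM G v _ * TX G v d).trace = _
  rw [Matrix.trace, map_sum]
  refine Finset.sum_congr rfl fun Q _ => ?_
  rw [Matrix.diag_apply, Matrix.mul_apply, Finset.sum_eq_single (Q ∘ x.1)]
  · by_cases h : Sigma.fst ∘ Q = x.2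
    · have h1 : CM G v (Gam (Sigma.fst : Ix v → K) d x) Q (Q ∘ x.1) = 1 := by
        simp [Gam, h]
      rw [h1, one_mul, TX, tens, map_prod]
      refine Fintype.prod_equiv x.1 _ _ fun k => ?_
      have h2 : ∀ k, (Q k).1 = x.2 k := fun k => congrFun h k
      simp [ab, h2]
    · have h1 : CM G v (Gam (Sigma.fst : Ix v → K) d x) Q (Q ∘ x.1) = 0 := by
        simp [Gam, h]
      rw [h1, zero_mul, map_zero]
      symm
      obtain ⟨k, hk⟩ := Function.ne_iff.mp h
      refine Finset.prod_eq_zero (Finset.mem_univ k) ?_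
      have hk' : (Q k).1 ≠ x.2 k := hk
      simp [ab, hk']
  · intro M _ hM
    simp [Gam, hM]
  · simp

theorem exists_g (Y : Matrix (Ix v) (Ix v) ℂ) (hY : Cp (Sigma.fst : Ix v → K) Y)
    (hu : IsUnit Y.det) : ∃ g, hg v g = Y := by
  have h1 : Y * Y⁻¹ = 1 := Matrix.mul_nonsing_inv _ hu
  have h2 : ∀ i, Y.blockDiag' i * Y⁻¹.blockDiag' i = 1 := by
    intro i
    ext p q
    have := congrFun (congrFun h1 ⟨i, p⟩) ⟨i, q⟩
    rw [Matrix.mul_apply, sum_block v i] at this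
    · rw [Matrix.mul_apply]
      simp only [Matrix.blockDiag'_apply]
      rw [this, Matrix.one_apply, Matrix.one_apply]
      simp
    · intro P hP
      rw [hY _ _ (fun h => hP h.symm), zero_mul]
  refine ⟨fun i => ⟨Y.blockDiag' i, Y⁻¹.blockDiag' i, h2 i, mul_eq_one_comm.mp (h2 i)⟩, ?_⟩
  ext ⟨i, p⟩ ⟨j, q⟩
  by_cases h : i = j
  · subst h
    rw [hg, Matrix.blockDiagonal'_apply_eq]; rfl
  · rw [hg_cp v _ h, hY _ _ h]

theorem main_homog (hG : ((2 : ℝ) • (1 : Matrix K K ℝ) - G.adjMatrix ℝ).PosDef)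
    (hε1 : ∀ a : Arrow G, ε a = 1 ∨ ε a = -1) (d : ℕ) (hd : d ≠ 0) (f : R G v)
    (hfd : f.IsHomogeneous d)
    (hf : ∀ g : ∀ i : K, GL (Fin (v i)) ℂ, act G v g f - f ∈ Irel G v ε) : f ∈ Irel G v ε := by
  obtain ⟨c0, rfl⟩ := psi_surj G v d f hfd
  let J : Submodule ℂ (Matrix (Fin d → Ix v) (Fin d → Ix v) ℂ) :=
    ((Irel G v ε).restrictScalars ℂ).comap (psi G v d)
  have hJ : ∀ c, c ∈ J ↔ psi G v d c ∈ Irel G v ε := fun c => Iff.rfl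
  obtain ⟨pr, hprJ, -, horth⟩ := hs_proj J
  set c := c0 - pr c0 with hc
  have hH : ∀ g, (tens d fun _ => hg v g) * (tens d fun _ => hg v g⁻¹) = 1 := by
    intro g
    rw [tens_mul, ← hg_mul, mul_inv_cancel, hg_one, tens_one]
  have hcJ : c ∈ J := by
    have hspan : c ∈ Submodule.span ℂ (Set.range (Gam (Sigma.fst : Ix v → K) d)) := by
      refine fft _ d c ?_
      intro Y hY hu
      obtain ⟨g, rfl⟩ := exists_g v Y hY hu
      have hz : (tens d fun _ => hg v g⁻¹) * c * (tens d fun _ => hg v g) - c = 0 := by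
        set H := tens d fun _ => hg v g with hHd
        set H' := tens d fun _ => hg v g⁻¹ with hHd'
        have hzJ : H' * c * H - c ∈ J := by
          have e : H' * c * H - c = (H' * c0 * H - c0) - (H' * pr c0 * H - pr c0) := by
            rw [hc]; noncomm_ring
          rw [e]
          refine sub_mem ?_ (sub_mem ?_ (hprJ _))
          · rw [hJ, map_sub, ← act_psi]; exact hf g
          · rw [hJ, ← act_psi]; exact act_Irel G v ε g _ (hprJ c0)
        apply hs_zero
        set z := H' * c * H - c with hzd
        have hb : ∀ b ∈ J, (b.conjTranspose * z).trace = 0 := by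
          intro b hb
          have hsH : ∀ k, (tens d fun _ => hg v k).conjTranspose = tens d fun _ => hg v (Star.star k) := by
            intro k
            ext P Q
            simp only [Matrix.conjTranspose_apply, tens, ← hg_star]
            rw [star_prod]
          have h1 : H'.conjTranspose * b * H.conjTranspose ∈ J := by
            rw [hJ, hHd, hHd', hsH, hsH]
            have e : Star.star g⁻¹ = (Star.star g)⁻¹ := by
              ext1 i
              simp
            rw [e, ← act_psi]
            exact act_Irel G v ε _ _ hb
          have h2 := horth c0 _ h1
          rw [← hc] at h2
          simp only [Matrix.conjTranspose_mul, Matrix.conjTranspose_conjTranspose] at h2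
          rw [mul_assoc, Matrix.trace_mul_comm] at h2
          rw [hzd, mul_sub, Matrix.trace_sub, horth c0 b hb, sub_zero, ← h2]
          simp only [mul_assoc]
        exact hb z hzJ
      have h3 := sub_eq_zero.mp hz
      calc c * (tens d fun _ => hg v g) = 1 * (c * (tens d fun _ => hg v g)) := (one_mul _).symm
        _ = (tens d fun _ => hg v g) * ((tens d fun _ => hg v g⁻¹) * c * (tens d fun _ => hg v g)) := by
          rw [← hH g]; simp only [mul_assoc]
        _ = _ := by rw [h3]
    have hle : Submodule.span ℂ (Set.range (Gam (Sigma.fst : Ix v → K) d)) ≤ J := by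
      rw [Submodule.span_le]
      rintro _ ⟨x, rfl⟩
      exact psi_gam G v ε hG hε1 d hd x
    exact hle hspan
  have : c0 = c + pr c0 := by rw [hc]; simp
  have h4 : c0 ∈ J := by rw [this]; exact add_mem hcJ (hprJ _)
  exact h4

theorem rel_homog (i : K) (p q : Fin (v i)) : (relMat G v ε i p q).IsHomogeneous 2 := by
  rw [relMat, Matrix.sum_apply]
  refine MvPolynomial.IsHomogeneous.sum _ _ _ fun j _ => ?_
  split_ifs with h
  · rw [Matrix.smul_apply, Matrix.mul_apply, MvPolynomial.smul_eq_C_mul]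
    refine MvPolynomial.IsHomogeneous.C_mul ?_ _
    refine MvPolynomial.IsHomogeneous.sum _ _ _ fun r _ => ?_
    exact (MvPolynomial.isHomogeneous_X _ _).mul (MvPolynomial.isHomogeneous_X _ _)
  · exact MvPolynomial.isHomogeneous_zero _ _ _

theorem Irel_homog (d : ℕ) (f : R G v) (hf : f ∈ Irel G v ε) :
    MvPolynomial.homogeneousComponent d f ∈ Irel G v ε := by
  letI := MvPolynomial.gradedAlgebra (σ := Var G v) (R := ℂ)
  refine MvPolynomial.homogeneousComponent_mem_of_mem ?_ hf d
  refine Ideal.homogeneous_span _ _ ?_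
  rintro _ ⟨i, p, q, rfl⟩
  exact ⟨2, rel_homog G v ε i p q⟩

theorem act_homog (g : ∀ i : K, GL (Fin (v i)) ℂ) (d : ℕ) (f : R G v) (hf : f.IsHomogeneous d) :
    (act G v g f).IsHomogeneous d := by
  have h := MvPolynomial.IsHomogeneous.aeval hf (n := 1) (fun x : Var G v =>
    ∑ p' : Fin (v (tgt x.1)), ∑ q' : Fin (v (src x.1)),
      MvPolynomial.C ((g (tgt x.1)).val x.2.1 p') *
        MvPolynomial.X (⟨x.1, (p', q')⟩ : Var G v) *
        MvPolynomial.C (((g (src x.1))⁻¹).val q' x.2.2)) (fun x => by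
    refine MvPolynomial.IsHomogeneous.sum _ _ _ fun p _ =>
      MvPolynomial.IsHomogeneous.sum _ _ _ fun q _ => ?_
    rw [mul_comm]
    exact ((MvPolynomial.isHomogeneous_X _ _).C_mul _).C_mul _)
  rw [one_mul] at h
  exact h

theorem act_comp (g : ∀ i : K, GL (Fin (v i)) ℂ) (d : ℕ) (f : R G v) :
    MvPolynomial.homogeneousComponent d (act G v g f) =
      act G v g (MvPolynomial.homogeneousComponent d f) := by
  conv_lhs => rw [← MvPolynomial.sum_homogeneousComponent f, map_sum, map_sum]
  have h : ∀ i, MvPolynomial.homogeneousComponent d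
      (act G v g (MvPolynomial.homogeneousComponent i f)) =
      if d = i then act G v g (MvPolynomial.homogeneousComponent i f) else 0 := fun i =>
    MvPolynomial.homogeneousComponent_of_mem
      (act_homog G v g i _ (MvPolynomial.homogeneousComponent_isHomogeneous i f))
  simp only [h]
  rw [Finset.sum_ite_eq]
  split_ifs with h'
  · rfl
  · rw [MvPolynomial.homogeneousComponent_eq_zero, map_zero]
    simpa using h'

end PartD

/-- If `G` is a (possibly disconnected) finite-type ADE Dynkin diagram,
then every `GL(v)`-invariant element of `ℂ[Rep(Π,v)] = R_v/I_v` is a scalar multiple of `1`. -/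
theorem stmt0 (G : SimpleGraph K) [DecidableRel G.Adj]
    (hG : ((2 : ℝ) • (1 : Matrix K K ℝ) - G.adjMatrix ℝ).PosDef)
    (ε : Arrow G → ℂ)
    (hε1 : ∀ a : Arrow G, ε a = 1 ∨ ε a = -1)
    (hε2 : ∀ a : Arrow G, ε (star a) = - ε a)
    (v : K → ℕ) (f : R G v)
    (hf : ∀ g : ∀ i : K, GL (Fin (v i)) ℂ, act G v g f - f ∈ Irel G v ε) :
    ∃ c : ℂ, f - MvPolynomial.C c ∈ Irel G v ε := by
  refine ⟨MvPolynomial.coeff 0 f, ?_⟩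
  have h := MvPolynomial.sum_homogeneousComponent f
  rw [Finset.sum_range_succ', MvPolynomial.homogeneousComponent_zero] at h
  rw [← eq_sub_of_add_eq h]
  refine Ideal.sum_mem _ fun d _ => ?_
  refine main_homog G v ε hG hε1 (d + 1) (Nat.succ_ne_zero d) _
    (MvPolynomial.homogeneousComponent_isHomogeneous _ f) fun g => ?_
  rw [← act_comp, ← map_sub]
  exact Irel_homog G v ε _ _ (hf g)

end Stmt0
end
end

section
/- Let G be the Dynkin graph of type D_n (n ≥ 4), E_6, E_7 or E_8, given explicitly as follows: D_n has vertices {1,…,n} and edges {i,i+1} for 1 ≤ i ≤ n−3 together with {n−2, n−1} and {n−2, n}; E_6 has vertices {1,…,6} and edges {1,2},{2,3},{3,4},{4,5},{3,6}; E_7 has vertices {1,…,7} and edges {1,2},{2,3},{3,4},{4,5},{5,6},{3,7}; E_8 has vertices {1,…,8} and edges {1,2},{2,3},{3,4},{4,5},{5,6},{6,7},{3,8}. Let δ_K : K → ℕ be the coefficient vector of the highest root, namely: for D_n, δ_K(1) = δ_K(n−1) = δ_K(n) = 1 and δ_K(i) = 2 for 2 ≤ i ≤ n−2; for E_6, δ_K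 = (1,2,3,2,1,2); for E_7, δ_K = (2,3,4,3,2,1,2); for E_8, δ_K = (2,4,6,5,4,3,2,3) (components listed in vertex order). Then the coordinate ring ℂ[Rep(Π,δ_K)] = R_{δ_K}/I_{δ_K} of the representation scheme of the preprojective algebra Π is not reduced: it contains a nonzero nilpotent element. -/
noncomputable section

open scoped BigOperators MatrixGroups

namespace Stmt1

variable {K : Type} [Fintype K] [DecidableEq K]

/-- Arrows of the double quiver of a simple graph: an arrow `⟨(i,j), h⟩` goes from `i` to `j`. -/
def Arrow (G : SimpleGraph K) : Type := {p : K × K // G.Adj p.1 p.2}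

/-- Source of an arrow. -/
abbrev src {G : SimpleGraph K} (a : Arrow G) : K := a.1.1

/-- Target of an arrow. -/
abbrev tgt {G : SimpleGraph K} (a : Arrow G) : K := a.1.2

/-- The reverse arrow `a*`. -/
def star {G : SimpleGraph K} (a : Arrow G) : Arrow G := ⟨(a.1.2, a.1.1), a.2.symm⟩

/-- Index type of the variables `x^a_{p,q}`. -/
def Var (G : SimpleGraph K) (v : K → ℕ) : Type :=
  Σ a : Arrow G, Fin (v (tgt a)) × Fin (v (src a))

/-- The polynomial ring `R_v`. -/
abbrev R (G : SimpleGraph K) (v : K → ℕ) : Type := MvPolynomial (Var G v) ℂ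

/-- The generic matrix `X_a`. -/
def X (G : SimpleGraph K) (v : K → ℕ) (a : Arrow G) :
    Matrix (Fin (v (tgt a))) (Fin (v (src a))) (R G v) :=
  fun p q => MvPolynomial.X ⟨a, (p, q)⟩

/-- Preprojective relation matrix at vertex `i`:
`∑_{a : t(a) = i} ε(a) • X_a * X_{a*}`. -/
def relMat (G : SimpleGraph K) [DecidableRel G.Adj] (v : K → ℕ) (ε : Arrow G → ℂ) (i : K) :
    Matrix (Fin (v i)) (Fin (v i)) (R G v) :=
  ∑ j : K,
    if h : G.Adj j i then
      ε ⟨(j, i), h⟩ •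
        ((X G v ⟨(j, i), h⟩ : Matrix (Fin (v i)) (Fin (v j)) (R G v)) *
          (X G v ⟨(i, j), h.symm⟩ : Matrix (Fin (v j)) (Fin (v i)) (R G v)))
    else 0

/-- The ideal `I_v` generated by the entries of the preprojective relation matrices. -/
def Irel (G : SimpleGraph K) [DecidableRel G.Adj] (v : K → ℕ) (ε : Arrow G → ℂ) :
    Ideal (R G v) :=
  Ideal.span {f | ∃ (i : K) (p q : Fin (v i)), f = relMat G v ε i p q}

/-! ### The Dynkin diagrams of type D and E, with 0-indexed vertices `0, …, n-1`
(so that the 1-indexed vertex `i` of the statement corresponds to `i - 1`). -/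

/-- Half of the adjacency relation of the type `D_n` diagram (0-indexed): edges `{i, i+1}`
for `i + 1 ≤ n - 2` (a path on the vertices `0, …, n-2`), plus the edge `{n-3, n-1}`. -/
def DAdj (n i j : ℕ) : Prop := (j = i + 1 ∧ j ≤ n - 2) ∨ (i = n - 3 ∧ j = n - 1)

/-- The dimension vector `δ_K` for type `D_n` (0-indexed):
`1` at the three outer vertices `0`, `n-2`, `n-1`, and `2` elsewhere. -/
def Dδ (n i : ℕ) : ℕ := if i = 0 ∨ i = n - 2 ∨ i = n - 1 then 1 else 2

/-- Edges of `E₆` (0-indexed): `{1,2},{2,3},{3,4},{4,5},{3,6}` (1-indexed). -/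
def E6edges : List (ℕ × ℕ) := [(0,1),(1,2),(2,3),(3,4),(2,5)]

/-- Edges of `E₇` (0-indexed). -/
def E7edges : List (ℕ × ℕ) := [(0,1),(1,2),(2,3),(3,4),(4,5),(2,6)]

/-- Edges of `E₈` (0-indexed). -/
def E8edges : List (ℕ × ℕ) := [(0,1),(1,2),(2,3),(3,4),(4,5),(5,6),(2,7)]

/-- Symmetrised adjacency from a list of edges. -/
def EAdj (E : List (ℕ × ℕ)) (i j : ℕ) : Prop := (i, j) ∈ E ∨ (j, i) ∈ E

/-- `δ_K` for `E₆`. -/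
def E6δ : List ℕ := [1,2,3,2,1,2]

/-- `δ_K` for `E₇`. -/
def E7δ : List ℕ := [2,3,4,3,2,1,2]

/-- `δ_K` for `E₈`. -/
def E8δ : List ℕ := [2,4,6,5,4,3,2,3]

/-- `G` is the Dynkin graph of type `D_n (n ≥ 4)`, `E₆`, `E₇` or `E₈`, with `δ` the
coefficient vector of the highest root. -/
def IsDynkinDE (n : ℕ) (G : SimpleGraph (Fin n)) (δ : Fin n → ℕ) : Prop :=
  (4 ≤ n ∧ (∀ i j : Fin n, G.Adj i j ↔ (DAdj n i.val j.val ∨ DAdj n j.val i.val)) ∧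
      (∀ i : Fin n, δ i = Dδ n i.val)) ∨
  (n = 6 ∧ (∀ i j : Fin n, G.Adj i j ↔ EAdj E6edges i.val j.val) ∧
      (∀ i : Fin n, δ i = E6δ.getD i.val 0)) ∨
  (n = 7 ∧ (∀ i j : Fin n, G.Adj i j ↔ EAdj E7edges i.val j.val) ∧
      (∀ i : Fin n, δ i = E7δ.getD i.val 0)) ∨
  (n = 8 ∧ (∀ i j : Fin n, G.Adj i j ↔ EAdj E8edges i.val j.val) ∧
      (∀ i : Fin n, δ i = E8δ.getD i.val 0))

section RingLemmas

variable {A0 : Type} [Ring A0]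

lemma ring_E6 (D A U : A0) (hDU : D * U = 0) (hA : A * A * A = 0)
    (hB : (A - U * D) * (A - U * D) * (A - U * D) = 0) :
    (D * A * U) * (D * A * U) = 0 ∧ (D * A * A * U) * (D * A * A * U) = 0 ∧
    (D * A * U) * (D * A * A * U) = - ((D * A * A * U) * (D * A * U)) := by
  have hDU' : ∀ x, D * (U * x) = 0 := fun x => by rw [← mul_assoc, hDU, zero_mul]
  have hA1 : A * (A * A) = 0 := by rw [← mul_assoc]; exact hA
  have hA' : ∀ x, A * (A * (A * x)) = 0 := fun x => by
    rw [← mul_assoc, ← mul_assoc, hA, zero_mul]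
  have hB0 : (A - U * D) * ((A - U * D) * (A - U * D)) = 0 := by
    simpa only [mul_assoc] using hB
  -- `D A U D A = - D A A U D`
  have h1 : D * (A * (U * (D * A))) = - (D * (A * (A * (U * D)))) := by
    have := congrArg (fun t => D * t) hB0
    simp only [mul_sub, sub_mul, mul_assoc, hDU', hA1, mul_zero, zero_mul, hA'] at this
    rw [eq_neg_iff_add_eq_zero, ← neg_eq_zero, ← this]
    abel
  have h1' : ∀ x, D * (A * (U * (D * (A * x)))) = - (D * (A * (A * (U * (D * x))))) := fun x => by
    have := congrArg (fun t => t * x) h1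
    simpa only [mul_assoc, neg_mul] using this
  have h2 : ∀ x, D * (A * (A * (U * (D * x)))) = - (D * (A * (U * (D * (A * x))))) := fun x => by
    rw [h1', neg_neg]
  refine ⟨?_, ?_, ?_⟩
  · simp only [mul_assoc, h1', hDU, mul_zero, neg_zero]
  · simp only [mul_assoc, h2, hA', mul_zero, neg_zero]
  · simp only [mul_assoc, h1']

lemma ring_E7 (D A B U : A0) (hUD : U * D = B * B) (hA : A * A = 0)
    (hDB : D * B = 0) (hBU : B * U = 0) (hB : B * B * B = 0)
    (hC : (B - A) * (B - A) * (B - A) * (B - A) = 0) :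
    (D * A * U) * (D * A * U) = 0 ∧ (D * A * B * A * U) * (D * A * B * A * U) = 0 ∧
    (D * A * U) * (D * A * B * A * U) = - ((D * A * B * A * U) * (D * A * U)) := by
  have hA' : ∀ x, A * (A * x) = 0 := fun x => by rw [← mul_assoc, hA, zero_mul]
  have hDB' : ∀ x, D * (B * x) = 0 := fun x => by rw [← mul_assoc, hDB, zero_mul]
  have hUD' : ∀ x, U * (D * x) = B * (B * x) := fun x => by rw [← mul_assoc, hUD, mul_assoc]
  have hB1 : B * (B * B) = 0 := by rw [← mul_assoc]; exact hB
  have hB' : ∀ x, B * (B * (B * x)) = 0 := fun x => by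
    rw [← mul_assoc, ← mul_assoc, hB, zero_mul]
  have hC0 : (B - A) * ((B - A) * ((B - A) * (B - A))) = 0 := by
    simpa only [mul_assoc] using hC
  -- `D A B A B = - D A B B A`
  have h1 : D * (A * (B * (A * B))) = - (D * (A * (B * (B * A)))) := by
    have := congrArg (fun t => D * t) hC0
    simp only [mul_sub, sub_mul, hDB', hB1, hA, hA', mul_zero] at this
    rw [eq_neg_iff_add_eq_zero, ← this]
    abel
  have h1' : ∀ x, D * (A * (B * (A * (B * x)))) = -(D * (A * (B * (B * (A * x))))) := fun x => by
    have := congrArg (fun t => t * x) h1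
    simpa only [mul_assoc, neg_mul] using this
  -- `B A B A U = - A B B A U`
  have h2 : B * (A * (B * (A * U))) = - (A * (B * (B * (A * U)))) := by
    have := congrArg (fun t => t * U) hC0
    simp only [mul_sub, sub_mul, mul_assoc, hBU, hB', hA', mul_zero, zero_mul] at this
    rw [eq_neg_iff_add_eq_zero, ← this]
    abel
  refine ⟨?_, ?_, ?_⟩
  · simp only [mul_assoc, hUD']
    rw [← neg_eq_zero, ← h1', hBU]; simp
  · simp only [mul_assoc, hUD', h1', h2, mul_neg, hA']
    simp
  · simp only [mul_assoc, hUD', h1', neg_neg]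

lemma ring_E8 (D A C U : A0) (hUD : U * D = C * C * C * C) (hA : A * A = 0)
    (hDC : D * C = 0) (hCU : C * U = 0) (hC : C * C * C * C * C = 0)
    (hB : (A + C) * (A + C) * (A + C) = 0) :
    (D * A * U) * (D * A * U) = 0 ∧
    (D * A * C * C * C * A * U) * (D * A * C * C * C * A * U) = 0 ∧
    (D * A * U) * (D * A * C * C * C * A * U) =
      - ((D * A * C * C * C * A * U) * (D * A * U)) := by
  have hA' : ∀ x, A * (A * x) = 0 := fun x => by rw [← mul_assoc, hA, zero_mul]
  have hDC' : ∀ x, D * (C * x) = 0 := fun x => by rw [← mul_assoc, hDC, zero_mul]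
  have hUD' : ∀ x, U * (D * x) = C * (C * (C * (C * x))) := fun x => by
    rw [← mul_assoc, hUD]; simp only [mul_assoc]
  have hC1 : C * (C * (C * (C * C))) = 0 := by simpa only [mul_assoc] using hC
  have hC' : ∀ x, C * (C * (C * (C * (C * x)))) = 0 := fun x => by
    have := congrArg (fun t => t * x) hC1
    simpa only [mul_assoc, zero_mul] using this
  have hB0 : A * (C * A) = -(A * (C * C) + C * (A * C) + C * (C * A) + C * (C * C)) := by
    simp only [mul_add, add_mul, mul_assoc, hA, zero_mul, mul_zero] at hB
    rw [eq_neg_iff_add_eq_zero, ← hB]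
    abel
  have hB' : ∀ x, A * (C * (A * x)) =
      -(A * (C * (C * x)) + C * (A * (C * x)) + C * (C * (A * x)) + C * (C * (C * x))) :=
    fun x => by
      have := congrArg (fun t => t * x) hB0
      simpa only [mul_assoc, neg_mul, add_mul] using this
  -- `D A C A = - D A C C`
  have e1 : ∀ x, D * (A * (C * (A * x))) = - (D * (A * (C * (C * x)))) := fun x => by
    rw [hB']; simp only [mul_neg, mul_add, hDC', add_zero]
  -- `D A C C A = 0`
  have e2 : ∀ x, D * (A * (C * (C * (A * x)))) = 0 := fun x => by
    rw [← neg_eq_zero, ← e1, hA']; simp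
  -- `D A C^3 A C = - D A C^4 A`
  have e3 : ∀ x, D * (A * (C * (C * (C * (A * (C * x)))))) =
      - (D * (A * (C * (C * (C * (C * (A * x))))))) := fun x => by
    have h := e2 (C * (A * x))
    rw [hB'] at h
    simp only [mul_neg, mul_add, e2, hC', mul_zero, zero_add, add_zero] at h
    rw [eq_neg_iff_add_eq_zero, ← neg_eq_zero]
    exact h
  -- `D A C^4 A C A = - D A C^4 A C C`
  have e4 : ∀ x, D * (A * (C * (C * (C * (C * (A * (C * (A * x)))))))) =
      - (D * (A * (C * (C * (C * (C * (A * (C * (C * x))))))))) := fun x => by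
    rw [hB']; simp only [mul_neg, mul_add, hC', mul_zero, add_zero]
  -- `A C C A = - A C A C - A C C C`
  have e5 : ∀ x, A * (C * (C * (A * x))) = - (A * (C * (A * (C * x)))) - A * (C * (C * (C * x))) :=
    fun x => by
      have h := hA' (C * (A * x))
      rw [hB'] at h
      simp only [mul_neg, mul_add, hA', zero_add] at h
      rw [← sub_eq_zero, ← neg_eq_zero, ← h]
      abel
  -- `D A C^4 A C C A = 0`
  have e6 : ∀ x, D * (A * (C * (C * (C * (C * (A * (C * (C * (A * x))))))))) = 0 := fun x => by
    rw [e5]; simp only [mul_sub, mul_neg, e4, neg_neg, sub_self]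
  -- mirror images of the above on the other side
  have f1 : A * (C * (A * U)) = - (C * (C * (A * U))) := by
    rw [hB']; simp only [hCU, mul_zero, zero_add, add_zero]
  have f2 : A * (C * (C * (A * U))) = 0 := by
    rw [← neg_eq_zero, ← mul_neg, ← f1, hA']
  have f3 : C * (A * (C * (C * (C * (A * U))))) = - (A * (C * (C * (C * (C * (A * U)))))) := by
    have h : A * (C * (A * (C * (C * (A * U))))) = 0 := by rw [f2]; simp
    rw [hB'] at h
    simp only [f2, hC', mul_zero, add_zero] at h
    rw [eq_neg_iff_add_eq_zero, ← neg_eq_zero, ← h]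
    abel
  refine ⟨?_, ?_, ?_⟩
  · simp only [mul_assoc, hUD']
    rw [← neg_eq_zero, ← e3, hCU]; simp
  · simp only [mul_assoc, hUD']
    rw [f3]
    simp only [mul_neg, e3, e6, neg_zero]
  · simp only [mul_assoc, hUD', e3, neg_neg]

end RingLemmas

section Gen

lemma trace_aux {a b c d : ℂ} (h1 : a * a + b * c = 0) (h2 : a * b + b * d = 0)
    (h3 : c * a + d * c = 0) (h4 : c * b + d * d = 0) : d = -a := by
  by_contra hne
  have hs : a + d ≠ 0 := fun h => hne (by linear_combination h)
  have hb : b = 0 := by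
    apply (mul_eq_zero.1 (show (a + d) * b = 0 by linear_combination h2)).resolve_left hs
  subst hb
  have ha : a = 0 := by simpa using h1
  have hd : d = 0 := by simpa using h4
  apply hne; rw [ha, hd]; simp

lemma smul_aux1 {a b : ℕ} {S : Type} [CommRing S] [Algebra ℂ S]
    (A : Matrix (Fin a) (Fin b) S) (B : Matrix (Fin b) (Fin a) S) (e : ℂ) :
    e • (A * B) = (1 : ℤ) • (e • A * (1 : ℂ) • B) := by simp

lemma smul_aux2 {a b : ℕ} {S : Type} [CommRing S] [Algebra ℂ S]
    (A : Matrix (Fin a) (Fin b) S) (B : Matrix (Fin b) (Fin a) S) (e : ℂ) :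
    e • (A * B) = (-1 : ℤ) • ((1 : ℂ) • A * (-e) • B) := by simp

/-- Two anticommuting square-zero `2 × 2` complex matrices have zero product. -/
lemma two_by_two {k : ℕ} (hk : k = 2) (P Q : Matrix (Fin k) (Fin k) ℂ) (hP : P * P = 0)
    (hQ : Q * Q = 0) (hPQ : P * Q = -(Q * P)) : P * Q = 0 := by
  subst hk
  have p00 := congrFun (congrFun hP 0) 0
  have p01 := congrFun (congrFun hP 0) 1
  have p10 := congrFun (congrFun hP 1) 0
  have p11 := congrFun (congrFun hP 1) 1
  have q00 := congrFun (congrFun hQ 0) 0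
  have q01 := congrFun (congrFun hQ 0) 1
  have q10 := congrFun (congrFun hQ 1) 0
  have q11 := congrFun (congrFun hQ 1) 1
  have r00 := congrFun (congrFun hPQ 0) 0
  have r01 := congrFun (congrFun hPQ 0) 1
  have r10 := congrFun (congrFun hPQ 1) 0
  have r11 := congrFun (congrFun hPQ 1) 1
  simp only [Matrix.mul_apply, Fin.sum_univ_two, Matrix.zero_apply, Matrix.neg_apply] at p00 p01 p10 p11 q00 q01 q10 q11 r00
  have hd : P 1 1 = - P 0 0 := trace_aux p00 p01 p10 p11
  have hh : Q 1 1 = - Q 0 0 := trace_aux q00 q01 q10 q11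
  have e1 : P 0 0 * Q 0 0 + P 0 1 * Q 1 0 = 0 := by
    apply pow_eq_zero_iff (two_ne_zero) |>.1
    linear_combination (P 0 1 * Q 1 0) * r00 + (Q 0 0)^2 * p00 - (P 0 1 * P 1 0) * q00
  have e2 : P 0 0 * Q 0 1 - P 0 1 * Q 0 0 = 0 := by
    apply pow_eq_zero_iff (two_ne_zero) |>.1
    linear_combination (-(P 0 1 * Q 0 1)) * r00 + (Q 0 1)^2 * p00 + (P 0 1)^2 * q00
  have e3 : P 1 0 * Q 0 0 - P 0 0 * Q 1 0 = 0 := by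
    apply pow_eq_zero_iff (two_ne_zero) |>.1
    linear_combination (-(P 1 0 * Q 1 0)) * r00 + (Q 1 0)^2 * p00 + (P 1 0)^2 * q00
  ext i j
  fin_cases i <;> fin_cases j <;> simp [Matrix.mul_apply, Fin.sum_univ_two, hd, hh]
  · exact e1
  · linear_combination e2
  · linear_combination e3
  · linear_combination r00 - e1

lemma mul_pow_succ_rect {a b : Type} [Fintype a] [Fintype b] [DecidableEq a] [DecidableEq b]
    {S : Type} [CommRing S] (X : Matrix a b S) (Y : Matrix b a S) (k : ℕ) :
    (X * Y) ^ (k + 1) = X * (Y * X) ^ k * Y := by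
  induction k with
  | zero => simp
  | succ k ih => rw [pow_succ, ih, pow_succ]; simp only [Matrix.mul_assoc]

/-- Families of matrices indexed by pairs of vertices. -/
abbrev Fam (n : ℕ) (δ : Fin n → ℕ) (S : Type) : Type :=
  ∀ i j : Fin n, Matrix (Fin (δ i)) (Fin (δ j)) S

/-- The standard sign. -/
def sg {n : ℕ} (i j : Fin n) : ℤ := if i < j then 1 else -1

/-- `M` is a point of the representation scheme, for the standard sign function. -/
def IsPt {n : ℕ} (G : SimpleGraph (Fin n)) (δ : Fin n → ℕ) {S : Type} [CommRing S]
    (M : Fam n δ S) : Prop :=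
  (∀ i j, ¬ G.Adj i j → M i j = 0) ∧ ∀ i, ∑ j, sg i j • (M i j * M j i) = 0

lemma IsPt.rel {n : ℕ} {G : SimpleGraph (Fin n)} {δ : Fin n → ℕ} {S : Type} [CommRing S]
    {M : Fam n δ S} (h : IsPt G δ M) (i : Fin n) (s : Finset (Fin n))
    (hs : ∀ j, G.Adj i j → j ∈ s) : ∑ j ∈ s, sg i j • (M i j * M j i) = 0 := by
  rw [← h.2 i]
  apply Finset.sum_subset (Finset.subset_univ s)
  intro j _ hj
  rw [h.1 i j (fun hh => hj (hs j hh))]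
  simp

variable {n : ℕ} (G : SimpleGraph (Fin n)) [DecidableRel G.Adj] (δ : Fin n → ℕ) (ε : Arrow G → ℂ)

/-- Sign-normalised generic matrices. -/
def tw (i j : Fin n) : Matrix (Fin (δ i)) (Fin (δ j)) (R G δ) :=
  if h : G.Adj j i then
    (if i < j then ε ⟨(j, i), h⟩ else 1) •
      (X G δ ⟨(j, i), h⟩ : Matrix (Fin (δ i)) (Fin (δ j)) (R G δ))
  else 0

lemma relMat_eq (hε2 : ∀ a : Arrow G, ε (star a) = - ε a) (i : Fin n) :
    relMat G δ ε i = ∑ j, sg i j • (tw G δ ε i j * tw G δ ε j i) := by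
  unfold relMat
  refine Finset.sum_congr rfl fun j _ => ?_
  unfold tw
  by_cases h : G.Adj j i
  · rw [dif_pos h, dif_pos h, dif_pos h.symm]
    have hs : ε ⟨(i, j), h.symm⟩ = - ε ⟨(j, i), h⟩ := hε2 ⟨(j, i), h⟩
    rcases lt_trichotomy i j with hl | hl | hl
    · have : ¬ j < i := not_lt.2 hl.le
      simp only [sg, hl, this, if_true, if_false]
      exact smul_aux1 _ _ _
    · subst hl; exact absurd h (G.irrefl)
    · have : ¬ i < j := not_lt.2 hl.le
      simp only [sg, hl, this, if_true, if_false, hs]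
      exact smul_aux2 _ _ _
  · rw [dif_neg h, dif_neg h]; simp

instance : Finite (Var G δ) := by
  unfold Var Arrow
  infer_instance

theorem key (hε1 : ∀ a : Arrow G, ε a = 1 ∨ ε a = -1)
    (hε2 : ∀ a : Arrow G, ε (star a) = - ε a) (m : Fin n)
    (W : ∀ (S : Type) [CommRing S], Fam n δ S → Matrix (Fin (δ m)) (Fin (δ m)) S)
    (hW : ∀ (S T : Type) [CommRing S] [CommRing T] (φ : S →+* T) (M : Fam n δ S),
      W T (fun i j => (M i j).map φ) = (W S M).map φ)
    (hC : ∀ M : Fam n δ ℂ, IsPt G δ M → W ℂ M = 0)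
    (S : Type) [CommRing S] [Algebra ℂ S] (z : Fam n δ S) (hz : IsPt G δ z)
    (hWz : W S z ≠ 0) :
    ∃ x : R G δ ⧸ Irel G δ ε, x ≠ 0 ∧ IsNilpotent x := by
  -- any entry of `W` of the generic matrices is nilpotent
  have hnil : ∀ p q, W _ (tw G δ ε) p q ∈ (Irel G δ ε).radical := by
    intro p q
    rw [← MvPolynomial.vanishingIdeal_zeroLocus_eq_radical (K := ℂ),
      MvPolynomial.mem_vanishingIdeal_iff]
    intro x hx
    rw [MvPolynomial.mem_zeroLocus_iff] at hx
    let φ : R G δ →+* ℂ := (MvPolynomial.aeval x : R G δ →ₐ[ℂ] ℂ).toRingHom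
    have h1 : IsPt G δ (fun i j => (tw G δ ε i j).map φ) := by
      constructor
      · intro i j hij
        have : ¬ G.Adj j i := fun h => hij h.symm
        simp [tw, this]
      · intro i
        have h2 : (relMat G δ ε i).map φ = 0 := by
          ext p q
          exact hx _ (Ideal.subset_span ⟨i, p, q, rfl⟩)
        rw [relMat_eq G δ ε hε2] at h2
        rw [← h2]
        ext p q
        simp only [Matrix.map_apply, Matrix.sum_apply, Matrix.smul_apply, Matrix.mul_apply, map_sum, map_zsmul, map_mul]
    have h3 := hC _ h1
    rw [hW] at h3
    exact congrFun (congrFun h3 p) q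
  -- some entry is nonzero
  let φ : R G δ →ₐ[ℂ] S := MvPolynomial.aeval (fun a : Var G δ =>
      (if tgt a.1 < src a.1 then ε a.1 else 1) • z (tgt a.1) (src a.1) a.2.1 a.2.2)
  have hφ : ∀ i j, (tw G δ ε i j).map (φ : R G δ →+* S) = z i j := by
    intro i j
    by_cases h : G.Adj j i
    · ext p q
      have h4 : φ (X G δ ⟨(j, i), h⟩ p q) =
        (if i < j then ε ⟨(j, i), h⟩ else 1) • z i j p q :=
          MvPolynomial.aeval_X _ _
      have h5 : (if i < j then ε ⟨(j, i), h⟩ else 1) * (if i < j then ε ⟨(j, i), h⟩ else 1)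
          = (1 : ℂ) := by
        split_ifs
        · rcases hε1 ⟨(j, i), h⟩ with h | h <;> rw [h] <;> norm_num
        · norm_num
      have h6 : tw G δ ε i j p q = (if i < j then ε ⟨(j, i), h⟩ else 1) • X G δ ⟨(j, i), h⟩ p q := by
        unfold tw
        rw [dif_pos h]
        rfl
      change φ (tw G δ ε i j p q) = _
      rw [h6]
      refine (map_smul φ _ _).trans ?_
      refine (congrArg (fun t => (if i < j then ε ⟨(j, i), h⟩ else (1 : ℂ)) • t) h4).trans ?_
      refine (smul_smul _ _ _).trans ?_
      refine (congrArg (fun t => t • z i j p q) h5).trans ?_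
      exact one_smul _ _
    · rw [hz.1 i j (fun hh => h hh.symm)]
      simp [tw, h]
  have hker : ∀ f ∈ Irel G δ ε, φ f = 0 := by
    intro f hf
    have : Irel G δ ε ≤ RingHom.ker (φ : R G δ →+* S) := by
      unfold Irel
      rw [Ideal.span_le]
      rintro f ⟨i, p, q, rfl⟩
      have h2 : (relMat G δ ε i).map (φ : R G δ →+* S) = 0 := by
        rw [relMat_eq G δ ε hε2, ← hz.2 i]
        simp only [← hφ]
        ext p q
        simp only [Matrix.map_apply, Matrix.sum_apply, Matrix.smul_apply, Matrix.mul_apply, map_sum, map_zsmul, map_mul]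
      exact congrFun (congrFun h2 p) q
    exact this hf
  obtain ⟨p, q, hpq⟩ : ∃ p q, W S z p q ≠ 0 := by
    by_contra hcon
    push Not at hcon
    exact hWz (by ext p q; exact hcon p q)
  refine ⟨Ideal.Quotient.mk _ (W _ (tw G δ ε) p q), ?_, ?_⟩
  · rw [Ne, Ideal.Quotient.eq_zero_iff_mem]
    intro hmem
    apply hpq
    have h5 := hW _ _ (φ : R G δ →+* S) (tw G δ ε)
    simp only [hφ] at h5
    have h6 := congrFun (congrFun h5 p) q
    rw [h6]
    exact hker _ hmem
  · obtain ⟨k, hk⟩ := hnil p q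
    refine ⟨k, ?_⟩
    rw [← map_pow, Ideal.Quotient.eq_zero_iff_mem]
    exact hk

end Gen

section Rel

variable {n : ℕ} {G : SimpleGraph (Fin n)} {δ : Fin n → ℕ} {S : Type} [CommRing S]
    {M : Fam n δ S}

lemma IsPt.rel1 (h : IsPt G δ M) (i j : Fin n) (hs : ∀ x, G.Adj i x → x = j) :
    M i j * M j i = 0 := by
  have := h.rel i {j} (by simpa using hs)
  rw [Finset.sum_singleton] at this
  unfold sg at this
  split_ifs at this <;> simpa using this

lemma IsPt.rel2 (h : IsPt G δ M) (i j k : Fin n) (hji : j < i) (hik : i < k)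
    (hs : ∀ x, G.Adj i x → x = j ∨ x = k) :
    M i k * M k i = M i j * M j i := by
  have := h.rel i {j, k} (by simpa using hs)
  rw [Finset.sum_pair (hji.trans hik).ne] at this
  simp only [sg, hik, not_lt.2 hji.le, if_true, if_false, one_smul, neg_smul] at this
  rw [← sub_eq_zero, ← this]; abel

lemma IsPt.rel3 (h : IsPt G δ M) (i j k l : Fin n) (hji : j < i) (hik : i < k) (hkl : k < l)
    (hs : ∀ x, G.Adj i x → x = j ∨ x = k ∨ x = l) :
    M i k * M k i + M i l * M l i = M i j * M j i := by
  have := h.rel i {j, k, l} (by simpa using hs)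
  rw [Finset.sum_insert (by simp [(hji.trans hik).ne, (hji.trans (hik.trans hkl)).ne]),
    Finset.sum_pair hkl.ne] at this
  simp only [sg, hik, hik.trans hkl, not_lt.2 hji.le, if_true, if_false, one_smul, neg_smul] at this
  rw [← sub_eq_zero, ← this]; abel

lemma IsPt.map {T : Type} [CommRing T] (φ : S →+* T) (h : IsPt G δ M) :
    IsPt G δ (fun i j => (M i j).map φ) := by
  constructor
  · intro i j hij
    simp [h.1 i j hij]
  · intro i
    have h2 := congrArg (fun A => A.map φ) (h.2 i)
    simp only [Matrix.map_zero φ (map_zero φ)] at h2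
    rw [← h2]
    ext p q
    simp only [Matrix.map_apply, Matrix.sum_apply, Matrix.smul_apply, Matrix.mul_apply, map_sum, map_zsmul, map_mul]

end Rel

section Rect

variable {m c : ℕ} (D : Matrix (Fin m) (Fin c) ℂ) (U : Matrix (Fin c) (Fin m) ℂ)
  (A B C : Matrix (Fin c) (Fin c) ℂ)

lemma rect_E6 (hDU : D * U = 0) (hA : A * A * A = 0)
    (hB : (A - U * D) * (A - U * D) * (A - U * D) = 0) :
    (D * A * U) * (D * A * U) = 0 ∧ (D * A * A * U) * (D * A * A * U) = 0 ∧
    (D * A * U) * (D * A * A * U) = - ((D * A * A * U) * (D * A * U)) := by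
  have := ring_E6 (Matrix.fromBlocks 0 D 0 0) (Matrix.fromBlocks 0 0 0 A)
    (Matrix.fromBlocks 0 0 U 0) (by simp [Matrix.fromBlocks_multiply, hDU])
    (by simp [Matrix.fromBlocks_multiply, hA])
    (by
      rw [sub_eq_add_neg] at hB
      simp [Matrix.fromBlocks_multiply, sub_eq_add_neg, Matrix.fromBlocks_neg,
        Matrix.fromBlocks_add, hB])
  simpa [Matrix.fromBlocks_multiply, Matrix.fromBlocks_neg, ← Matrix.fromBlocks_zero,
    Matrix.fromBlocks_inj] using this

lemma rect_E7 (hUD : U * D = B * B) (hA : A * A = 0)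
    (hDB : D * B = 0) (hBU : B * U = 0) (hB : B * B * B = 0)
    (hC : (B - A) * (B - A) * (B - A) * (B - A) = 0) :
    (D * A * U) * (D * A * U) = 0 ∧ (D * A * B * A * U) * (D * A * B * A * U) = 0 ∧
    (D * A * U) * (D * A * B * A * U) = - ((D * A * B * A * U) * (D * A * U)) := by
  have := ring_E7 (Matrix.fromBlocks 0 D 0 0) (Matrix.fromBlocks 0 0 0 A)
    (Matrix.fromBlocks 0 0 0 B)
    (Matrix.fromBlocks 0 0 U 0) (by simp [Matrix.fromBlocks_multiply, hUD])
    (by simp [Matrix.fromBlocks_multiply, hA]) (by simp [Matrix.fromBlocks_multiply, hDB])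
    (by simp [Matrix.fromBlocks_multiply, hBU]) (by simp [Matrix.fromBlocks_multiply, hB])
    (by
      rw [sub_eq_add_neg] at hC
      simp [Matrix.fromBlocks_multiply, sub_eq_add_neg, Matrix.fromBlocks_neg,
        Matrix.fromBlocks_add, hC])
  simpa [Matrix.fromBlocks_multiply, Matrix.fromBlocks_neg, ← Matrix.fromBlocks_zero,
    Matrix.fromBlocks_inj] using this

lemma rect_E8 (hUD : U * D = C * C * C * C) (hA : A * A = 0)
    (hDC : D * C = 0) (hCU : C * U = 0) (hC : C * C * C * C * C = 0)
    (hB : (A + C) * (A + C) * (A + C) = 0) :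
    (D * A * U) * (D * A * U) = 0 ∧
    (D * A * C * C * C * A * U) * (D * A * C * C * C * A * U) = 0 ∧
    (D * A * U) * (D * A * C * C * C * A * U) =
      - ((D * A * C * C * C * A * U) * (D * A * U)) := by
  have := ring_E8 (Matrix.fromBlocks 0 D 0 0) (Matrix.fromBlocks 0 0 0 A)
    (Matrix.fromBlocks 0 0 0 C)
    (Matrix.fromBlocks 0 0 U 0) (by simp [Matrix.fromBlocks_multiply, hUD])
    (by simp [Matrix.fromBlocks_multiply, hA]) (by simp [Matrix.fromBlocks_multiply, hDC])
    (by simp [Matrix.fromBlocks_multiply, hCU]) (by simp [Matrix.fromBlocks_multiply, hC])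
    (by simp [Matrix.fromBlocks_multiply, Matrix.fromBlocks_add, hB])
  simpa [Matrix.fromBlocks_multiply, Matrix.fromBlocks_neg, ← Matrix.fromBlocks_zero,
    Matrix.fromBlocks_inj] using this

end Rect

section Dual

/-- Base change of dual numbers from the integers to the complex numbers. -/
def iot : DualNumber ℤ →+* DualNumber ℂ where
  toFun x := (TrivSqZeroExt.inl (x.fst : ℂ) + TrivSqZeroExt.inr (x.snd : ℂ))
  map_one' := by ext <;> simp
  map_zero' := by ext <;> simp
  map_add' x y := by ext <;> simp
  map_mul' x y := by ext <;> simp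

lemma iot_ne {x : DualNumber ℤ} (h : x.snd ≠ 0) : iot x ≠ 0 := by
  intro h0
  have := congrArg TrivSqZeroExt.snd h0
  simp [iot] at this
  exact h this

instance decEqDual : DecidableEq (DualNumber ℤ) := inferInstanceAs (DecidableEq (ℤ × ℤ))

/-- Table lookup. -/
def look (t : List (List (List (ℕ × ℕ × ℤ × ℤ)))) (i j p q : ℕ) : DualNumber ℤ :=
  ((t.getD i []).getD j []).foldr
    (fun e acc => if e.1 = p ∧ e.2.1 = q then (e.2.2.1, e.2.2.2) else acc) ((0 : ℤ), (0 : ℤ))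

/-- The family of matrices given by a table. -/
def tabFam (t : List (List (List (ℕ × ℕ × ℤ × ℤ)))) (n : ℕ) (δ : Fin n → ℕ) :
    Fam n δ (DualNumber ℤ) := fun i j p q => look t i j p q

/-- Vectors given by a list. -/
def vl (k : ℕ) (L : List (ℤ × ℤ)) : Fin k → DualNumber ℤ := fun p => L.getD p ((0 : ℤ), (0 : ℤ))

lemma tab_step (t : List (List (List (ℕ × ℕ × ℤ × ℤ)))) {n : ℕ} {δ : Fin n → ℕ} (i j : Fin n)
    (L L' : List (ℤ × ℤ))
    (h : ∀ p : Fin (δ i), ∑ k : Fin (δ j), look t i j p k * vl (δ j) L k = vl (δ i) L' p) :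
    (tabFam t n δ i j).mulVec (vl (δ j) L) = vl (δ i) L' := by
  ext1 p
  exact h p

lemma tab_isPt (t : List (List (List (ℕ × ℕ × ℤ × ℤ)))) {n : ℕ} (δ : Fin n → ℕ)
    (G : SimpleGraph (Fin n))
    (h1 : ∀ i j : Fin n, ¬ G.Adj i j → (t.getD i []).getD j [] = [])
    (h2 : ∀ i : Fin n, ∀ p q : Fin (δ i),
      ∑ j : Fin n, sg i j • ∑ k : Fin (δ j), look t i j p k * look t j i k q = 0) :
    IsPt G δ (tabFam t n δ) := by
  constructor
  · intro i j hij
    refine Matrix.ext fun p q => ?_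
    simp only [tabFam, look, h1 i j hij]
    rfl
  · intro i
    refine Matrix.ext fun p q => ?_
    simp only [Matrix.sum_apply, Matrix.smul_apply, Matrix.mul_apply]
    exact h2 i p q

end Dual

section Tab

/-- A point over the dual numbers for `E6`. -/
def tabE6 : List (List (List (ℕ × ℕ × ℤ × ℤ))) :=
  [[[],
    [(0, 0, 1, 0)],
    [],
    [],
    [],
    []],
   [[(1, 0, 1, 0)],
    [],
    [(0, 0, 1, 0), (1, 1, 1, 0)],
    [],
    [],
    []],
   [[],
    [(1, 0, 1, 0), (2, 1, 1, 0)],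
    [],
    [(0, 1, 0, -1), (1, 0, 1, 0), (2, 1, 1, 0)],
    [],
    [(0, 0, 1, 0), (1, 1, 0, -1)]],
   [[],
    [],
    [(0, 0, 1, 0), (0, 2, 0, 1), (1, 1, 1, 0)],
    [],
    [(1, 0, 1, 0)],
    []],
   [[],
    [],
    [],
    [(0, 0, 1, 0)],
    [],
    []],
   [[],
    [],
    [(0, 1, 0, 1), (1, 2, 1, 0)],
    [],
    [],
    []]]

abbrev dlE6 : Fin 6 → ℕ := fun i => E6δ.getD i.val 0

lemma tabE6_isPt (G : SimpleGraph (Fin 6))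
    (hG : ∀ i j : Fin 6, G.Adj i j ↔ EAdj E6edges i.val j.val) :
    IsPt G dlE6 (tabFam tabE6 6 dlE6) := by
  apply tab_isPt
  · intro i j
    rw [hG]
    unfold EAdj
    revert i j
    decide +kernel
  · decide +kernel

lemma tabE6_vec (v : Fin (dlE6 5) → DualNumber ℤ) (hv : v = vl (dlE6 5) [(1, 0), (0, 0)]) :
    (fun M : Fam 6 dlE6 (DualNumber ℤ) =>
        (M 5 2).mulVec (
        (M 2 1).mulVec (
        (M 1 2).mulVec (
        (M 2 5).mulVec (
        (M 5 2).mulVec (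
        (M 2 1).mulVec (
        (M 1 2).mulVec (
        (M 2 1).mulVec (
        (M 1 2).mulVec (
        (M 2 5).mulVec v)))))))))) (tabFam tabE6 6 dlE6) = vl (dlE6 5) [(0, 0), (0, -1)] := by
  subst hv
  dsimp only
  rw [tab_step tabE6 2 5 [(1, 0), (0, 0)]
    [(1, 0), (0, 0), (0, 0)] (by decide +kernel)]
  rw [tab_step tabE6 1 2 [(1, 0), (0, 0), (0, 0)]
    [(1, 0), (0, 0)] (by decide +kernel)]
  rw [tab_step tabE6 2 1 [(1, 0), (0, 0)]
    [(0, 0), (1, 0), (0, 0)] (by decide +kernel)]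
  rw [tab_step tabE6 1 2 [(0, 0), (1, 0), (0, 0)]
    [(0, 0), (1, 0)] (by decide +kernel)]
  rw [tab_step tabE6 2 1 [(0, 0), (1, 0)]
    [(0, 0), (0, 0), (1, 0)] (by decide +kernel)]
  rw [tab_step tabE6 5 2 [(0, 0), (0, 0), (1, 0)]
    [(0, 0), (1, 0)] (by decide +kernel)]
  rw [tab_step tabE6 2 5 [(0, 0), (1, 0)]
    [(0, 0), (0, -1), (0, 0)] (by decide +kernel)]
  rw [tab_step tabE6 1 2 [(0, 0), (0, -1), (0, 0)]
    [(0, 0), (0, -1)] (by decide +kernel)]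
  rw [tab_step tabE6 2 1 [(0, 0), (0, -1)]
    [(0, 0), (0, 0), (0, -1)] (by decide +kernel)]
  rw [tab_step tabE6 5 2 [(0, 0), (0, 0), (0, -1)]
    [(0, 0), (0, -1)] (by decide +kernel)]

/-- A point over the dual numbers for `E7`. -/
def tabE7 : List (List (List (ℕ × ℕ × ℤ × ℤ))) :=
  [[[],
    [(0, 1, 0, 1), (1, 2, 1, 0)],
    [],
    [],
    [],
    [],
    []],
   [[(0, 0, 1, 0), (1, 1, 0, -1)],
    [],
    [(0, 2, 0, 1), (1, 1, 1, 0), (2, 3, 1, 0)],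
    [],
    [],
    [],
    []],
   [[],
    [(0, 0, 1, 0), (1, 2, 0, -1), (2, 1, 1, 0)],
    [],
    [(1, 0, 1, 0), (2, 1, 1, 0), (3, 2, 1, 0)],
    [],
    [],
    [(0, 1, 0, 1), (1, 0, -1, 0), (3, 1, -1, 0)]],
   [[],
    [],
    [(0, 0, 1, 0), (1, 1, 1, 0), (2, 2, 1, 0)],
    [],
    [(1, 0, 1, 0), (2, 1, 1, 0)],
    [],
    []],
   [[],
    [],
    [],
    [(0, 0, 1, 0), (1, 1, 1, 0)],
    [],
    [(1, 0, 1, 0)],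
    []],
   [[],
    [],
    [],
    [],
    [(0, 0, 1, 0)],
    [],
    []],
   [[],
    [],
    [(0, 0, 1, 0), (0, 3, 0, 1), (1, 2, 1, 0)],
    [],
    [],
    [],
    []]]

abbrev dlE7 : Fin 7 → ℕ := fun i => E7δ.getD i.val 0

lemma tabE7_isPt (G : SimpleGraph (Fin 7))
    (hG : ∀ i j : Fin 7, G.Adj i j ↔ EAdj E7edges i.val j.val) :
    IsPt G dlE7 (tabFam tabE7 7 dlE7) := by
  apply tab_isPt
  · intro i j
    rw [hG]
    unfold EAdj
    revert i j
    decide +kernel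
  · decide +kernel

lemma tabE7_vec (v : Fin (dlE7 0) → DualNumber ℤ) (hv : v = vl (dlE7 0) [(1, 0), (0, 0)]) :
    (fun M : Fam 7 dlE7 (DualNumber ℤ) =>
        (M 0 1).mulVec (
        (M 1 2).mulVec (
        (M 2 6).mulVec (
        (M 6 2).mulVec (
        (M 2 1).mulVec (
        (M 1 0).mulVec (
        (M 0 1).mulVec (
        (M 1 2).mulVec (
        (M 2 6).mulVec (
        (M 6 2).mulVec (
        (M 2 1).mulVec (
        (M 1 2).mulVec (
        (M 2 6).mulVec (
        (M 6 2).mulVec (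
        (M 2 1).mulVec (
        (M 1 0).mulVec v)))))))))))))))) (tabFam tabE7 7 dlE7) = vl (dlE7 0) [(0, 0), (0, 1)] := by
  subst hv
  dsimp only
  rw [tab_step tabE7 1 0 [(1, 0), (0, 0)]
    [(1, 0), (0, 0), (0, 0)] (by decide +kernel)]
  rw [tab_step tabE7 2 1 [(1, 0), (0, 0), (0, 0)]
    [(1, 0), (0, 0), (0, 0), (0, 0)] (by decide +kernel)]
  rw [tab_step tabE7 6 2 [(1, 0), (0, 0), (0, 0), (0, 0)]
    [(1, 0), (0, 0)] (by decide +kernel)]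
  rw [tab_step tabE7 2 6 [(1, 0), (0, 0)]
    [(0, 0), (-1, 0), (0, 0), (0, 0)] (by decide +kernel)]
  rw [tab_step tabE7 1 2 [(0, 0), (-1, 0), (0, 0), (0, 0)]
    [(0, 0), (-1, 0), (0, 0)] (by decide +kernel)]
  rw [tab_step tabE7 2 1 [(0, 0), (-1, 0), (0, 0)]
    [(0, 0), (0, 0), (-1, 0), (0, 0)] (by decide +kernel)]
  rw [tab_step tabE7 6 2 [(0, 0), (0, 0), (-1, 0), (0, 0)]
    [(0, 0), (-1, 0)] (by decide +kernel)]
  rw [tab_step tabE7 2 6 [(0, 0), (-1, 0)]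
    [(0, -1), (0, 0), (0, 0), (1, 0)] (by decide +kernel)]
  rw [tab_step tabE7 1 2 [(0, -1), (0, 0), (0, 0), (1, 0)]
    [(0, 0), (0, 0), (1, 0)] (by decide +kernel)]
  rw [tab_step tabE7 0 1 [(0, 0), (0, 0), (1, 0)]
    [(0, 0), (1, 0)] (by decide +kernel)]
  rw [tab_step tabE7 1 0 [(0, 0), (1, 0)]
    [(0, 0), (0, -1), (0, 0)] (by decide +kernel)]
  rw [tab_step tabE7 2 1 [(0, 0), (0, -1), (0, 0)]
    [(0, 0), (0, 0), (0, -1), (0, 0)] (by decide +kernel)]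
  rw [tab_step tabE7 6 2 [(0, 0), (0, 0), (0, -1), (0, 0)]
    [(0, 0), (0, -1)] (by decide +kernel)]
  rw [tab_step tabE7 2 6 [(0, 0), (0, -1)]
    [(0, 0), (0, 0), (0, 0), (0, 1)] (by decide +kernel)]
  rw [tab_step tabE7 1 2 [(0, 0), (0, 0), (0, 0), (0, 1)]
    [(0, 0), (0, 0), (0, 1)] (by decide +kernel)]
  rw [tab_step tabE7 0 1 [(0, 0), (0, 0), (0, 1)]
    [(0, 0), (0, 1)] (by decide +kernel)]

/-- A point over the dual numbers for `E8`. -/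
def tabE8 : List (List (List (ℕ × ℕ × ℤ × ℤ))) :=
  [[[],
    [(0, 0, 1, 0), (1, 2, 1, 0)],
    [],
    [],
    [],
    [],
    [],
    []],
   [[(1, 0, 1, 0), (3, 1, 1, 0)],
    [],
    [(0, 0, 1, 0), (1, 1, 1, 0), (2, 3, 1, 0), (3, 4, 1, 0)],
    [],
    [],
    [],
    [],
    []],
   [[],
    [(1, 0, 1, 0), (2, 1, 1, 0), (4, 2, 1, 0), (5, 3, 1, 0)],
    [],
    [(0, 0, 1, 0), (1, 4, 0, -1), (2, 1, 1, 0), (3, 2, 1, 0), (4, 3, 1, 0)],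
    [],
    [],
    [],
    [(0, 2, 0, -1), (1, 0, 1, 0), (3, 1, -1, 0), (5, 2, 1, 0)]],
   [[],
    [],
    [(0, 4, 0, 1), (1, 1, 1, 0), (2, 2, 1, 0), (3, 3, 1, 0), (4, 5, 1, 0)],
    [],
    [(0, 0, 1, 0), (1, 3, 0, -1), (2, 1, 1, 0), (3, 2, 1, 0)],
    [],
    [],
    []],
   [[],
    [],
    [],
    [(0, 3, 0, 1), (1, 1, 1, 0), (2, 2, 1, 0), (3, 4, 1, 0)],
    [],
    [(0, 0, 1, 0), (1, 2, 0, -1), (2, 1, 1, 0)],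
    [],
    []],
   [[],
    [],
    [],
    [],
    [(0, 2, 0, 1), (1, 1, 1, 0), (2, 3, 1, 0)],
    [],
    [(0, 0, 1, 0), (1, 1, 0, -1)],
    []],
   [[],
    [],
    [],
    [],
    [],
    [(0, 1, 0, 1), (1, 2, 1, 0)],
    [],
    []],
   [[],
    [],
    [(0, 0, 1, 0), (0, 5, 0, 1), (1, 2, 1, 0), (2, 4, 1, 0)],
    [],
    [],
    [],
    [],
    []]]

abbrev dlE8 : Fin 8 → ℕ := fun i => E8δ.getD i.val 0

lemma tabE8_isPt (G : SimpleGraph (Fin 8))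
    (hG : ∀ i j : Fin 8, G.Adj i j ↔ EAdj E8edges i.val j.val) :
    IsPt G dlE8 (tabFam tabE8 8 dlE8) := by
  apply tab_isPt
  · intro i j
    rw [hG]
    unfold EAdj
    revert i j
    decide +kernel
  · decide +kernel

lemma tabE8_vec (v : Fin (dlE8 6) → DualNumber ℤ) (hv : v = vl (dlE8 6) [(1, 0), (0, 0)]) :
    (fun M : Fam 8 dlE8 (DualNumber ℤ) =>
        (M 6 5).mulVec (
        (M 5 4).mulVec (
        (M 4 3).mulVec (
        (M 3 2).mulVec (
        (M 2 7).mulVec (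
        (M 7 2).mulVec (
        (M 2 3).mulVec (
        (M 3 4).mulVec (
        (M 4 5).mulVec (
        (M 5 6).mulVec (
        (M 6 5).mulVec (
        (M 5 4).mulVec (
        (M 4 3).mulVec (
        (M 3 2).mulVec (
        (M 2 7).mulVec (
        (M 7 2).mulVec (
        (M 2 3).mulVec (
        (M 3 2).mulVec (
        (M 2 3).mulVec (
        (M 3 2).mulVec (
        (M 2 3).mulVec (
        (M 3 2).mulVec (
        (M 2 7).mulVec (
        (M 7 2).mulVec (
        (M 2 3).mulVec (
        (M 3 4).mulVec (
        (M 4 5).mulVec (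
        (M 5 6).mulVec v)))))))))))))))))))))))))))) (tabFam tabE8 8 dlE8) = vl (dlE8 6) [(0, 0), (0, -1)] := by
  subst hv
  dsimp only
  rw [tab_step tabE8 5 6 [(1, 0), (0, 0)]
    [(1, 0), (0, 0), (0, 0)] (by decide +kernel)]
  rw [tab_step tabE8 4 5 [(1, 0), (0, 0), (0, 0)]
    [(1, 0), (0, 0), (0, 0), (0, 0)] (by decide +kernel)]
  rw [tab_step tabE8 3 4 [(1, 0), (0, 0), (0, 0), (0, 0)]
    [(1, 0), (0, 0), (0, 0), (0, 0), (0, 0)] (by decide +kernel)]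
  rw [tab_step tabE8 2 3 [(1, 0), (0, 0), (0, 0), (0, 0), (0, 0)]
    [(1, 0), (0, 0), (0, 0), (0, 0), (0, 0), (0, 0)] (by decide +kernel)]
  rw [tab_step tabE8 7 2 [(1, 0), (0, 0), (0, 0), (0, 0), (0, 0), (0, 0)]
    [(1, 0), (0, 0), (0, 0)] (by decide +kernel)]
  rw [tab_step tabE8 2 7 [(1, 0), (0, 0), (0, 0)]
    [(0, 0), (1, 0), (0, 0), (0, 0), (0, 0), (0, 0)] (by decide +kernel)]
  rw [tab_step tabE8 3 2 [(0, 0), (1, 0), (0, 0), (0, 0), (0, 0), (0, 0)]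
    [(0, 0), (1, 0), (0, 0), (0, 0), (0, 0)] (by decide +kernel)]
  rw [tab_step tabE8 2 3 [(0, 0), (1, 0), (0, 0), (0, 0), (0, 0)]
    [(0, 0), (0, 0), (1, 0), (0, 0), (0, 0), (0, 0)] (by decide +kernel)]
  rw [tab_step tabE8 3 2 [(0, 0), (0, 0), (1, 0), (0, 0), (0, 0), (0, 0)]
    [(0, 0), (0, 0), (1, 0), (0, 0), (0, 0)] (by decide +kernel)]
  rw [tab_step tabE8 2 3 [(0, 0), (0, 0), (1, 0), (0, 0), (0, 0)]
    [(0, 0), (0, 0), (0, 0), (1, 0), (0, 0), (0, 0)] (by decide +kernel)]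
  rw [tab_step tabE8 3 2 [(0, 0), (0, 0), (0, 0), (1, 0), (0, 0), (0, 0)]
    [(0, 0), (0, 0), (0, 0), (1, 0), (0, 0)] (by decide +kernel)]
  rw [tab_step tabE8 2 3 [(0, 0), (0, 0), (0, 0), (1, 0), (0, 0)]
    [(0, 0), (0, 0), (0, 0), (0, 0), (1, 0), (0, 0)] (by decide +kernel)]
  rw [tab_step tabE8 7 2 [(0, 0), (0, 0), (0, 0), (0, 0), (1, 0), (0, 0)]
    [(0, 0), (0, 0), (1, 0)] (by decide +kernel)]
  rw [tab_step tabE8 2 7 [(0, 0), (0, 0), (1, 0)]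
    [(0, -1), (0, 0), (0, 0), (0, 0), (0, 0), (1, 0)] (by decide +kernel)]
  rw [tab_step tabE8 3 2 [(0, -1), (0, 0), (0, 0), (0, 0), (0, 0), (1, 0)]
    [(0, 0), (0, 0), (0, 0), (0, 0), (1, 0)] (by decide +kernel)]
  rw [tab_step tabE8 4 3 [(0, 0), (0, 0), (0, 0), (0, 0), (1, 0)]
    [(0, 0), (0, 0), (0, 0), (1, 0)] (by decide +kernel)]
  rw [tab_step tabE8 5 4 [(0, 0), (0, 0), (0, 0), (1, 0)]
    [(0, 0), (0, 0), (1, 0)] (by decide +kernel)]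
  rw [tab_step tabE8 6 5 [(0, 0), (0, 0), (1, 0)]
    [(0, 0), (1, 0)] (by decide +kernel)]
  rw [tab_step tabE8 5 6 [(0, 0), (1, 0)]
    [(0, 0), (0, -1), (0, 0)] (by decide +kernel)]
  rw [tab_step tabE8 4 5 [(0, 0), (0, -1), (0, 0)]
    [(0, 0), (0, 0), (0, -1), (0, 0)] (by decide +kernel)]
  rw [tab_step tabE8 3 4 [(0, 0), (0, 0), (0, -1), (0, 0)]
    [(0, 0), (0, 0), (0, 0), (0, -1), (0, 0)] (by decide +kernel)]
  rw [tab_step tabE8 2 3 [(0, 0), (0, 0), (0, 0), (0, -1), (0, 0)]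
    [(0, 0), (0, 0), (0, 0), (0, 0), (0, -1), (0, 0)] (by decide +kernel)]
  rw [tab_step tabE8 7 2 [(0, 0), (0, 0), (0, 0), (0, 0), (0, -1), (0, 0)]
    [(0, 0), (0, 0), (0, -1)] (by decide +kernel)]
  rw [tab_step tabE8 2 7 [(0, 0), (0, 0), (0, -1)]
    [(0, 0), (0, 0), (0, 0), (0, 0), (0, 0), (0, -1)] (by decide +kernel)]
  rw [tab_step tabE8 3 2 [(0, 0), (0, 0), (0, 0), (0, 0), (0, 0), (0, -1)]
    [(0, 0), (0, 0), (0, 0), (0, 0), (0, -1)] (by decide +kernel)]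
  rw [tab_step tabE8 4 3 [(0, 0), (0, 0), (0, 0), (0, 0), (0, -1)]
    [(0, 0), (0, 0), (0, 0), (0, -1)] (by decide +kernel)]
  rw [tab_step tabE8 5 4 [(0, 0), (0, 0), (0, 0), (0, -1)]
    [(0, 0), (0, 0), (0, -1)] (by decide +kernel)]
  rw [tab_step tabE8 6 5 [(0, 0), (0, 0), (0, -1)]
    [(0, 0), (0, -1)] (by decide +kernel)]

end Tab

section EFin

lemma ne_of_vec {k : ℕ} (W : Matrix (Fin k) (Fin k) (DualNumber ℤ)) (v w : Fin k → DualNumber ℤ)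
    (h : W.mulVec v = w) (i : Fin k) (hi : (w i).snd ≠ 0)
    (hv : ∃ j, v j = 1 ∧ ∀ l, l ≠ j → v l = 0) :
    W.map iot ≠ 0 := by
  obtain ⟨j, hj, hl⟩ := hv
  have hw : W i j = w i := by
    rw [← h, Matrix.mulVec, dotProduct, Finset.sum_eq_single j]
    · rw [hj, mul_one]
    · intro b _ hb; rw [hl b hb, mul_zero]
    · simp
  intro h0
  have := congrFun (congrFun h0 i) j
  rw [Matrix.map_apply, hw] at this
  exact iot_ne hi this

lemma assoc0 {a b c : ℕ} {A : Matrix (Fin a) (Fin b) ℂ} {B : Matrix (Fin b) (Fin c) ℂ}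
    (h : A * B = 0) (k : ℕ) (Y : Matrix (Fin c) (Fin k) ℂ) : A * (B * Y) = 0 := by
  rw [← Matrix.mul_assoc, h, Matrix.zero_mul]

lemma assoc2 {a b c d : ℕ} {A : Matrix (Fin a) (Fin b) ℂ} {B : Matrix (Fin b) (Fin c) ℂ}
    {C : Matrix (Fin a) (Fin d) ℂ} {D : Matrix (Fin d) (Fin c) ℂ}
    (h : A * B = C * D) (k : ℕ) (Y : Matrix (Fin c) (Fin k) ℂ) : A * (B * Y) = C * (D * Y) := by
  rw [← Matrix.mul_assoc, h, Matrix.mul_assoc]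

theorem case_E6 (G : SimpleGraph (Fin 6)) [DecidableRel G.Adj]
    (hG : ∀ i j : Fin 6, G.Adj i j ↔ EAdj E6edges i.val j.val)
    (ε : Arrow G → ℂ) (hε1 : ∀ a : Arrow G, ε a = 1 ∨ ε a = -1)
    (hε2 : ∀ a : Arrow G, ε (star a) = - ε a) :
    ∃ x : R G dlE6 ⧸ Irel G dlE6 ε, x ≠ 0 ∧ IsNilpotent x := by
  let W : ∀ (S : Type) [CommRing S], Fam 6 dlE6 S → Matrix (Fin (dlE6 5)) (Fin (dlE6 5)) S :=
    fun S _ M => (M 5 2 * (M 2 1 * M 1 2) * M 2 5) *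
      (M 5 2 * (M 2 1 * M 1 2) * (M 2 1 * M 1 2) * M 2 5)
  have hW : ∀ (S T : Type) [CommRing S] [CommRing T] (φ : S →+* T) (M : Fam 6 dlE6 S),
      W T (fun i j => (M i j).map φ) = (W S M).map φ := by
    intro S T _ _ φ M
    simp only [W, Matrix.map_mul]
  refine key G dlE6 ε hε1 hε2 5 W hW ?_ (DualNumber ℂ) _ ((tabE6_isPt G hG).map iot) ?_
  · intro M hM
    have r0 := hM.rel1 0 1 
      (by simp only [hG, EAdj]; decide +kernel)
    have r1 := hM.rel2 1 0 2 (by decide) (by decide) 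
      (by simp only [hG, EAdj]; decide +kernel)
    have r2 := hM.rel3 2 1 3 5 (by decide) (by decide) (by decide) 
      (by simp only [hG, EAdj]; decide +kernel)
    have r3 := hM.rel2 3 2 4 (by decide) (by decide) 
      (by simp only [hG, EAdj]; decide +kernel)
    have r4 := hM.rel1 4 3 
      (by simp only [hG, EAdj]; decide +kernel)
    have r5 := hM.rel1 5 2 
      (by simp only [hG, EAdj]; decide +kernel)
    have hB : M 2 1 * M 1 2 - M 2 5 * M 5 2 = M 2 3 * M 3 2 := by rw [← r2]; abel
    have t0 := assoc0 r0
    have t1 := assoc2 r1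
    have t3 := assoc2 r3.symm
    have t4 := assoc0 r4
    obtain ⟨a1, a2, a3⟩ := rect_E6 (M 5 2) (M 2 5) (M 2 1 * M 1 2) r5
      (by simp only [Matrix.mul_assoc, t1, t0, Matrix.mul_zero])
      (by rw [hB]; simp only [Matrix.mul_assoc, t3, t4, Matrix.mul_zero])
    exact two_by_two rfl _ _ a1 a2 a3
  · rw [hW]
    have hv : (W _ (tabFam tabE6 6 dlE6)).mulVec (vl (dlE6 5) [(1, 0), (0, 0)]) =
        vl (dlE6 5) [(0, 0), (0, -1)] := by
      simp only [W, ← Matrix.mulVec_mulVec]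
      exact tabE6_vec _ rfl
    exact ne_of_vec _ _ _ hv (1 : Fin 2) (by decide +kernel) ⟨(0 : Fin 2),
      (by decide +kernel : vl 2 [(1, 0), (0, 0)] 0 = 1 ∧
        ∀ l : Fin 2, l ≠ 0 → vl 2 [(1, 0), (0, 0)] l = 0)⟩

theorem case_E7 (G : SimpleGraph (Fin 7)) [DecidableRel G.Adj]
    (hG : ∀ i j : Fin 7, G.Adj i j ↔ EAdj E7edges i.val j.val)
    (ε : Arrow G → ℂ) (hε1 : ∀ a : Arrow G, ε a = 1 ∨ ε a = -1)
    (hε2 : ∀ a : Arrow G, ε (star a) = - ε a) :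
    ∃ x : R G dlE7 ⧸ Irel G dlE7 ε, x ≠ 0 ∧ IsNilpotent x := by
  let W : ∀ (S : Type) [CommRing S], Fam 7 dlE7 S → Matrix (Fin (dlE7 0)) (Fin (dlE7 0)) S :=
    fun S _ M => (M 0 1 * M 1 2 * (M 2 6 * M 6 2) * (M 2 1 * M 1 0)) *
      (M 0 1 * M 1 2 * (M 2 6 * M 6 2) * (M 2 1 * M 1 2) * (M 2 6 * M 6 2) * (M 2 1 * M 1 0))
  have hW : ∀ (S T : Type) [CommRing S] [CommRing T] (φ : S →+* T) (M : Fam 7 dlE7 S),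
      W T (fun i j => (M i j).map φ) = (W S M).map φ := by
    intro S T _ _ φ M
    simp only [W, Matrix.map_mul]
  refine key G dlE7 ε hε1 hε2 0 W hW ?_ (DualNumber ℂ) _ ((tabE7_isPt G hG).map iot) ?_
  · intro M hM
    have r0 := hM.rel1 0 1 
      (by simp only [hG, EAdj]; decide +kernel)
    have r1 := hM.rel2 1 0 2 (by decide) (by decide) 
      (by simp only [hG, EAdj]; decide +kernel)
    have r2 := hM.rel3 2 1 3 6 (by decide) (by decide) (by decide) 
      (by simp only [hG, EAdj]; decide +kernel)
    have r3 := hM.rel2 3 2 4 (by decide) (by decide) 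
      (by simp only [hG, EAdj]; decide +kernel)
    have r4 := hM.rel2 4 3 5 (by decide) (by decide) 
      (by simp only [hG, EAdj]; decide +kernel)
    have r5 := hM.rel1 5 4 
      (by simp only [hG, EAdj]; decide +kernel)
    have r6 := hM.rel1 6 2 
      (by simp only [hG, EAdj]; decide +kernel)
    have hB : M 2 1 * M 1 2 - M 2 6 * M 6 2 = M 2 3 * M 3 2 := by rw [← r2]; abel
    have t0 := assoc0 r0
    have t1 := assoc2 r1
    have t1s := assoc2 r1.symm
    have t3 := assoc2 r3.symm
    have t4 := assoc2 r4.symm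
    have t5 := assoc0 r5
    have t6 := assoc0 r6
    obtain ⟨a1, a2, a3⟩ := rect_E7 (M 0 1 * M 1 2) (M 2 1 * M 1 0) (M 2 6 * M 6 2)
      (M 2 1 * M 1 2)
      (by simp only [Matrix.mul_assoc, t1s])
      (by simp only [Matrix.mul_assoc, t6, Matrix.mul_zero])
      (by simp only [Matrix.mul_assoc, t1, t0])
      (by simp only [Matrix.mul_assoc, t1, r0, Matrix.mul_zero])
      (by simp only [Matrix.mul_assoc, t1, t0, Matrix.mul_zero])
      (by rw [hB]; simp only [Matrix.mul_assoc, t3, t4, t5, Matrix.mul_zero])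
    exact two_by_two rfl _ _ a1 a2 a3
  · rw [hW]
    have hv : (W _ (tabFam tabE7 7 dlE7)).mulVec (vl (dlE7 0) [(1, 0), (0, 0)]) =
        vl (dlE7 0) [(0, 0), (0, 1)] := by
      simp only [W, ← Matrix.mulVec_mulVec]
      exact tabE7_vec _ rfl
    exact ne_of_vec _ _ _ hv (1 : Fin 2) (by decide +kernel) ⟨(0 : Fin 2),
      (by decide +kernel : vl 2 [(1, 0), (0, 0)] 0 = 1 ∧
        ∀ l : Fin 2, l ≠ 0 → vl 2 [(1, 0), (0, 0)] l = 0)⟩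

theorem case_E8 (G : SimpleGraph (Fin 8)) [DecidableRel G.Adj]
    (hG : ∀ i j : Fin 8, G.Adj i j ↔ EAdj E8edges i.val j.val)
    (ε : Arrow G → ℂ) (hε1 : ∀ a : Arrow G, ε a = 1 ∨ ε a = -1)
    (hε2 : ∀ a : Arrow G, ε (star a) = - ε a) :
    ∃ x : R G dlE8 ⧸ Irel G dlE8 ε, x ≠ 0 ∧ IsNilpotent x := by
  let W : ∀ (S : Type) [CommRing S], Fam 8 dlE8 S → Matrix (Fin (dlE8 6)) (Fin (dlE8 6)) S :=
    fun S _ M => (M 6 5 * M 5 4 * M 4 3 * M 3 2 * (M 2 7 * M 7 2) * (M 2 3 * M 3 4 * M 4 5 * M 5 6)) *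
      (M 6 5 * M 5 4 * M 4 3 * M 3 2 * (M 2 7 * M 7 2) * (M 2 3 * M 3 2) * (M 2 3 * M 3 2) * (M 2 3 * M 3 2) * (M 2 7 * M 7 2) *
        (M 2 3 * M 3 4 * M 4 5 * M 5 6))
  have hW : ∀ (S T : Type) [CommRing S] [CommRing T] (φ : S →+* T) (M : Fam 8 dlE8 S),
      W T (fun i j => (M i j).map φ) = (W S M).map φ := by
    intro S T _ _ φ M
    simp only [W, Matrix.map_mul]
  refine key G dlE8 ε hε1 hε2 6 W hW ?_ (DualNumber ℂ) _ ((tabE8_isPt G hG).map iot) ?_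
  · intro M hM
    have r0 := hM.rel1 0 1 
      (by simp only [hG, EAdj]; decide +kernel)
    have r1 := hM.rel2 1 0 2 (by decide) (by decide) 
      (by simp only [hG, EAdj]; decide +kernel)
    have r2 := hM.rel3 2 1 3 7 (by decide) (by decide) (by decide) 
      (by simp only [hG, EAdj]; decide +kernel)
    have r3 := hM.rel2 3 2 4 (by decide) (by decide) 
      (by simp only [hG, EAdj]; decide +kernel)
    have r4 := hM.rel2 4 3 5 (by decide) (by decide) 
      (by simp only [hG, EAdj]; decide +kernel)
    have r5 := hM.rel2 5 4 6 (by decide) (by decide) 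
      (by simp only [hG, EAdj]; decide +kernel)
    have r6 := hM.rel1 6 5 
      (by simp only [hG, EAdj]; decide +kernel)
    have r7 := hM.rel1 7 2 
      (by simp only [hG, EAdj]; decide +kernel)
    have hB : M 2 7 * M 7 2 + M 2 3 * M 3 2 = M 2 1 * M 1 2 := by rw [← r2]; abel
    have t0 := assoc0 r0
    have t1 := assoc2 r1
    have t3 := assoc2 r3.symm
    have t4 := assoc2 r4.symm
    have t5 := assoc2 r5.symm
    have s3 := assoc2 r3
    have s4 := assoc2 r4
    have s5 := assoc2 r5
    have t6 := assoc0 r6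
    have t7 := assoc0 r7
    obtain ⟨a1, a2, a3⟩ := rect_E8 (M 6 5 * M 5 4 * M 4 3 * M 3 2) (M 2 3 * M 3 4 * M 4 5 * M 5 6)
      (M 2 7 * M 7 2) (M 2 3 * M 3 2)
      (by simp only [Matrix.mul_assoc, s3, s4, s5])
      (by simp only [Matrix.mul_assoc, t7, Matrix.mul_zero])
      (by simp only [Matrix.mul_assoc, t3, t4, t5, t6, Matrix.mul_zero])
      (by simp only [Matrix.mul_assoc, t3, t4, t5, r6, Matrix.mul_zero])
      (by simp only [Matrix.mul_assoc, t3, t4, t5, t6, Matrix.mul_zero])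
      (by rw [hB]; simp only [Matrix.mul_assoc, t1, t0, Matrix.mul_zero])
    exact two_by_two rfl _ _ a1 a2 a3
  · rw [hW]
    have hv : (W _ (tabFam tabE8 8 dlE8)).mulVec (vl (dlE8 6) [(1, 0), (0, 0)]) =
        vl (dlE8 6) [(0, 0), (0, -1)] := by
      simp only [W, ← Matrix.mulVec_mulVec]
      exact tabE8_vec _ rfl
    exact ne_of_vec _ _ _ hv (1 : Fin 2) (by decide +kernel) ⟨(0 : Fin 2),
      (by decide +kernel : vl 2 [(1, 0), (0, 0)] 0 = 1 ∧
        ∀ l : Fin 2, l ≠ 0 → vl 2 [(1, 0), (0, 0)] l = 0)⟩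

end EFin

section DCase

lemma nil_two {k : ℕ} (hk : k = 2) (N : Matrix (Fin k) (Fin k) ℂ) (h : IsNilpotent N) :
    N * N = 0 := by
  subst hk
  have ht : N.trace = 0 := (Matrix.isNilpotent_trace_of_isNilpotent h).eq_zero
  have hd : N.det = 0 := by
    obtain ⟨r, hr⟩ := h
    have : N.det ^ r = 0 ∨ r = 0 := by
      by_cases h0 : r = 0
      · exact Or.inr h0
      · left
        rw [← Matrix.det_pow, hr, Matrix.det_zero]
    rcases this with h1 | h1
    · exact eq_zero_of_pow_eq_zero h1
    · subst h1
      rw [pow_zero] at hr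
      exact absurd hr one_ne_zero
  rw [Matrix.trace_fin_two] at ht
  rw [Matrix.det_fin_two] at hd
  ext i j
  fin_cases i <;> fin_cases j <;> simp [Matrix.mul_apply, Fin.sum_univ_two]
  · linear_combination (N 0 0) * ht - hd
  · linear_combination (N 0 1) * ht
  · linear_combination (N 1 0) * ht
  · linear_combination (N 1 1) * ht - hd

lemma isPt_of {n : ℕ} {G : SimpleGraph (Fin n)} {δ : Fin n → ℕ} {S : Type} [CommRing S]
    {M : Fam n δ S} (h0 : ∀ i j, ¬ G.Adj i j → M i j = 0)
    (h : ∀ i, ∃ s : Finset (Fin n), (∀ j, G.Adj i j → j ∈ s) ∧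
      ∑ j ∈ s, sg i j • (M i j * M j i) = 0) : IsPt G δ M := by
  refine ⟨h0, fun i => ?_⟩
  obtain ⟨s, hs, h⟩ := h i
  rw [← h]
  symm
  apply Finset.sum_subset (Finset.subset_univ s)
  intro j _ hj
  rw [h0 i j (fun hh => hj (hs j hh))]
  simp

/-- The square-zero element. -/
abbrev ee : DualNumber ℂ := DualNumber.eps

lemma ee_sq : ee * ee = 0 := DualNumber.eps_mul_eps

/-- The endomorphism along the chain. -/
def LL (p q : ℕ) : DualNumber ℂ :=
  if p = 0 then (if q = 0 then -2 * ee else 2) else (if q = 0 then 0 else 2 * ee)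

/-- The point over the dual numbers for `D_{k+4}`. -/
def zN (k i j p q : ℕ) : DualNumber ℂ :=
  if i = k + 1 ∧ j = k + 2 then (if p = 0 then 1 else 0)
  else if i = k + 2 ∧ j = k + 1 then (if q = 0 then 0 else 1)
  else if i = k + 1 ∧ j = k + 3 then (if p = 0 then 1 else 2 * ee)
  else if i = k + 3 ∧ j = k + 1 then (if q = 0 then -2 * ee else 1)
  else if i = 1 ∧ j = 0 then (if p = 0 then 1 else ee)
  else if i = 0 ∧ j = 1 then (if q = 0 then -2 * ee else 2)
  else if j = i + 1 ∧ 1 ≤ i ∧ i ≤ k then LL p q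
  else if i = j + 1 ∧ 1 ≤ j ∧ j ≤ k then (if p = q then 1 else 0)
  else 0

lemma z_ca (k p q : ℕ) : zN k (k+1) (k+2) p q = if p = 0 then 1 else 0 := by
  simp [zN]
lemma z_ac (k p q : ℕ) : zN k (k+2) (k+1) p q = if q = 0 then 0 else 1 := by
  simp [zN]
lemma z_cb (k p q : ℕ) : zN k (k+1) (k+3) p q = if p = 0 then 1 else 2 * ee := by
  simp [zN]
lemma z_bc (k p q : ℕ) : zN k (k+3) (k+1) p q = if q = 0 then -2 * ee else 1 := by
  simp [zN]
lemma z_10 (k p q : ℕ) : zN k 1 0 p q = if p = 0 then 1 else ee := by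
  simp [zN]
lemma z_01 (k p q : ℕ) : zN k 0 1 p q = if q = 0 then -2 * ee else 2 := by
  simp [zN]
lemma z_up (k i p q : ℕ) (h1 : 1 ≤ i) (h2 : i ≤ k) : zN k i (i+1) p q = LL p q := by
  unfold zN
  rw [if_neg (by omega), if_neg (by omega), if_neg (by omega), if_neg (by omega),
    if_neg (by omega), if_neg (by omega), if_pos (by omega)]
lemma z_down (k i p q : ℕ) (h1 : 1 ≤ i) (h2 : i ≤ k) :
    zN k (i+1) i p q = if p = q then 1 else 0 := by
  unfold zN
  rw [if_neg (by omega), if_neg (by omega), if_neg (by omega), if_neg (by omega),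
    if_neg (by omega), if_neg (by omega), if_neg (by omega), if_pos (by omega)]

/-- Entries of the two-step products. -/
def zF (k i j p q : ℕ) : DualNumber ℂ :=
  ∑ r ∈ Finset.range (Dδ (k + 4) j), zN k i j p r * zN k j i r q

lemma F_1 (k i j p q : ℕ) (h : j = 0 ∨ j = k + 2 ∨ j = k + 3) :
    zF k i j p q = zN k i j p 0 * zN k j i 0 q := by
  have : Dδ (k + 4) j = 1 := by unfold Dδ; rw [if_pos (by omega)]
  rw [zF, this, Finset.sum_range_one]

lemma F_2 (k i j p q : ℕ) (h : 1 ≤ j ∧ j ≤ k + 1) :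
    zF k i j p q = zN k i j p 0 * zN k j i 0 q + zN k i j p 1 * zN k j i 1 q := by
  have : Dδ (k + 4) j = 2 := by unfold Dδ; rw [if_neg (by omega)]
  rw [zF, this, Finset.sum_range_succ, Finset.sum_range_one]

lemma F_down (k i p q : ℕ) (h : i ≤ k) (hp : p < 2) (hq : q < 2) :
    zF k (i + 1) i p q = LL p q := by
  have he := ee_sq
  rcases Nat.eq_zero_or_pos i with h0 | h0
  · subst h0
    rw [F_1 _ _ _ _ _ (by omega), zero_add, z_10, z_01]
    interval_cases p <;> interval_cases q <;> simp [LL]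
    · linear_combination 2 * he
    · ring
  · rw [F_2 _ _ _ _ _ (by omega), z_down _ _ _ _ h0 h, z_down _ _ _ _ h0 h, z_up _ _ _ _ h0 h,
      z_up _ _ _ _ h0 h]
    interval_cases p <;> interval_cases q <;> simp [LL]

lemma F_up (k i p q : ℕ) (h : i ≤ k) (h0 : 1 ≤ i) (hp : p < 2) (hq : q < 2) :
    zF k i (i + 1) p q = LL p q := by
  rw [F_2 _ _ _ _ _ (by omega), z_down _ _ _ _ h0 h, z_down _ _ _ _ h0 h, z_up _ _ _ _ h0 h,
      z_up _ _ _ _ h0 h]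
  interval_cases p <;> interval_cases q <;> simp [LL]

lemma F_c (k p q : ℕ) (hp : p < 2) (hq : q < 2) :
    zF k (k + 1) (k + 2) p q + zF k (k + 1) (k + 3) p q = LL p q := by
  have he := ee_sq
  rw [F_1 _ _ _ _ _ (by omega), F_1 _ _ _ _ _ (by omega), z_ca, z_ac, z_cb, z_bc]
  interval_cases p <;> interval_cases q <;> simp [LL]
  · norm_num
  · linear_combination 4 * he

lemma F_a (k : ℕ) : zF k (k + 2) (k + 1) 0 0 = 0 := by
  rw [F_2 _ _ _ _ _ (by omega), z_ca, z_ac, z_ca, z_ac]; simp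

lemma F_b (k : ℕ) : zF k (k + 3) (k + 1) 0 0 = 0 := by
  rw [F_2 _ _ _ _ _ (by omega), z_cb, z_bc, z_cb, z_bc]; simp

lemma F_0 (k : ℕ) : zF k 0 1 0 0 = 0 := by
  rw [F_2 _ _ _ _ _ (by omega), z_01, z_10, z_01, z_10]; simp

lemma zN_zero (k i j p q : ℕ) (h : ¬ (DAdj (k + 4) i j ∨ DAdj (k + 4) j i)) :
    zN k i j p q = 0 := by
  unfold DAdj at h
  unfold zN
  rw [if_neg (by omega), if_neg (by omega), if_neg (by omega), if_neg (by omega),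
    if_neg (by omega), if_neg (by omega), if_neg (by omega), if_neg (by omega)]

/-- The family of matrices over the dual numbers. -/
def zM (k : ℕ) (δ : Fin (k + 4) → ℕ) : Fam (k + 4) δ (DualNumber ℂ) :=
  fun i j p q => zN k i j p q

lemma zFam_mul {k : ℕ} {δ : Fin (k + 4) → ℕ} (hδ : ∀ i, δ i = Dδ (k + 4) i.val)
    (i j : Fin (k + 4)) (p q : Fin (δ i)) :
    (zM k δ i j * zM k δ j i) p q =
    zF k i j p q := by
  rw [Matrix.mul_apply, zF, ← hδ, Finset.sum_range]
  rfl

lemma sum_entry {k : ℕ} {δ : Fin (k + 4) → ℕ} (hδ : ∀ i, δ i = Dδ (k + 4) i.val)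
    (i : Fin (k + 4)) (s : Finset (Fin (k + 4)))
    (h : ∀ p q : ℕ, p < δ i → q < δ i → ∑ j ∈ s, sg i j • zF k i j p q = 0) :
    ∑ j ∈ s, sg i j • (zM k δ i j * zM k δ j i) = 0 := by
  refine Matrix.ext fun p q => ?_
  rw [Matrix.sum_apply, Matrix.zero_apply, ← h p q p.2 q.2]
  refine Finset.sum_congr rfl fun j _ => ?_
  rw [Matrix.smul_apply, zFam_mul hδ]

theorem case_D (k : ℕ) (G : SimpleGraph (Fin (k + 4))) [DecidableRel G.Adj]
    (hG : ∀ i j : Fin (k + 4), G.Adj i j ↔ (DAdj (k + 4) i.val j.val ∨ DAdj (k + 4) j.val i.val))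
    (δ : Fin (k + 4) → ℕ) (hδ : ∀ i, δ i = Dδ (k + 4) i.val)
    (ε : Arrow G → ℂ) (hε1 : ∀ a : Arrow G, ε a = 1 ∨ ε a = -1)
    (hε2 : ∀ a : Arrow G, ε (star a) = - ε a) :
    ∃ x : R G δ ⧸ Irel G δ ε, x ≠ 0 ∧ IsNilpotent x := by
  have d2 : ∀ i : Fin (k + 4), 1 ≤ i.val → i.val ≤ k + 1 → δ i = 2 := by
    intro i h1 h2
    rw [hδ]; unfold Dδ; rw [if_neg (by omega)]
  have d1 : ∀ i : Fin (k + 4), i.val = 0 ∨ i.val = k + 2 ∨ i.val = k + 3 → δ i = 1 := by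
    intro i h1
    rw [hδ]; unfold Dδ; rw [if_pos (by omega)]
  obtain ⟨c, hc⟩ : ∃ c : Fin (k + 4), c.val = k + 1 := ⟨⟨k + 1, by omega⟩, rfl⟩
  obtain ⟨a, ha⟩ : ∃ c : Fin (k + 4), c.val = k + 2 := ⟨⟨k + 2, by omega⟩, rfl⟩
  obtain ⟨b, hb⟩ : ∃ c : Fin (k + 4), c.val = k + 3 := ⟨⟨k + 3, by omega⟩, rfl⟩
  let W : ∀ (S : Type) [CommRing S], Fam (k + 4) δ S → Matrix (Fin (δ c)) (Fin (δ c)) S :=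
    fun S _ M => (M c a * M a c) * (M c b * M b c)
  have hW : ∀ (S T : Type) [CommRing S] [CommRing T] (φ : S →+* T) (M : Fam (k + 4) δ S),
      W T (fun i j => (M i j).map φ) = (W S M).map φ := by
    intro S T _ _ φ M
    simp only [W, Matrix.map_mul]
  refine key G δ ε hε1 hε2 c W hW ?_ (DualNumber ℂ) (zM k δ) ?_ ?_
  · intro M hM
    have r0 := hM.rel1 ⟨0, by omega⟩ ⟨1, by omega⟩
      (by intro x; rw [hG]; simp only [DAdj, Fin.ext_iff]; omega)
    have ra := hM.rel1 a c (by intro x; rw [hG]; simp only [DAdj, Fin.ext_iff]; omega)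
    have rb := hM.rel1 b c (by intro x; rw [hG]; simp only [DAdj, Fin.ext_iff]; omega)
    have chain : ∀ (r : ℕ) (hr : r ≤ k),
        (M ⟨r + 1, by omega⟩ ⟨r, by omega⟩ * M ⟨r, _⟩ ⟨r + 1, by omega⟩) ^ (r + 2) = 0 := by
      intro r
      induction r with
      | zero =>
        intro hr
        have r0' : M ⟨0, by omega⟩ ⟨0 + 1, by omega⟩ * M ⟨0 + 1, _⟩ ⟨0, by omega⟩ = 0 := r0
        rw [mul_pow_succ_rect, r0', zero_pow (by omega), Matrix.mul_zero, Matrix.zero_mul]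
      | succ r ih =>
        intro hr
        have r2 := hM.rel2 ⟨r + 1, by omega⟩ ⟨r, by omega⟩ ⟨r + 2, by omega⟩
          (by simp [Fin.lt_def]) (by simp [Fin.lt_def])
          (by intro x; rw [hG]; simp only [DAdj, Fin.ext_iff]; omega)
        rw [mul_pow_succ_rect, r2, ih (by omega)]
        simp
    have rc := hM.rel3 c ⟨k, by omega⟩ a b (by simp [Fin.lt_def, hc])
      (by simp [Fin.lt_def, hc, ha]) (by simp [Fin.lt_def, ha, hb])
      (by intro x; rw [hG]; simp only [DAdj, Fin.ext_iff]; omega)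
    have hnil : IsNilpotent (M c a * M a c + M c b * M b c) := by
      rw [rc]
      obtain rfl : c = ⟨k + 1, Nat.add_lt_add_left (by decide) k⟩ := Fin.ext hc
      exact ⟨k + 2, chain k le_rfl⟩
    have hk : δ c = 2 := d2 c (by omega) (by omega)
    have hsq := nil_two hk _ hnil
    have hA : (M c a * M a c) * (M c a * M a c) = 0 := by
      rw [Matrix.mul_assoc, ← Matrix.mul_assoc (M a c), ra]; simp
    have hB : (M c b * M b c) * (M c b * M b c) = 0 := by
      rw [Matrix.mul_assoc, ← Matrix.mul_assoc (M b c), rb]; simp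
    refine two_by_two hk _ _ hA hB ?_
    rw [add_mul, mul_add, mul_add, hA, hB, zero_add, add_zero] at hsq
    exact eq_neg_of_add_eq_zero_left hsq
  · apply isPt_of
    · intro i j hij
      refine Matrix.ext fun p q => ?_
      exact zN_zero _ _ _ _ _ (by rw [← hG]; exact hij)
    · intro i
      have hi := i.2
      obtain h | h | h | h | h : i.val = 0 ∨ (1 ≤ i.val ∧ i.val ≤ k) ∨ i.val = k + 1 ∨
        i.val = k + 2 ∨ i.val = k + 3 := by omega
      · refine ⟨{⟨1, by omega⟩}, ?_, sum_entry hδ _ _ ?_⟩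
        · intro x; rw [hG]; simp only [DAdj, Fin.ext_iff, Finset.mem_singleton]; omega
        · intro p q hp hq
          rw [d1 i (by omega), Nat.lt_one_iff] at hp hq
          rw [Finset.sum_singleton, h, hp, hq, F_0, smul_zero]
      · refine ⟨{⟨i.val - 1, by omega⟩, ⟨i.val + 1, by omega⟩}, ?_, sum_entry hδ _ _ ?_⟩
        · intro x; rw [hG]
          simp only [DAdj, Fin.ext_iff, Finset.mem_singleton, Finset.mem_insert]; omega
        · intro p q hp hq
          rw [d2 i (by omega) (by omega)] at hp hq
          obtain ⟨t, ht⟩ : ∃ t, i.val = t + 1 := ⟨i.val - 1, by omega⟩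
          rw [Finset.sum_pair (by simp only [ne_eq, Fin.ext_iff]; omega)]
          have e1 : sg i ⟨i.val - 1, by omega⟩ = -1 := by
            unfold sg; rw [if_neg (by simp only [Fin.lt_def]; omega)]
          have e2 : sg i ⟨i.val + 1, by omega⟩ = 1 := by
            unfold sg; rw [if_pos (by simp only [Fin.lt_def]; omega)]
          rw [e1, e2]
          simp only [ht, Nat.add_sub_cancel]
          rw [F_down _ _ _ _ (by omega) hp hq, F_up _ _ _ _ (by omega) (by omega) hp hq]
          simp
      · refine ⟨{⟨k, by omega⟩, a, b}, ?_, sum_entry hδ _ _ ?_⟩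
        · intro x; rw [hG]
          simp only [DAdj, Fin.ext_iff, Finset.mem_singleton, Finset.mem_insert]; omega
        · intro p q hp hq
          rw [d2 i (by omega) (by omega)] at hp hq
          rw [Finset.sum_insert (by
              simp only [Finset.mem_singleton, Finset.mem_insert, Fin.ext_iff]; omega),
            Finset.sum_pair (by simp only [ne_eq, Fin.ext_iff]; omega)]
          have e1 : sg i ⟨k, by omega⟩ = -1 := by
            unfold sg; rw [if_neg (by simp only [Fin.lt_def]; omega)]
          have e2 : sg i a = 1 := by
            unfold sg; rw [if_pos (by simp only [Fin.lt_def]; omega)]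
          have e3 : sg i b = 1 := by
            unfold sg; rw [if_pos (by simp only [Fin.lt_def]; omega)]
          rw [e1, e2, e3, one_smul, one_smul, h, ha, hb, F_c _ _ _ hp hq]
          simp only []
          rw [F_down _ _ _ _ (by omega) hp hq]
          simp
      · refine ⟨{c}, ?_, sum_entry hδ _ _ ?_⟩
        · intro x; rw [hG]; simp only [DAdj, Fin.ext_iff, Finset.mem_singleton]; omega
        · intro p q hp hq
          rw [d1 i (by omega), Nat.lt_one_iff] at hp hq
          rw [Finset.sum_singleton, h, hc, hp, hq, F_a, smul_zero]
      · refine ⟨{c}, ?_, sum_entry hδ _ _ ?_⟩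
        · intro x; rw [hG]; simp only [DAdj, Fin.ext_iff, Finset.mem_singleton]; omega
        · intro p q hp hq
          rw [d1 i (by omega), Nat.lt_one_iff] at hp hq
          rw [Finset.sum_singleton, h, hc, hp, hq, F_b, smul_zero]
  · intro h0
    have hk : δ c = 2 := d2 c (by omega) (by omega)
    have h1 := congrFun (congrFun h0 ⟨0, by omega⟩) ⟨1, by omega⟩
    simp only [W] at h1
    rw [Matrix.mul_apply] at h1
    simp only [zFam_mul hδ] at h1
    have h2 : ∑ r ∈ Finset.range (δ c), zF k c a 0 r * zF k c b r 1 = 0 := by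
      rw [Finset.sum_range]; exact h1
    rw [hk, Finset.sum_range_succ, Finset.sum_range_one, hc, ha, hb,
      F_1 _ _ _ _ _ (by omega), F_1 _ _ _ _ _ (by omega), F_1 _ _ _ _ _ (by omega),
      F_1 _ _ _ _ _ (by omega)] at h2
    simp only [z_ca, z_ac, z_cb, z_bc] at h2
    have h3 := congrArg TrivSqZeroExt.snd h2
    simp at h3
    rw [show (2 : DualNumber ℂ) = ((2 : ℕ) : DualNumber ℂ) from rfl,
      TrivSqZeroExt.fst_natCast] at h3
    norm_num at h3

end DCase

/-- For `G` of type `D_n (n ≥ 4)`, `E₆`, `E₇` or `E₈` and `δ_K` the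
coefficient vector of the highest root, the coordinate ring `ℂ[Rep(Π,δ_K)] = R_{δ_K}/I_{δ_K}`
is not reduced: it contains a nonzero nilpotent element. -/
theorem stmt1 (n : ℕ) (G : SimpleGraph (Fin n)) [DecidableRel G.Adj]
    (δ : Fin n → ℕ) (hDyn : IsDynkinDE n G δ)
    (ε : Arrow G → ℂ)
    (hε1 : ∀ a : Arrow G, ε a = 1 ∨ ε a = -1)
    (hε2 : ∀ a : Arrow G, ε (star a) = - ε a) :
    ∃ x : R G δ ⧸ Irel G δ ε, x ≠ 0 ∧ IsNilpotent x := by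
  rcases hDyn with ⟨hn, hG, hδ⟩ | ⟨rfl, hG, hδ⟩ | ⟨rfl, hG, hδ⟩ | ⟨rfl, hG, hδ⟩
  · obtain ⟨k, rfl⟩ : ∃ k, n = k + 4 := ⟨n - 4, by omega⟩
    exact case_D k G hG δ hδ ε hε1 hε2
  · obtain rfl : δ = dlE6 := funext hδ
    exact case_E6 G hG ε hε1 hε2
  · obtain rfl : δ = dlE7 := funext hδ
    exact case_E7 G hG ε hε1 hε2
  · obtain rfl : δ = dlE8 := funext hδ
    exact case_E8 G hG ε hε1 hε2

end Stmt1
end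
end
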